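/- (Refined localization of the cross-section.) For every κ, W, δ₀, m₀ > 0 there exist ε₀, d₀, C > 0 such that: whenever ε ∈ (0, ε₀] and ψ is a centralized stream function of a steady vortex ring with parameters (ε, W, μ), μ ≥ m₀, whose circulation equals κ and whose cross-section A is simply connected, contained in {x : δ₀ ≤ x₁ ≤ 1/δ₀}, and of diameter at most d₀, and p = (p₁, 0) ∈ A is a point at which ψ attains its maximum over the closure of A, then there exists z₁ > 0 with |z₁ − p₁| ≤ C ε² ln(1/ε) such that the Lebesgue measure of the symmetric difference A Δ B_{s₀}((z₁, 0)) is at most C ε⁴ ln(1/ε), where s₀ := ε √(κ/(π z₁)). -/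

import Mathlib

open MeasureTheory Real Filter
open scoped RealInnerProductSpace

noncomputable section

/-- The plane `ℝ²` with the Euclidean norm. -/
abbrev Plane : Type := EuclideanSpace ℝ (Fin 2)

/-- The point `(a, b)` of the plane. -/
def mk2 (a b : ℝ) : Plane := (WithLp.equiv 2 (Fin 2 → ℝ)).symm ![a, b]

/-- The open right half plane `Π = {x : x₁ > 0}`. -/
def halfPlane : Set Plane := {x : Plane | 0 < x 0}

/-- The reflection `x̄ = (−x₁, x₂)` of a point `x = (x₁, x₂)`. -/
def reflPt (x : Plane) : Plane := mk2 (-(x 0)) (x 1)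

/-- The Green function `G_*` on the half plane of the operator `−(1/x₁)div((1/x₁)∇)`. -/
def Gstar (x x' : Plane) : ℝ :=
  x 0 * (x' 0) ^ 2 / (4 * π) *
    ∫ θ in (-π)..π, Real.cos θ /
      Real.sqrt ((x 1 - x' 1) ^ 2 + (x 0) ^ 2 + (x' 0) ^ 2 - 2 * x 0 * x' 0 * Real.cos θ)

/-- The Green function of `−Δ` on the half plane. -/
def Gfun (x x' : Plane) : ℝ :=
  (1 / (4 * π)) * Real.log
    (((x 0 + x' 0) ^ 2 + (x 1 - x' 1) ^ 2) / ((x 0 - x' 0) ^ 2 + (x 1 - x' 1) ^ 2))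

/-- The regular part `H_c(x,x') = G_*(x,x') − c² G(x,x')`. -/
def Hker (c : ℝ) (x x' : Plane) : ℝ := Gstar x x' - c ^ 2 * Gfun x x'

/-- The regular part `H_c`, extended continuously to the diagonal. -/
def HkerExt (c : ℝ) (x x' : Plane) : ℝ := by
  classical
  exact if x = x' then limUnder (nhdsWithin x' {x'}ᶜ) (fun y => Hker c y x')
    else Hker c x x'

/-- The cross-section `A = {x ∈ Π : ψ(x) − (W/2) x₁² ln(1/ε) > μ}`. -/
def crossSection (ψ : Plane → ℝ) (ε W μ : ℝ) : Set Plane :=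
  {x : Plane | x ∈ halfPlane ∧ μ < ψ x - W / 2 * (x 0) ^ 2 * Real.log (1 / ε)}

/-- `ψ` is a stream function of a steady vortex ring with parameters `(ε, W, μ)`. -/
structure IsVortexRingStream (ψ : Plane → ℝ) (ε W μ : ℝ) : Prop where
  continuousOn : ContinuousOn ψ halfPlane
  bounded : Bornology.IsBounded (crossSection ψ ε W μ)
  closure_subset : closure (crossSection ψ ε W μ) ⊆ halfPlane
  repr : ∀ x ∈ halfPlane, ψ x = (∫ x' in crossSection ψ ε W μ, Gstar x x') / ε ^ 2

/-- The circulation `ε⁻² ∫_A x₁ dx` of a vortex ring. -/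
def circulation (ψ : Plane → ℝ) (ε W μ : ℝ) : ℝ :=
  (∫ x in crossSection ψ ε W μ, x 0) / ε ^ 2

/-- `ψ` is centralized: it is even in the second variable. -/
def Centralized (ψ : Plane → ℝ) : Prop :=
  ∀ a b : ℝ, ψ (mk2 a (-b)) = ψ (mk2 a b)

namespace VortexRing

lemma integrableOn_inv_norm_ball (r : ℝ) :
    IntegrableOn (fun y : ℂ => ‖y‖⁻¹) (Metric.ball 0 r) := by
  rw [integrableOn_fun_norm_addHaar (μ := (volume : Measure ℂ)) (f := fun t => t⁻¹)]
  have h : IntegrableOn (fun _ : ℝ => (1 : ℝ)) (Set.Ioo 0 r) := by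
    simp
  refine h.congr_fun (fun y hy => ?_) measurableSet_Ioo
  simp [Complex.finrank_real_complex, hy.1.ne']

lemma integral_inv_norm_ball {r : ℝ} (hr : 0 ≤ r) :
    ∫ y in Metric.ball (0 : ℂ) r, ‖y‖⁻¹ = 2 * π * r := by
  rw [← integral_indicator Metric.isOpen_ball.measurableSet]
  have h1 : (Metric.ball (0 : ℂ) r).indicator (fun y : ℂ => ‖y‖⁻¹)
      = fun y : ℂ => (Set.Iio r).indicator (fun t : ℝ => t⁻¹) ‖y‖ := by
    ext y
    simp [Set.indicator]
  rw [h1, integral_fun_norm_addHaar (volume : Measure ℂ)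
    (fun t => (Set.Iio r).indicator (fun t : ℝ => t⁻¹) t)]
  have h2 : ∫ y in Set.Ioi (0 : ℝ), y ^ (Module.finrank ℝ ℂ - 1) •
      (Set.Iio r).indicator (fun t : ℝ => t⁻¹) y = r := by
    have : ∀ y ∈ Set.Ioi (0 : ℝ), y ^ (Module.finrank ℝ ℂ - 1) •
      (Set.Iio r).indicator (fun t : ℝ => t⁻¹) y = (Set.Iio r).indicator (fun _ => (1 : ℝ)) y := by
      intro y hy
      have hy' : (0 : ℝ) < y := hy
      by_cases hyr : y < r <;> simp [Complex.finrank_real_complex, hyr, hy'.ne']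
    rw [setIntegral_congr_fun measurableSet_Ioi this, setIntegral_indicator measurableSet_Iio,
      Set.Ioi_inter_Iio]
    simp [hr]
  rw [h2]
  simp [Complex.finrank_real_complex, Measure.real, Complex.volume_ball]
  ring

lemma integrableOn_inv_norm_sub {E : Set ℂ} (hv : volume E ≠ ⊤) (x : ℂ) :
    IntegrableOn (fun y => ‖x - y‖⁻¹) E ∧
      ∀ r : ℝ, 0 < r → ∫ y in E, ‖x - y‖⁻¹ ≤ 2 * π * r + volume.real E / r := by
  have key : ∀ r : ℝ, 0 < r →
      IntegrableOn (fun y => (Metric.ball x r).indicator (fun y => ‖x - y‖⁻¹) y + r⁻¹) E ∧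
      ∫ y in E, ((Metric.ball x r).indicator (fun y => ‖x - y‖⁻¹) y + r⁻¹)
        ≤ 2 * π * r + volume.real E / r := by
    intro r hr
    have hI : Integrable ((Metric.ball x r).indicator (fun y => ‖x - y‖⁻¹)) := by
      have h0 := (integrable_indicator_iff Metric.isOpen_ball.measurableSet).2
        (integrableOn_inv_norm_ball r)
      have h1 := h0.comp_sub_left x
      refine h1.congr (Eventually.of_forall fun y => ?_)
      simp [Set.indicator, dist_eq_norm, norm_sub_rev]
    have hval : ∫ y, (Metric.ball x r).indicator (fun y => ‖x - y‖⁻¹) y = 2 * π * r := by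
      rw [← integral_inv_norm_ball hr.le, ← integral_indicator Metric.isOpen_ball.measurableSet,
        ← integral_sub_left_eq_self _ _ x]
      congr 1
      ext y
      simp [Set.indicator, dist_eq_norm]
    have hc : IntegrableOn (fun _ : ℂ => r⁻¹) E := integrableOn_const hv
    refine ⟨hI.integrableOn.add hc, ?_⟩
    rw [integral_add hI.integrableOn hc]
    have h3 : ∫ y in E, (Metric.ball x r).indicator (fun y => ‖x - y‖⁻¹) y ≤ 2 * π * r := by
      rw [← hval]
      exact setIntegral_le_integral hI (Eventually.of_forall fun y =>
        Set.indicator_nonneg (fun _ _ => by positivity) _)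
    simp only [setIntegral_const, smul_eq_mul]
    rw [div_eq_mul_inv]
    linarith
  have hle : ∀ r : ℝ, 0 < r → ∀ y, ‖x - y‖⁻¹ ≤
      (Metric.ball x r).indicator (fun y => ‖x - y‖⁻¹) y + r⁻¹ := by
    intro r hr y
    by_cases hy : y ∈ Metric.ball x r
    · simp only [Set.indicator_of_mem hy]
      have : 0 < r⁻¹ := by positivity
      linarith
    · simp only [Set.indicator_of_notMem hy, zero_add]
      rw [Metric.mem_ball, not_lt, dist_comm, dist_eq_norm] at hy
      gcongr
  have hfi : IntegrableOn (fun y => ‖x - y‖⁻¹) E := by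
    refine (key 1 one_pos).1.mono' (by fun_prop) (Eventually.of_forall fun y => ?_)
    rw [Real.norm_of_nonneg (by positivity)]
    exact hle 1 one_pos y
  exact ⟨hfi, fun r hr => (setIntegral_mono hfi (key r hr).1 (hle r hr)).trans (key r hr).2⟩

lemma integral_inv_norm_sub_le {E : Set ℂ} (hv : volume E ≠ ⊤) (x : ℂ) :
    ∫ y in E, ‖x - y‖⁻¹ ≤ 8 * √(volume.real E) := by
  have h := (integrableOn_inv_norm_sub hv x).2
  rcases (measureReal_nonneg (μ := volume) (s := E)).eq_or_lt with h0 | h0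
  · rw [← h0]
    have : volume E = 0 := by
      rw [eq_comm, measureReal_eq_zero_iff hv] at h0
      exact h0
    rw [Measure.restrict_eq_zero.2 this]
    simp
  · have hs : 0 < √(volume.real E) := Real.sqrt_pos.2 h0
    refine (h _ hs).trans ?_
    have : volume.real E / √(volume.real E) = √(volume.real E) := Real.div_sqrt
    rw [this]
    nlinarith [Real.pi_lt_d2]

lemma abs_log_le_inv_add {t : ℝ} (ht : 0 ≤ t) : |Real.log t| ≤ t⁻¹ + t := by
  rcases ht.eq_or_lt with rfl | ht
  · simp
  · rw [abs_le]
    have h1 := Real.log_le_self ht.le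
    have h2 := Real.log_le_self (inv_pos.2 ht).le
    rw [Real.log_inv] at h2
    have : 0 < t⁻¹ := by positivity
    constructor <;> linarith

lemma integrableOn_log_norm_sub {E : Set ℂ} (hE : MeasurableSet E) (hb : Bornology.IsBounded E)
    (x : ℂ) : IntegrableOn (fun y => Real.log ‖x - y‖) E := by
  have hv : volume E ≠ ⊤ := hb.measure_lt_top.ne
  obtain ⟨R, hR⟩ := hb.subset_closedBall x
  refine ((integrableOn_inv_norm_sub hv x).1.add
    (integrableOn_const (C := R) hv)).mono' ?_ ?_
  · exact (Real.measurable_log.comp (by fun_prop)).aestronglyMeasurable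
  · refine (ae_restrict_mem hE).mono fun y hy => ?_
    have h1 := hR hy
    rw [Metric.mem_closedBall, dist_comm, dist_eq_norm] at h1
    have := abs_log_le_inv_add (norm_nonneg (x - y))
    simp only [Real.norm_eq_abs, Pi.add_apply]
    linarith

end VortexRing

namespace VortexRing

/-- Reflection of the complex plane in the vertical line `re = l`. -/
def mirror (l : ℝ) (y : ℂ) : ℂ := 2 * (l : ℂ) - (starRingEnd ℂ) y

@[simp] lemma mirror_re (l : ℝ) (y : ℂ) : (mirror l y).re = 2 * l - y.re := by
  simp [mirror]

@[simp] lemma mirror_im (l : ℝ) (y : ℂ) : (mirror l y).im = y.im := by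
  simp [mirror]

@[simp] lemma mirror_mirror (l : ℝ) (y : ℂ) : mirror l (mirror l y) = y := by
  apply Complex.ext <;> simp

lemma norm_mirror_sub_mirror (l : ℝ) (x y : ℂ) : ‖mirror l x - mirror l y‖ = ‖x - y‖ := by
  have : mirror l x - mirror l y = -(starRingEnd ℂ) (x - y) := by
    simp [mirror]
  rw [this, norm_neg, RCLike.norm_conj]

lemma continuous_mirror (l : ℝ) : Continuous (mirror l) := by
  unfold mirror
  fun_prop

lemma measurePreserving_mirror (l : ℝ) : MeasurePreserving (mirror l) := by
  have h1 : MeasurePreserving (fun y : ℂ => (starRingEnd ℂ) y) :=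
    Complex.conjLIE.measurePreserving
  have h2 : MeasurePreserving (fun y : ℂ => 2 * (l : ℂ) - y) :=
    (Measure.measurePreserving_sub_left volume (2 * (l : ℂ)))
  exact h2.comp h1

lemma measurableEmbedding_mirror (l : ℝ) : MeasurableEmbedding (mirror l) := by
  have : Function.Injective (mirror l) := fun x y h => by
    rw [← mirror_mirror l x, h, mirror_mirror]
  exact (continuous_mirror l).measurableEmbedding this

lemma integral_nonneg_of_mirror {G f : ℂ → ℝ} {l : ℝ}
    (hf : ∀ y, f (mirror l y) = -f y) (hG : Integrable (fun y => G y * f y))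
    (hpos : ∀ᵐ y, y.re < l → 0 ≤ (G y - G (mirror l y)) * f y) :
    0 ≤ ∫ y, G y * f y := by
  have hmp := measurePreserving_mirror l
  have h2 : ∫ y, G (mirror l y) * f (mirror l y) = ∫ y, G y * f y :=
    hmp.integral_comp (measurableEmbedding_mirror l) (fun y => G y * f y)
  have h3 : Integrable (fun y => G (mirror l y) * f (mirror l y)) :=
    hmp.integrable_comp_of_integrable hG
  have h4 : ∫ y, (G y * f y + G (mirror l y) * f (mirror l y)) = 2 * ∫ y, G y * f y := by
    rw [integral_add hG h3, h2]
    ring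
  have h5 : 0 ≤ ∫ y, (G y * f y + G (mirror l y) * f (mirror l y)) := by
    apply integral_nonneg_of_ae
    have hpos' := hmp.quasiMeasurePreserving.ae hpos
    filter_upwards [hpos, hpos'] with y h1 h2
    rw [hf y]
    rcases lt_trichotomy y.re l with h | h | h
    · have := h1 h
      simp only [Pi.zero_apply]
      nlinarith
    · have : mirror l y = y := by
        apply Complex.ext
        · simp; linarith
        · simp
      have h0 := hf y
      rw [this] at h0
      have : f y = 0 := by linarith
      simp [this]
    · have := h2 (by simp; linarith)
      rw [hf y, mirror_mirror] at this
      simp only [Pi.zero_apply]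
      nlinarith
  linarith

/-- The logarithmic potential of the density `ρ` on `A`. -/
def logPot (A : Set ℂ) (ρ : ℂ → ℝ) (y : ℂ) : ℝ :=
  ∫ y' in A, ρ y' * (-2 * Real.log ‖y - y'‖)

/-- The data to which the method of moving planes is applied. -/
structure PlaneData (A : Set ℂ) (ρ h : ℂ → ℝ) (r K η : ℝ) : Prop where
  pos : 0 < r
  isOpen : IsOpen A
  sub : A ⊆ Metric.closedBall 0 r
  meas : Measurable ρ
  nonneg : ∀ y, ‖y‖ ≤ 4 * r → 0 ≤ ρ y
  le : ∀ y, ‖y‖ ≤ 4 * r → ρ y ≤ K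
  anti : ∀ y₁ y₂, ‖y₁‖ ≤ 4 * r → ‖y₂‖ ≤ 4 * r → y₁.im = y₂.im → y₁.re ≤ y₂.re → ρ y₂ ≤ ρ y₁
  level : ∀ y, ‖y‖ ≤ 4 * r → (y ∈ A ↔ 0 < logPot A ρ y + h y)
  slope : ∀ y₁ y₂, ‖y₁‖ ≤ 4 * r → ‖y₂‖ ≤ 4 * r → y₁.im = y₂.im → y₁.re ≤ y₂.re →
    h y₂ - h y₁ ≤ η * (y₂.re - y₁.re)

namespace PlaneData

variable {A : Set ℂ} {ρ h : ℂ → ℝ} {r K η : ℝ}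

lemma norm_le (H : PlaneData A ρ h r K η) {y : ℂ} (hy : y ∈ A) : ‖y‖ ≤ r := by
  simpa using H.sub hy

lemma norm_le' (H : PlaneData A ρ h r K η) {y : ℂ} (hy : y ∈ A) : ‖y‖ ≤ 4 * r := by
  linarith [H.norm_le hy, H.pos]

lemma norm_mirror_le {y : ℂ} {l : ℝ} (hy : ‖y‖ ≤ r)
    (h1 : -(3 / 2 * r) ≤ l) (h2 : l ≤ r) : ‖mirror l y‖ ≤ 4 * r := by
  have : ‖mirror l y‖ ≤ ‖2 * (l : ℂ)‖ + ‖(starRingEnd ℂ) y‖ := norm_sub_le _ _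
  rw [RCLike.norm_conj, norm_mul, Complex.norm_real, Real.norm_eq_abs] at this
  have h3 : |l| ≤ 3 / 2 * r := abs_le.2 ⟨h1, by linarith [norm_nonneg y]⟩
  norm_num at this
  linarith

lemma volume_ne_top (H : PlaneData A ρ h r K η) {E : Set ℂ} (hE : E ⊆ A) : volume E ≠ ⊤ :=
  (((Metric.isBounded_closedBall).subset (hE.trans H.sub)).measure_lt_top).ne

lemma K_nonneg (H : PlaneData A ρ h r K η) : 0 ≤ K := by
  have h0 : ‖(0 : ℂ)‖ ≤ 4 * r := by simpa using H.pos.le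
  exact (H.nonneg 0 h0).trans (H.le 0 h0)

lemma integrableOn_mul (H : PlaneData A ρ h r K η) {f : ℂ → ℝ} (hf : IntegrableOn f A) :
    IntegrableOn (fun y => ρ y * f y) A := by
  refine Integrable.bdd_mul (c := K) hf H.meas.aestronglyMeasurable ?_
  refine (ae_restrict_mem H.isOpen.measurableSet).mono fun y hy => ?_
  rw [Real.norm_eq_abs, abs_of_nonneg (H.nonneg y (H.norm_le' hy))]
  exact H.le y (H.norm_le' hy)

lemma integrableOn_log (H : PlaneData A ρ h r K η) (x : ℂ) :
    IntegrableOn (fun y => Real.log ‖x - y‖) A :=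
  integrableOn_log_norm_sub H.isOpen.measurableSet
    ((Metric.isBounded_closedBall).subset H.sub) x

lemma integrableOn_sub_re (H : PlaneData A ρ h r K η) (l : ℝ) :
    IntegrableOn (fun y : ℂ => l - y.re) A := by
  have hA : IntegrableOn (fun y : ℂ => l - y.re) (Metric.closedBall 0 r) :=
    ContinuousOn.integrableOn_compact (isCompact_closedBall 0 r) (by fun_prop)
  exact hA.mono_set H.sub

end PlaneData

lemma norm_mirror_sub_sq (l : ℝ) (x y : ℂ) :
    ‖x - y‖ ^ 2 = ‖mirror l x - y‖ ^ 2 + 4 * (x.re - l) * (l - y.re) := by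
  rw [← Complex.normSq_eq_norm_sq, ← Complex.normSq_eq_norm_sq, Complex.normSq_apply,
    Complex.normSq_apply]
  simp
  ring

/-- The part of `A` to the right of the line `re = l` whose mirror image is not in `A`. -/
def excess (A : Set ℂ) (l : ℝ) : Set ℂ := {y | y ∈ A ∧ l < y.re ∧ mirror l y ∉ A}

lemma excess_subset (A : Set ℂ) (l : ℝ) : excess A l ⊆ A := fun _ h => h.1

lemma measurableSet_excess {A : Set ℂ} (hA : IsOpen A) (l : ℝ) : MeasurableSet (excess A l) := by
  refine hA.measurableSet.inter ((measurableSet_lt measurable_const Complex.measurable_re).inter ?_)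
  exact ((hA.preimage (continuous_mirror l)).measurableSet).compl

namespace PlaneData

variable {A : Set ℂ} {ρ h : ℂ → ℝ} {r K η : ℝ}

/-- Positivity, after symmetrization, of integrals against antisymmetric functions. -/
lemma setIntegral_nonneg (H : PlaneData A ρ h r K η) {l : ℝ}
    {f : ℂ → ℝ} (hf : ∀ y, f (mirror l y) = -f y)
    (hfi : IntegrableOn f A) (hpos : ∀ᵐ y, y ∈ A → y.re < l → 0 ≤ f y) :
    0 ≤ ∫ y in A \ excess A l, ρ y * f y := by
  have hm : MeasurableSet (A \ excess A l) :=
    H.isOpen.measurableSet.diff (measurableSet_excess H.isOpen l)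
  set G : ℂ → ℝ := (A \ excess A l).indicator ρ with hG
  have hGf : (fun y => G y * f y) = (A \ excess A l).indicator (fun y => ρ y * f y) := by
    ext y
    simp [hG, Set.indicator]
  rw [← integral_indicator hm, ← hGf]
  refine integral_nonneg_of_mirror hf ?_ ?_
  · rw [hGf, integrable_indicator_iff hm]
    exact (H.integrableOn_mul hfi).mono_set Set.sdiff_subset
  · filter_upwards [hpos] with y hy hyl
    have hmem : mirror l y ∈ A \ excess A l → y ∈ A := by
      intro hh
      by_contra hc
      exact hh.2 ⟨hh.1, by simp; linarith, by rwa [mirror_mirror]⟩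
    by_cases hyA : y ∈ A
    · have hG1 : G y = ρ y := by
        rw [hG, Set.indicator_of_mem]
        exact ⟨hyA, fun hc => absurd hc.2.1 (by linarith)⟩
      refine mul_nonneg ?_ (hy hyA hyl)
      rw [sub_nonneg, hG1]
      by_cases hs : mirror l y ∈ A \ excess A l
      · rw [hG, Set.indicator_of_mem hs]
        exact H.anti _ _ (H.norm_le' hyA) (H.norm_le' hs.1) (by simp) (by simp; linarith)
      · rw [hG, Set.indicator_of_notMem hs]
        exact H.nonneg _ (H.norm_le' hyA)
    · have hG1 : G y = 0 := by
        rw [hG, Set.indicator_of_notMem]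
        exact fun hc => hyA hc.1
      have hG2 : G (mirror l y) = 0 := by
        rw [hG, Set.indicator_of_notMem]
        exact fun hc => hyA (hmem hc)
      simp [hG1, hG2]

/-- Gain of the logarithmic potential under reflection. -/
lemma logPot_mirror_sub_ge (H : PlaneData A ρ h r K η) {l : ℝ}
    {x : ℂ} (hx : ‖x‖ ≤ r) (hxl : l < x.re) :
    (x.re - l) * ((∫ y in A, ρ y * (l - y.re)) / r ^ 2
        - 32 * K * √(volume.real (excess A l)))
      ≤ logPot A ρ (mirror l x) - logPot A ρ x := by
  set E := excess A l with hE
  set d := x.re - l with hd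
  have hd0 : 0 < d := by rw [hd]; linarith
  have hr := H.pos
  set ell : ℂ → ℝ := fun y => 2 * Real.log ‖x - y‖ - 2 * Real.log ‖mirror l x - y‖ with hell
  have hEm : MeasurableSet E := measurableSet_excess H.isOpen l
  have hEA : E ⊆ A := excess_subset A l
  have hellint : IntegrableOn ell A :=
    ((H.integrableOn_log x).const_mul 2).sub ((H.integrableOn_log (mirror l x)).const_mul 2)
  have hdiff : logPot A ρ (mirror l x) - logPot A ρ x = ∫ y in A, ρ y * ell y := by
    unfold logPot
    rw [← integral_sub]
    · congr 1
      ext y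
      rw [hell]
      ring
    · exact H.integrableOn_mul ((H.integrableOn_log _).const_mul _)
    · exact H.integrableOn_mul ((H.integrableOn_log _).const_mul _)
  have hlin := H.integrableOn_sub_re l
  have hmul := H.integrableOn_mul hellint
  have hmul2 := H.integrableOn_mul hlin
  have hsplit : ∫ y in A, ρ y * ell y
      = (∫ y in A \ E, ρ y * ell y) + ∫ y in E, ρ y * ell y := by
    rw [← setIntegral_union Set.disjoint_sdiff_left hEm (hmul.mono_set Set.sdiff_subset)
      (hmul.mono_set hEA), Set.sdiff_union_of_subset hEA]
  have hsplit2 : ∫ y in A, ρ y * (l - y.re)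
      = (∫ y in A \ E, ρ y * (l - y.re)) + ∫ y in E, ρ y * (l - y.re) := by
    rw [← setIntegral_union Set.disjoint_sdiff_left hEm (hmul2.mono_set Set.sdiff_subset)
      (hmul2.mono_set hEA), Set.sdiff_union_of_subset hEA]
  have hEneg : ∫ y in E, ρ y * (l - y.re) ≤ 0 := by
    refine setIntegral_nonpos hEm fun y hy => ?_
    refine mul_nonpos_of_nonneg_of_nonpos (H.nonneg y (H.norm_le' (hEA hy))) ?_
    linarith [hy.2.1]
  have hpart1 : d / r ^ 2 * ∫ y in A \ E, ρ y * (l - y.re) ≤ ∫ y in A \ E, ρ y * ell y := by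
    have key := H.setIntegral_nonneg (l := l) (f := fun y => ell y - d / r ^ 2 * (l - y.re))
      (fun y => ?_) (hellint.sub (hlin.const_mul _)) ?_
    · have e1 : ∫ y in A \ E, ρ y * (ell y - d / r ^ 2 * (l - y.re))
          = (∫ y in A \ E, ρ y * ell y) - d / r ^ 2 * ∫ y in A \ E, ρ y * (l - y.re) := by
        rw [← integral_const_mul, ← integral_sub (hmul.mono_set Set.sdiff_subset)
          ((hmul2.mono_set Set.sdiff_subset).const_mul _)]
        congr 1
        ext y
        ring
      rw [← hE, e1] at key
      linarith
    · have e2 : ‖x - mirror l y‖ = ‖mirror l x - y‖ := by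
        rw [← norm_mirror_sub_mirror l x, mirror_mirror]
      have e3 : ‖mirror l x - mirror l y‖ = ‖x - y‖ := norm_mirror_sub_mirror l x y
      simp only [hell, e2, e3, mirror_re]
      ring
    · have hne : ∀ᵐ y : ℂ, y ≠ mirror l x := by
        simp [ae_iff]
      filter_upwards [hne] with y hy hyA hyl
      have hP : 0 < ‖mirror l x - y‖ := norm_pos_iff.2 (sub_ne_zero.2 (Ne.symm hy))
      have hsq := norm_mirror_sub_sq l x y
      rw [← hd] at hsq
      have hq : 0 ≤ 4 * d * (l - y.re) := by
        have : 0 < l - y.re := by linarith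
        positivity
      have hQ : 0 < ‖x - y‖ ^ 2 := by rw [hsq]; positivity
      have hQ2 : ‖x - y‖ ^ 2 ≤ 4 * r ^ 2 := by
        have : ‖x - y‖ ≤ 2 * r := by
          have := norm_sub_le x y
          linarith [H.norm_le hyA]
        nlinarith [norm_nonneg (x - y)]
      have hl := one_sub_inv_le_log_of_pos (x := ‖x - y‖ ^ 2 / ‖mirror l x - y‖ ^ 2)
        (by positivity)
      rw [Real.log_div hQ.ne' (by positivity), Real.log_pow, Real.log_pow, inv_div] at hl
      have h3 : 1 - ‖mirror l x - y‖ ^ 2 / ‖x - y‖ ^ 2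
          = 4 * d * (l - y.re) / ‖x - y‖ ^ 2 := by
        rw [eq_div_iff hQ.ne', sub_mul, div_mul_cancel₀ _ hQ.ne']
        linarith
      have h4 : 4 * d * (l - y.re) / (4 * r ^ 2) ≤ 4 * d * (l - y.re) / ‖x - y‖ ^ 2 :=
        div_le_div_of_nonneg_left hq hQ hQ2
      have h5 : 4 * d * (l - y.re) / (4 * r ^ 2) = d / r ^ 2 * (l - y.re) := by
        field_simp
      rw [sub_nonneg, ← h5]
      rw [h3] at hl
      simp only [hell]
      push_cast at hl
      linarith
  have hvE : volume E ≠ ⊤ := H.volume_ne_top hEA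
  have hpart2 : -(d * (32 * K * √(volume.real E))) ≤ ∫ y in E, ρ y * ell y := by
    have hi := (integrableOn_inv_norm_sub hvE x).1
    have hb := integral_inv_norm_sub_le hvE x
    have hlow : ∫ y in E, (-(4 * d * K)) * ‖x - y‖⁻¹ ≤ ∫ y in E, ρ y * ell y := by
      refine setIntegral_mono_ae_restrict (hi.const_mul _) (hmul.mono_set hEA) ?_
      have hne : ∀ᵐ y : ℂ ∂(volume.restrict E), y ≠ x :=
        ae_restrict_of_ae (by simp [ae_iff])
      filter_upwards [hne, ae_restrict_mem hEm] with y hy hyE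
      have hQ : 0 < ‖x - y‖ := norm_pos_iff.2 (sub_ne_zero.2 (Ne.symm hy))
      have hP : 0 < ‖mirror l x - y‖ := by
        refine norm_pos_iff.2 (sub_ne_zero.2 fun hc => ?_)
        have := hyE.2.1
        rw [← hc] at this
        simp at this
        linarith
      have hρ0 := H.nonneg y (H.norm_le' (hEA hyE))
      have hρK := H.le y (H.norm_le' (hEA hyE))
      have hl := Real.log_le_sub_one_of_pos (div_pos hP hQ)
      rw [Real.log_div hP.ne' hQ.ne'] at hl
      have htri : ‖mirror l x - y‖ ≤ 2 * d + ‖x - y‖ := by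
        have e : mirror l x - x = ((-(2 * d) : ℝ) : ℂ) := by
          apply Complex.ext
          · simp [hd]; ring
          · simp
        have e2 : ‖mirror l x - x‖ = 2 * d := by
          rw [e, Complex.norm_real, Real.norm_eq_abs, abs_neg, abs_of_pos (by positivity)]
        calc ‖mirror l x - y‖ = ‖(mirror l x - x) + (x - y)‖ := by congr 1; ring
          _ ≤ _ := (norm_add_le _ _).trans (by rw [e2])
      have h3 : ‖mirror l x - y‖ / ‖x - y‖ - 1 ≤ 2 * d * ‖x - y‖⁻¹ := by
        rw [div_sub_one hQ.ne', div_eq_mul_inv]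
        exact mul_le_mul_of_nonneg_right (by linarith) (by positivity)
      have h4 : -(4 * d * ‖x - y‖⁻¹) ≤ ell y := by
        simp only [hell]
        linarith
      have h5 : 0 ≤ 4 * d * ‖x - y‖⁻¹ := by positivity
      have h6 : ρ y * (-(4 * d * ‖x - y‖⁻¹)) ≤ ρ y * ell y :=
        mul_le_mul_of_nonneg_left h4 hρ0
      have h7 : ρ y * (4 * d * ‖x - y‖⁻¹) ≤ K * (4 * d * ‖x - y‖⁻¹) :=
        mul_le_mul_of_nonneg_right hρK h5
      linarith
    rw [integral_const_mul] at hlow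
    have : 4 * d * K * ∫ y in E, ‖x - y‖⁻¹ ≤ 4 * d * K * (8 * √(volume.real E)) :=
      mul_le_mul_of_nonneg_left hb (by have := H.K_nonneg; positivity)
    linarith
  rw [hdiff, hsplit]
  have hfin : d * ((∫ y in A, ρ y * (l - y.re)) / r ^ 2)
      ≤ d / r ^ 2 * ∫ y in A \ E, ρ y * (l - y.re) := by
    rw [hsplit2]
    have hdr : 0 ≤ d / r ^ 2 := by positivity
    have := mul_le_mul_of_nonneg_left hEneg hdr
    have e : d * (((∫ y in A \ E, ρ y * (l - y.re)) + ∫ y in E, ρ y * (l - y.re)) / r ^ 2)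
      = d / r ^ 2 * (∫ y in A \ E, ρ y * (l - y.re)) + d / r ^ 2 * ∫ y in E, ρ y * (l - y.re) := by
      ring
    linarith
  have : d * ((∫ y in A, ρ y * (l - y.re)) / r ^ 2 - 32 * K * √(volume.real E))
    = d * ((∫ y in A, ρ y * (l - y.re)) / r ^ 2) - d * (32 * K * √(volume.real E)) := by ring
  linarith

lemma excess_eq_empty_of_small (H : PlaneData A ρ h r K η) {l : ℝ}
    (h1 : -(3 / 2 * r) ≤ l)
    (hs : 2 * η < (∫ y in A, ρ y * (l - y.re)) / r ^ 2
        - 32 * K * √(volume.real (excess A l))) :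
    excess A l = ∅ := by
  by_contra hne
  obtain ⟨x, hx⟩ := Set.nonempty_iff_ne_empty.2 hne
  have hxr := H.norm_le hx.1
  have hlx := hx.2.1
  have h2 : l ≤ r := by
    have := (Complex.abs_re_le_norm x).trans hxr
    linarith [le_abs_self x.re]
  have key := H.logPot_mirror_sub_ge hxr hlx
  have hm := norm_mirror_le hxr h1 h2
  have l1 := (H.level x (H.norm_le' hx.1)).1 hx.1
  have l2 : logPot A ρ (mirror l x) + h (mirror l x) ≤ 0 := by
    by_contra hc
    exact hx.2.2 ((H.level _ hm).2 (not_le.1 hc))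
  have hsl := H.slope (mirror l x) x hm (H.norm_le' hx.1) (by simp) (by simp; linarith)
  simp only [mirror_re] at hsl
  have : (x.re - l) * (2 * η) < (x.re - l) * ((∫ y in A, ρ y * (l - y.re)) / r ^ 2
        - 32 * K * √(volume.real (excess A l))) :=
    mul_lt_mul_of_pos_left hs (by linarith)
  nlinarith

end PlaneData

lemma exists_step_volume {A : Set ℂ} (hA : IsOpen A) (hb : volume A ≠ ⊤) {c : ℝ} (hc : 0 < c) :
    ∃ δ > 0, volume.real (A ∩ Metric.cthickening δ Aᶜ) < c := by
  have : IsFiniteMeasure (volume.restrict A) := ⟨by simpa using hb.lt_top⟩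
  have ht := tendsto_measure_cthickening_of_isClosed (μ := volume.restrict A) (s := Aᶜ)
    ⟨1, one_pos, measure_ne_top _ _⟩ hA.isClosed_compl
  have h0 : (volume.restrict A) Aᶜ = 0 := by
    rw [Measure.restrict_apply hA.measurableSet.compl]
    simp
  rw [h0] at ht
  have h1 := ht.eventually (gt_mem_nhds (ENNReal.ofReal_pos.2 hc))
  obtain ⟨δ, hδ, h2⟩ := (Metric.eventually_nhds_iff.1 h1)
  refine ⟨δ / 2, by positivity, ?_⟩
  have h3 := h2 (y := δ / 2) (by
    rw [Real.dist_eq, sub_zero, abs_of_pos (by positivity)]; linarith)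
  rw [Measure.restrict_apply Metric.isClosed_cthickening.measurableSet, Set.inter_comm] at h3
  rw [Measure.real]
  exact (ENNReal.lt_ofReal_iff_toReal_lt (ne_top_of_lt h3)).1 h3

lemma volume_slab_le {r a b : ℝ} (hr : 0 ≤ r) (hab : a ≤ b) {S : Set ℂ}
    (hS : S ⊆ Metric.closedBall 0 r) (hS2 : ∀ y ∈ S, a ≤ y.re ∧ y.re ≤ b) :
    volume.real S ≤ (b - a) * (2 * r) := by
  have hsub : S ⊆ Complex.measurableEquivRealProd ⁻¹' (Set.Icc a b ×ˢ Set.Icc (-r) r) := by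
    intro y hy
    have h1 : ‖y‖ ≤ r := by simpa using hS hy
    have h2 := abs_le.1 ((Complex.abs_im_le_norm y).trans h1)
    exact ⟨hS2 y hy, h2⟩
  have hv : volume (Complex.measurableEquivRealProd ⁻¹' (Set.Icc a b ×ˢ Set.Icc (-r) r))
      = ENNReal.ofReal (b - a) * ENNReal.ofReal (2 * r) := by
    rw [Complex.volume_preserving_equiv_real_prod.measure_preimage
      (measurableSet_Icc.prod measurableSet_Icc).nullMeasurableSet, Measure.volume_eq_prod,
      Measure.prod_prod, Real.volume_Icc, Real.volume_Icc]
    congr 2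
    ring
  have h3 := measure_mono (μ := volume) hsub
  rw [hv, ← ENNReal.ofReal_mul (by linarith)] at h3
  exact ENNReal.toReal_le_of_le_ofReal (mul_nonneg (by linarith) (by linarith)) h3

namespace PlaneData

variable {A : Set ℂ} {ρ h : ℂ → ℝ} {r K η : ℝ}

lemma integral_sub_re_mono (H : PlaneData A ρ h r K η) {l l' : ℝ} (hl : l ≤ l') :
    ∫ y in A, ρ y * (l - y.re) ≤ ∫ y in A, ρ y * (l' - y.re) := by
  refine setIntegral_mono_on (H.integrableOn_mul (H.integrableOn_sub_re l))
    (H.integrableOn_mul (H.integrableOn_sub_re l')) H.isOpen.measurableSet fun y hy => ?_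
  exact mul_le_mul_of_nonneg_left (by linarith) (H.nonneg y (H.norm_le' hy))

/-- The method of moving planes. -/
theorem excess_eq_empty (H : PlaneData A ρ h r K η) {l₀ : ℝ} (h1 : -(3 / 2 * r) ≤ l₀)
    (hs : 2 * η < (∫ y in A, ρ y * (l₀ - y.re)) / r ^ 2) : excess A l₀ = ∅ := by
  have hr := H.pos
  set g := (∫ y in A, ρ y * (l₀ - y.re)) / r ^ 2 - 2 * η with hg
  have hg0 : 0 < g := by rw [hg]; linarith
  have hK := H.K_nonneg
  obtain ⟨c, hc, hc2⟩ : ∃ c > 0, ∀ v : ℝ, v < 2 * c → 32 * K * √v < g := by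
    refine ⟨(g / (32 * K + 1)) ^ 2 / 2, by positivity, fun v hv => ?_⟩
    have h3 : √v < g / (32 * K + 1) := by
      rw [Real.sqrt_lt' (by positivity)]
      linarith
    rw [lt_div_iff₀ (by positivity)] at h3
    nlinarith [Real.sqrt_nonneg v]
  obtain ⟨δ, hδ, hδ2⟩ := exists_step_volume H.isOpen (H.volume_ne_top subset_rfl) hc
  set s := min (δ / 2) (c / (2 * r)) with hsdef
  have hs0 : 0 < s := lt_min (by positivity) (by positivity)
  have step : ∀ l l', l₀ ≤ l' → l' ≤ l → l - l' ≤ s → excess A l = ∅ → excess A l' = ∅ := by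
    intro l l' h0 h2 h3 h4
    apply H.excess_eq_empty_of_small (h1.trans h0)
    have hsub : excess A l' ⊆ {y | y ∈ A ∧ l' ≤ y.re ∧ y.re ≤ l}
        ∪ mirror l ⁻¹' (A ∩ Metric.cthickening δ Aᶜ) := by
      intro y hy
      by_cases hyl : y.re ≤ l
      · exact Or.inl ⟨hy.1, hy.2.1.le, hyl⟩
      · right
        push Not at hyl
        have hyA : mirror l y ∈ A := by
          by_contra hcon
          have : y ∈ excess A l := ⟨hy.1, hyl, hcon⟩
          rw [h4] at this
          exact this
        refine ⟨hyA, ?_⟩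
        refine Metric.mem_cthickening_of_dist_le _ (mirror l' y) δ _ hy.2.2 ?_
        have e : mirror l y - mirror l' y = ((2 * (l - l') : ℝ) : ℂ) := by
          apply Complex.ext
          · simp; ring
          · simp
        rw [dist_eq_norm, e, Complex.norm_real, Real.norm_eq_abs, abs_of_nonneg (by linarith)]
        linarith [min_le_left (δ / 2) (c / (2 * r))]
    have hv1 : volume.real {y | y ∈ A ∧ l' ≤ y.re ∧ y.re ≤ l} ≤ (l - l') * (2 * r) :=
      volume_slab_le hr.le h2 (fun y hy => H.sub hy.1) (fun y hy => hy.2)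
    have hm : MeasurableSet (A ∩ Metric.cthickening δ Aᶜ) :=
      H.isOpen.measurableSet.inter Metric.isClosed_cthickening.measurableSet
    have hpre : volume (mirror l ⁻¹' (A ∩ Metric.cthickening δ Aᶜ))
        = volume (A ∩ Metric.cthickening δ Aᶜ) :=
      (measurePreserving_mirror l).measure_preimage hm.nullMeasurableSet
    have hfin : volume ({y | y ∈ A ∧ l' ≤ y.re ∧ y.re ≤ l}
        ∪ mirror l ⁻¹' (A ∩ Metric.cthickening δ Aᶜ)) ≠ ⊤ := by
      refine measure_union_ne_top (H.volume_ne_top fun y hy => hy.1) ?_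
      rw [hpre]
      exact H.volume_ne_top Set.inter_subset_left
    have hv : volume.real (excess A l') < 2 * c := by
      have e1 := measureReal_mono hsub hfin
      have e2 := measureReal_union_le (μ := volume) {y | y ∈ A ∧ l' ≤ y.re ∧ y.re ≤ l}
        (mirror l ⁻¹' (A ∩ Metric.cthickening δ Aᶜ))
      have e3 : volume.real (mirror l ⁻¹' (A ∩ Metric.cthickening δ Aᶜ)) < c := by
        rw [Measure.real, hpre]
        exact hδ2
      have e4 : (l - l') * (2 * r) ≤ c := by
        rw [← le_div_iff₀ (by positivity)]
        exact h3.trans (min_le_right _ _)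
      linarith
    have h5 := hc2 _ hv
    have h6 : (∫ y in A, ρ y * (l₀ - y.re)) / r ^ 2 ≤ (∫ y in A, ρ y * (l' - y.re)) / r ^ 2 := by
      exact div_le_div_of_nonneg_right (H.integral_sub_re_mono h0) (by positivity)
    linarith
  have iter : ∀ n : ℕ, ∀ l, l₀ ≤ l → r - n * s ≤ l → excess A l = ∅ := by
    intro n
    induction n with
    | zero =>
      intro l _ hl
      refine Set.eq_empty_iff_forall_notMem.2 fun y hy => ?_
      have h2 := (le_abs_self _).trans ((Complex.abs_re_le_norm y).trans (H.norm_le hy.1))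
      have := hy.2.1
      simp at hl
      linarith
    | succ n ih =>
      intro l hl0 hl
      refine step (l + s) l hl0 (by linarith) (by linarith) (ih _ (by linarith) ?_)
      push_cast at hl
      linarith
  obtain ⟨n, hn⟩ := exists_nat_ge ((r - l₀) / s)
  refine iter n l₀ le_rfl ?_
  rw [div_le_iff₀ hs0] at hn
  linarith

lemma integrableOn_density (H : PlaneData A ρ h r K η) : IntegrableOn ρ A := by
  simpa using H.integrableOn_mul (f := fun _ => (1 : ℝ))
    (integrableOn_const (H.volume_ne_top subset_rfl))

lemma integrableOn_mul_re (H : PlaneData A ρ h r K η) :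
    IntegrableOn (fun y => ρ y * y.re) A := by
  refine H.integrableOn_mul ?_
  simpa using (H.integrableOn_sub_re 0).neg

lemma integral_sub_re (H : PlaneData A ρ h r K η) (l : ℝ) :
    ∫ y in A, ρ y * (l - y.re) = l * (∫ y in A, ρ y) - ∫ y in A, ρ y * y.re := by
  have i1 : IntegrableOn (fun y => ρ y * l) A :=
    H.integrableOn_mul (integrableOn_const (H.volume_ne_top subset_rfl))
  rw [mul_comm l, ← integral_mul_const, ← integral_sub i1 H.integrableOn_mul_re]
  congr 1
  ext y
  ring

/-- Force balance: the external potential cannot be strictly decreasing. -/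
theorem slope_nonneg (H : PlaneData A ρ h r K η) (hM : 0 < ∫ y in A, ρ y) : 0 ≤ η := by
  by_contra hη
  push Not at hη
  have hr := H.pos
  set M := ∫ y in A, ρ y with hMdef
  set C := (∫ y in A, ρ y * y.re) / M with hC
  have hCM : C * M = ∫ y in A, ρ y * y.re := by
    rw [hC, div_mul_cancel₀ _ hM.ne']
  have hCr : -r ≤ C := by
    rw [hC, le_div_iff₀ hM, hMdef, ← integral_const_mul]
    refine setIntegral_mono_on ?_ ?_ H.isOpen.measurableSet fun y hy => ?_
    · exact H.integrableOn_density.const_mul _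
    · exact H.integrableOn_mul_re
    · have h2 := abs_le.1 ((Complex.abs_re_le_norm y).trans (H.norm_le hy))
      have := H.nonneg y (H.norm_le' hy)
      nlinarith [h2.1]
  set t := min (r / 2) (-η * r ^ 2 / M) with ht
  have ht0 : 0 < t := lt_min (by positivity) (div_pos (by nlinarith [sq_pos_of_pos hr]) hM)
  have ht1 : t ≤ r / 2 := min_le_left _ _
  have ht2 : t * M ≤ -η * r ^ 2 := by
    rw [← le_div_iff₀ hM]
    exact min_le_right _ _
  have hI : ∫ y in A, ρ y * (C - t - y.re) = -(t * M) := by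
    rw [H.integral_sub_re, ← hMdef, ← hCM]
    ring
  have hE : excess A (C - t) = ∅ := by
    refine H.excess_eq_empty (by linarith) ?_
    rw [hI, lt_div_iff₀ (by positivity)]
    nlinarith [sq_pos_of_pos hr]
  have hpos := H.setIntegral_nonneg (l := C - t) (f := fun y => C - t - y.re)
    (fun y => by simp; ring) (H.integrableOn_sub_re _)
    (Eventually.of_forall fun y _ hy => by linarith)
  rw [hE, Set.sdiff_empty, hI] at hpos
  nlinarith

/-- Gain of the logarithmic potential when no point is in excess. -/
lemma logPot_mirror_sub_ge_of_empty (H : PlaneData A ρ h r K η) {l : ℝ}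
    {x : ℂ} (hx : ‖x‖ ≤ r) (hxl : l < x.re) (hE : excess A l = ∅) :
    (x.re - l) * ((∫ y in A, ρ y * (l - y.re)) / r ^ 2)
      ≤ logPot A ρ (mirror l x) - logPot A ρ x := by
  have := H.logPot_mirror_sub_ge hx hxl
  simpa [hE] using this

end PlaneData

end VortexRing

namespace VortexRing

/-- The profile of the Green function as a function of the normalized squared distance. -/
def profile (τ : ℝ) : ℝ :=
  ∫ θ in (-π)..π, Real.cos θ / √(τ + 2 * (1 - Real.cos θ))

/-- The smoother of the two summands of the profile. -/
def profileSmooth (τ : ℝ) : ℝ :=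
  ∫ θ in (0 : ℝ)..π, (Real.cos θ - Real.cos (θ / 2)) / √(τ + 4 * Real.sin (θ / 2) ^ 2)

/-- The regular part of the profile, after removal of its logarithmic singularity. -/
def profileReg (τ : ℝ) : ℝ := 2 * Real.log (2 + √(4 + τ)) + 2 * profileSmooth τ

lemma cos_eq_half (θ : ℝ) : Real.cos θ = 1 - 2 * Real.sin (θ / 2) ^ 2 := by
  have h := Real.cos_two_mul (θ / 2)
  have h2 := Real.sin_sq_add_cos_sq (θ / 2)
  rw [show 2 * (θ / 2) = θ by ring] at h
  linarith

lemma integral_cos_half {τ : ℝ} (hτ : 0 < τ) :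
    ∫ θ in (0 : ℝ)..π, Real.cos (θ / 2) / √(τ + 4 * Real.sin (θ / 2) ^ 2)
      = Real.arsinh (2 / √τ) := by
  have hs : 0 < √τ := Real.sqrt_pos.2 hτ
  have hd : ∀ θ ∈ Set.uIcc (0 : ℝ) π, HasDerivAt
      (fun θ => Real.arsinh (2 * Real.sin (θ / 2) / √τ))
      (Real.cos (θ / 2) / √(τ + 4 * Real.sin (θ / 2) ^ 2)) θ := by
    intro θ _
    have h1 : HasDerivAt (fun θ : ℝ => 2 * Real.sin (θ / 2) / √τ) (Real.cos (θ / 2) / √τ) θ := by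
      have := (((hasDerivAt_id θ).div_const 2).sin.const_mul 2).div_const (√τ)
      refine this.congr_deriv ?_
      simp
      ring
    refine h1.arsinh.congr_deriv ?_
    have h2 : √(τ + 4 * Real.sin (θ / 2) ^ 2)
        = √τ * √(1 + (2 * Real.sin (θ / 2) / √τ) ^ 2) := by
      rw [← Real.sqrt_mul hτ.le]
      congr 1
      rw [div_pow, Real.sq_sqrt hτ.le]
      field_simp
      ring
    rw [h2, smul_eq_mul]
    field_simp
  rw [intervalIntegral.integral_eq_sub_of_hasDerivAt hd]
  · simp
  · apply ContinuousOn.intervalIntegrable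
    apply Continuous.continuousOn
    refine Continuous.div (by fun_prop) (by fun_prop) fun θ => ?_
    have : 0 < τ + 4 * Real.sin (θ / 2) ^ 2 := by positivity
    exact (Real.sqrt_pos.2 this).ne'

lemma continuous_profile_integrand {τ : ℝ} (hτ : 0 < τ) {f : ℝ → ℝ} (hf : Continuous f) :
    Continuous fun θ => f θ / √(τ + 4 * Real.sin (θ / 2) ^ 2) := by
  refine Continuous.div hf (by fun_prop) fun θ => ?_
  have : 0 < τ + 4 * Real.sin (θ / 2) ^ 2 := by positivity
  exact (Real.sqrt_pos.2 this).ne'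

lemma profile_eq {τ : ℝ} (hτ : 0 < τ) : profile τ = -Real.log τ + profileReg τ := by
  have e1 : profile τ = ∫ θ in (-π)..π, Real.cos θ / √(τ + 4 * Real.sin (θ / 2) ^ 2) := by
    unfold profile
    congr 1
    ext θ
    rw [show τ + 2 * (1 - Real.cos θ) = τ + 4 * Real.sin (θ / 2) ^ 2 by
      rw [cos_eq_half θ]; ring]
  have hc := continuous_profile_integrand hτ Real.continuous_cos
  have e2 : ∫ θ in (-π)..0, Real.cos θ / √(τ + 4 * Real.sin (θ / 2) ^ 2)
      = ∫ θ in (0 : ℝ)..π, Real.cos θ / √(τ + 4 * Real.sin (θ / 2) ^ 2) := by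
    have := intervalIntegral.integral_comp_neg (a := 0) (b := π)
      (fun θ => Real.cos θ / √(τ + 4 * Real.sin (θ / 2) ^ 2))
    rw [neg_zero] at this
    rw [← this]
    congr 1
    ext θ
    rw [Real.cos_neg, neg_div, Real.sin_neg, neg_sq]
  have e3 : ∫ θ in (0 : ℝ)..π, Real.cos θ / √(τ + 4 * Real.sin (θ / 2) ^ 2)
      = Real.arsinh (2 / √τ) + profileSmooth τ := by
    rw [← integral_cos_half hτ, profileSmooth, ← intervalIntegral.integral_add
      ((continuous_profile_integrand hτ (by fun_prop)).intervalIntegrable _ _)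
      ((continuous_profile_integrand hτ (by fun_prop)).intervalIntegrable _ _)]
    congr 1
    ext θ
    ring
  have hs : 0 < √τ := Real.sqrt_pos.2 hτ
  have e4 : Real.arsinh (2 / √τ) = Real.log (2 + √(4 + τ)) - Real.log τ / 2 := by
    rw [Real.arsinh]
    have : √(1 + (2 / √τ) ^ 2) = √(4 + τ) / √τ := by
      rw [← Real.sqrt_div (by positivity)]
      congr 1
      rw [div_pow, Real.sq_sqrt hτ.le]
      field_simp
      ring
    rw [this, ← add_div, Real.log_div (by positivity) hs.ne', Real.log_sqrt hτ.le]
  rw [e1, ← intervalIntegral.integral_add_adjacent_intervals (hc.intervalIntegrable _ 0)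
    (hc.intervalIntegrable _ _), e2, e3, e4, profileReg]
  ring

lemma abs_cos_sub_cos_half_le {θ : ℝ} (h0 : 0 ≤ θ) (h1 : θ ≤ π) :
    |Real.cos θ - Real.cos (θ / 2)| ≤ 4 * Real.sin (θ / 2) ^ 2 := by
  have hc : 0 ≤ Real.cos (θ / 2) :=
    Real.cos_nonneg_of_mem_Icc ⟨by linarith [Real.pi_pos], by linarith⟩
  have hc1 := Real.cos_le_one (θ / 2)
  have h2 := Real.sin_sq_add_cos_sq (θ / 2)
  rw [cos_eq_half θ, abs_le]
  constructor <;> nlinarith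

lemma abs_profileSmooth_le {τ : ℝ} (hτ : 0 < τ) : |profileSmooth τ| ≤ 2 * π := by
  have h := intervalIntegral.norm_integral_le_of_norm_le_const (a := 0) (b := π) (C := 2)
    (f := fun θ => (Real.cos θ - Real.cos (θ / 2)) / √(τ + 4 * Real.sin (θ / 2) ^ 2)) ?_
  · rwa [Real.norm_eq_abs, sub_zero, abs_of_pos Real.pi_pos] at h
  · intro θ hθ
    rw [Set.uIoc_of_le Real.pi_pos.le] at hθ
    have hg := abs_cos_sub_cos_half_le hθ.1.le hθ.2
    have hs : 0 ≤ Real.sin (θ / 2) :=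
      Real.sin_nonneg_of_nonneg_of_le_pi (by linarith [hθ.1]) (by linarith [hθ.2, Real.pi_pos])
    have hs1 := Real.sin_le_one (θ / 2)
    have hq : 0 < √(τ + 4 * Real.sin (θ / 2) ^ 2) := Real.sqrt_pos.2 (by positivity)
    rw [Real.norm_eq_abs, abs_div, abs_of_pos hq, div_le_iff₀ hq]
    have hq2 : 2 * Real.sin (θ / 2) ≤ √(τ + 4 * Real.sin (θ / 2) ^ 2) := by
      apply Real.le_sqrt_of_sq_le
      nlinarith
    nlinarith

lemma abs_profileReg_le {τ : ℝ} (hτ : 0 < τ) : |profileReg τ| ≤ 20 + 2 * τ := by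
  have h1 := abs_profileSmooth_le hτ
  have h2 : 0 ≤ Real.log (2 + √(4 + τ)) := by
    apply Real.log_nonneg
    linarith [Real.sqrt_nonneg (4 + τ)]
  have h3 : Real.log (2 + √(4 + τ)) ≤ 2 + √(4 + τ) - 1 :=
    Real.log_le_sub_one_of_pos (by positivity)
  have h4 : √(4 + τ) ≤ 2 + τ := by
    rw [Real.sqrt_le_left (by linarith)]
    nlinarith
  have h5 := Real.pi_lt_d2
  rw [profileReg]
  rw [abs_le] at h1 ⊢
  constructor <;> nlinarith

lemma abs_inv_sqrt_sub_le {a b s : ℝ} (ha : 0 < a) (hb : 0 < b) (hs : 0 ≤ s) (hsa : s ≤ √a)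
    (hsb : s ≤ √b) : s ^ 2 * |1 / √a - 1 / √b| ≤ |a - b| / √a := by
  have ha' : 0 < √a := Real.sqrt_pos.2 ha
  have hb' : 0 < √b := Real.sqrt_pos.2 hb
  have e : 1 / √a - 1 / √b = -((a - b) / (√a * √b * (√a + √b))) := by
    have : a - b = (√a - √b) * (√a + √b) := by
      have h1 := Real.sq_sqrt ha.le
      have h2 := Real.sq_sqrt hb.le
      nlinarith
    rw [this]
    field_simp
    ring
  rw [e, abs_neg, abs_div, abs_of_pos (by positivity : 0 < √a * √b * (√a + √b))]
  rw [mul_div_assoc', div_le_div_iff₀ (by positivity) ha']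
  have h3 : s ^ 2 ≤ √a * √b := by nlinarith
  have h4 : 0 ≤ |a - b| := abs_nonneg _
  have h5 : s ^ 2 * √a ≤ √a * √b * (√a + √b) := by
    nlinarith [mul_pos ha' hb', mul_pos (mul_pos ha' hb') hb']
  nlinarith

lemma abs_profileSmooth_sub_le {τ₁ τ₂ e : ℝ} (h1 : 0 < τ₁) (h2 : 0 < τ₂) (he : 0 < e)
    (he1 : e ≤ 1) :
    |profileSmooth τ₁ - profileSmooth τ₂|
      ≤ |τ₁ - τ₂| * (e / √τ₁ + 2 * (2 + Real.log (1 / e))) := by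
  have hπ := Real.pi_pos
  have hπ3 := Real.pi_gt_three
  set f : ℝ → ℝ := fun θ => (Real.cos θ - Real.cos (θ / 2)) / √(τ₁ + 4 * Real.sin (θ / 2) ^ 2)
    - (Real.cos θ - Real.cos (θ / 2)) / √(τ₂ + 4 * Real.sin (θ / 2) ^ 2) with hf
  have hfc : Continuous f := (continuous_profile_integrand h1 (by fun_prop)).sub
    (continuous_profile_integrand h2 (by fun_prop))
  have hsub : profileSmooth τ₁ - profileSmooth τ₂ = ∫ θ in (0 : ℝ)..π, f θ := by
    rw [profileSmooth, profileSmooth, ← intervalIntegral.integral_sub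
      ((continuous_profile_integrand h1 (by fun_prop)).intervalIntegrable _ _)
      ((continuous_profile_integrand h2 (by fun_prop)).intervalIntegrable _ _)]
  have hpt : ∀ θ, 0 ≤ θ → θ ≤ π →
      |f θ| ≤ |τ₁ - τ₂| / √(τ₁ + 4 * Real.sin (θ / 2) ^ 2) := by
    intro θ h3 h4
    have hg := abs_cos_sub_cos_half_le h3 h4
    have hs : 0 ≤ Real.sin (θ / 2) :=
      Real.sin_nonneg_of_nonneg_of_le_pi (by linarith) (by linarith)
    have key := abs_inv_sqrt_sub_le (a := τ₁ + 4 * Real.sin (θ / 2) ^ 2)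
      (b := τ₂ + 4 * Real.sin (θ / 2) ^ 2) (s := 2 * Real.sin (θ / 2))
      (by positivity) (by positivity) (by positivity)
      (Real.le_sqrt_of_sq_le (by nlinarith)) (Real.le_sqrt_of_sq_le (by nlinarith))
    have e1 : f θ = (Real.cos θ - Real.cos (θ / 2)) *
        (1 / √(τ₁ + 4 * Real.sin (θ / 2) ^ 2) - 1 / √(τ₂ + 4 * Real.sin (θ / 2) ^ 2)) := by
      rw [hf]
      ring
    rw [e1, abs_mul]
    refine (mul_le_mul_of_nonneg_right hg (abs_nonneg _)).trans ?_
    have e2 : (2 * Real.sin (θ / 2)) ^ 2 = 4 * Real.sin (θ / 2) ^ 2 := by ring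
    rw [e2] at key
    refine key.trans (le_of_eq ?_)
    congr 2
    ring
  have hA : |∫ θ in (0 : ℝ)..e, f θ| ≤ |τ₁ - τ₂| * (e / √τ₁) := by
    have := intervalIntegral.norm_integral_le_of_norm_le_const (a := 0) (b := e)
      (C := |τ₁ - τ₂| / √τ₁) (f := f) ?_
    · rw [Real.norm_eq_abs, sub_zero, abs_of_pos he] at this
      refine this.trans (le_of_eq ?_)
      ring
    · intro θ hθ
      rw [Set.uIoc_of_le he.le] at hθ
      refine (hpt θ hθ.1.le (by linarith [hθ.2])).trans ?_
      refine div_le_div_of_nonneg_left (abs_nonneg _) (Real.sqrt_pos.2 h1) (Real.sqrt_le_sqrt ?_)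
      nlinarith [sq_nonneg (Real.sin (θ / 2))]
  have hB : |∫ θ in e..π, f θ| ≤ |τ₁ - τ₂| * (2 * (2 + Real.log (1 / e))) := by
    have heπ : e ≤ π := by linarith
    have := intervalIntegral.norm_integral_le_of_norm_le (a := e) (b := π) (μ := volume)
      (f := f) (g := fun θ => (|τ₁ - τ₂| * 2) * θ⁻¹) heπ (Eventually.of_forall ?_) ?_
    · rw [Real.norm_eq_abs, intervalIntegral.integral_const_mul,
        integral_inv_of_pos he hπ] at this
      refine this.trans ?_
      rw [mul_assoc]
      refine mul_le_mul_of_nonneg_left ?_ (abs_nonneg _)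
      have : Real.log (π / e) ≤ 2 + Real.log (1 / e) := by
        rw [Real.log_div hπ.ne' he.ne', Real.log_div one_ne_zero he.ne', Real.log_one]
        have := Real.log_le_sub_one_of_pos (show 0 < π / 2 by positivity)
        rw [Real.log_div hπ.ne' two_ne_zero] at this
        have h2 := Real.log_two_lt_d9
        have h5 := Real.pi_lt_d2
        linarith
      linarith
    · intro θ hθ
      have h0 : 0 < θ := he.trans hθ.1
      refine (hpt θ h0.le hθ.2).trans ?_
      rw [div_eq_mul_inv, mul_assoc]
      refine mul_le_mul_of_nonneg_left ?_ (abs_nonneg _)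
      have hj : 2 / π * (θ / 2) ≤ Real.sin (θ / 2) :=
        Real.mul_le_sin (by linarith) (by linarith [hθ.2])
      have hj2 : θ / 2 ≤ √(τ₁ + 4 * Real.sin (θ / 2) ^ 2) := by
        apply Real.le_sqrt_of_sq_le
        have h6 : θ / 4 ≤ Real.sin (θ / 2) := by
          refine le_trans ?_ hj
          have : (1 : ℝ) / 4 ≤ 1 / π :=
            one_div_le_one_div_of_le hπ Real.pi_le_four
          calc θ / 4 = 1 / 4 * θ := by ring
            _ ≤ 1 / π * θ := mul_le_mul_of_nonneg_right this h0.le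
            _ = _ := by ring
        nlinarith
      rw [show 2 * θ⁻¹ = (θ / 2)⁻¹ by rw [inv_div]; ring]
      exact inv_anti₀ (by positivity) hj2
    · apply IntervalIntegrable.const_mul
      apply intervalIntegral.intervalIntegrable_inv
      · intro x hx
        rw [Set.uIcc_of_le heπ] at hx
        linarith [hx.1]
      · exact continuousOn_id
  rw [hsub, ← intervalIntegral.integral_add_adjacent_intervals (hfc.intervalIntegrable 0 e)
    (hfc.intervalIntegrable e π), mul_add]
  exact (abs_add_le _ _).trans (add_le_add hA hB)

lemma abs_log_sub_log_le {a b m : ℝ} (hm : 0 < m) (ha : m ≤ a) (hb : m ≤ b) :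
    |Real.log a - Real.log b| ≤ |a - b| / m := by
  wlog hab : b ≤ a generalizing a b
  · rw [abs_sub_comm, abs_sub_comm a]
    exact this hb ha (le_of_not_ge hab)
  have hb0 := hm.trans_le hb
  rw [abs_of_nonneg (sub_nonneg.2 (Real.log_le_log hb0 hab)), abs_of_nonneg (sub_nonneg.2 hab),
    ← Real.log_div (hm.trans_le ha).ne' hb0.ne']
  refine (Real.log_le_sub_one_of_pos (div_pos (hm.trans_le ha) hb0)).trans ?_
  rw [div_sub_one hb0.ne']
  exact div_le_div_of_nonneg_left (sub_nonneg.2 hab) hm hb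

lemma abs_profileReg_sub_le {τ₁ τ₂ e : ℝ} (h1 : 0 < τ₁) (h2 : 0 < τ₂) (he : 0 < e)
    (he1 : e ≤ 1) :
    |profileReg τ₁ - profileReg τ₂| ≤ |τ₁ - τ₂| * (2 * e / √τ₁ + 9 + 4 * Real.log (1 / e)) := by
  have hs := abs_profileSmooth_sub_le h1 h2 he he1
  have ha : 2 ≤ √(4 + τ₁) := Real.le_sqrt_of_sq_le (by linarith)
  have hb : 2 ≤ √(4 + τ₂) := Real.le_sqrt_of_sq_le (by linarith)
  have hl := abs_log_sub_log_le (a := 2 + √(4 + τ₁)) (b := 2 + √(4 + τ₂)) (m := 4) (by norm_num)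
    (by linarith) (by linarith)
  have hq : |√(4 + τ₁) - √(4 + τ₂)| ≤ |τ₁ - τ₂| := by
    have e1 : (√(4 + τ₁) - √(4 + τ₂)) * (√(4 + τ₁) + √(4 + τ₂)) = τ₁ - τ₂ := by
      have := Real.sq_sqrt (show 0 ≤ 4 + τ₁ by linarith)
      have := Real.sq_sqrt (show 0 ≤ 4 + τ₂ by linarith)
      nlinarith
    rw [← e1, abs_mul, abs_of_pos (by linarith : 0 < √(4 + τ₁) + √(4 + τ₂))]
    nlinarith [abs_nonneg (√(4 + τ₁) - √(4 + τ₂))]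
  have e2 : 2 + √(4 + τ₁) - (2 + √(4 + τ₂)) = √(4 + τ₁) - √(4 + τ₂) := by ring
  rw [e2] at hl
  have e3 : profileReg τ₁ - profileReg τ₂ = 2 * (Real.log (2 + √(4 + τ₁))
      - Real.log (2 + √(4 + τ₂))) + 2 * (profileSmooth τ₁ - profileSmooth τ₂) := by
    rw [profileReg, profileReg]
    ring
  rw [e3]
  refine (abs_add_le _ _).trans ?_
  rw [abs_mul, abs_mul, abs_two]
  have e4 : |τ₁ - τ₂| * (2 * e / √τ₁ + 9 + 4 * Real.log (1 / e))
      = 2 * (|τ₁ - τ₂| * (e / √τ₁ + 2 * (2 + Real.log (1 / e)))) + |τ₁ - τ₂| := by ring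
  rw [e4]
  linarith [abs_nonneg (τ₁ - τ₂)]

lemma measurable_profileReg : Measurable profileReg := by
  have h : StronglyMeasurable profileSmooth := by
    unfold profileSmooth
    simp_rw [intervalIntegral.integral_of_le Real.pi_pos.le]
    have hm : StronglyMeasurable (Function.uncurry fun (τ θ : ℝ) =>
        (Real.cos θ - Real.cos (θ / 2)) / √(τ + 4 * Real.sin (θ / 2) ^ 2)) := by
      apply Measurable.stronglyMeasurable
      unfold Function.uncurry
      fun_prop
    exact hm.integral_prod_right
  unfold profileReg
  have := h.measurable
  fun_prop

/-- The Green function in complex notation. -/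
def greenC (x x' : ℂ) : ℝ :=
  x.re * x'.re ^ 2 / (4 * π) *
    ∫ θ in (-π)..π, Real.cos θ /
      √((x.im - x'.im) ^ 2 + x.re ^ 2 + x'.re ^ 2 - 2 * x.re * x'.re * Real.cos θ)

lemma greenC_eq {x x' : ℂ} (hx : 0 < x.re) (hx' : 0 < x'.re) :
    greenC x x' = √x.re * (x'.re * √x'.re) / (4 * π)
      * profile (‖x - x'‖ ^ 2 / (x.re * x'.re)) := by
  have hs : 0 < √x.re := Real.sqrt_pos.2 hx
  have hs' : 0 < √x'.re := Real.sqrt_pos.2 hx'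
  have e : ∀ θ : ℝ, Real.cos θ /
      √((x.im - x'.im) ^ 2 + x.re ^ 2 + x'.re ^ 2 - 2 * x.re * x'.re * Real.cos θ)
      = (√x.re * √x'.re)⁻¹ *
        (Real.cos θ / √(‖x - x'‖ ^ 2 / (x.re * x'.re) + 2 * (1 - Real.cos θ))) := by
    intro θ
    have h1 : (x.im - x'.im) ^ 2 + x.re ^ 2 + x'.re ^ 2 - 2 * x.re * x'.re * Real.cos θ
        = (x.re * x'.re) * (‖x - x'‖ ^ 2 / (x.re * x'.re) + 2 * (1 - Real.cos θ)) := by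
      rw [← Complex.normSq_eq_norm_sq, Complex.normSq_apply]
      simp
      field_simp
      ring
    rw [h1, Real.sqrt_mul (by positivity), Real.sqrt_mul hx.le]
    rw [div_mul_eq_div_div, mul_comm, div_eq_mul_inv (Real.cos θ / _)]
    ring
  rw [greenC, profile]
  simp_rw [e]
  rw [intervalIntegral.integral_const_mul]
  field_simp
  rw [Real.sq_sqrt hx.le, Real.sq_sqrt hx'.le]

end VortexRing

namespace VortexRing

/-- The cross-section of a centralized steady vortex ring, in complex notation. -/
structure RingData (κ W δ ε μ : ℝ) (A : Set ℂ) (ψ : ℂ → ℝ) (p : ℝ) : Prop where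
  kappa_pos : 0 < κ
  W_pos : 0 < W
  delta_pos : 0 < δ
  eps_pos : 0 < ε
  one_le_log : 1 ≤ Real.log (1 / ε)
  mu_pos : 0 < μ
  isOpen : IsOpen A
  preconn : IsPreconnected A
  strip : ∀ x ∈ A, δ ≤ x.re ∧ x.re ≤ 1 / δ
  diam : ∀ x ∈ A, ∀ y ∈ A, ‖x - y‖ ≤ 1
  level : ∀ x : ℂ, 0 < x.re → (x ∈ A ↔ μ + W / 2 * x.re ^ 2 * Real.log (1 / ε) < ψ x)
  repr : ∀ x : ℂ, 0 < x.re → ψ x = (∫ x' in A, greenC x x') / ε ^ 2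
  symm : ∀ x ∈ A, (starRingEnd ℂ) x ∈ A
  circ : ∫ x in A, x.re = κ * ε ^ 2
  mem : (p : ℂ) ∈ A
  max : ∀ x ∈ A, ψ x ≤ ψ p

/-- A bound for the profile on points of the strip at distance at most one. -/
lemma profile_le {δ : ℝ} (hδ : 0 < δ) {x x' : ℂ} (hx : δ ≤ x.re ∧ x.re ≤ 1 / δ)
    (hx' : δ ≤ x'.re ∧ x'.re ≤ 1 / δ) (hne : x ≠ x') (hd : ‖x - x'‖ ≤ 1) :
    profile (‖x - x'‖ ^ 2 / (x.re * x'.re))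
      ≤ 20 + 2 / δ ^ 2 + 2 / δ + 2 * Real.log (1 / ‖x - x'‖) := by
  have h0 : 0 < x.re := hδ.trans_le hx.1
  have h0' : 0 < x'.re := hδ.trans_le hx'.1
  have hn : 0 < ‖x - x'‖ := norm_pos_iff.2 (sub_ne_zero.2 hne)
  have hτ : 0 < ‖x - x'‖ ^ 2 / (x.re * x'.re) := by positivity
  rw [profile_eq hτ]
  have h1 := (le_abs_self _).trans (abs_profileReg_le hτ)
  have h2 : ‖x - x'‖ ^ 2 / (x.re * x'.re) ≤ 1 / δ ^ 2 := by
    apply div_le_div₀ zero_le_one (by nlinarith) (by positivity)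
    nlinarith
  have h3 : Real.log (‖x - x'‖ ^ 2 / (x.re * x'.re))
      = 2 * Real.log ‖x - x'‖ - Real.log x.re - Real.log x'.re := by
    rw [Real.log_div (by positivity) (by positivity), Real.log_pow, Real.log_mul h0.ne' h0'.ne']
    push_cast
    ring
  have h4 : ∀ t, 0 < t → t ≤ 1 / δ → Real.log t ≤ 1 / δ := fun t ht1 ht2 =>
    (Real.log_le_sub_one_of_pos ht1).trans (by linarith)
  rw [h3, one_div ‖x - x'‖, Real.log_inv]
  have := h4 _ h0 hx.2
  have := h4 _ h0' hx'.2
  have e1 : 2 / δ ^ 2 = 2 * (1 / δ ^ 2) := by ring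
  have e2 : 2 / δ = 2 * (1 / δ) := by ring
  linarith

/-- The pointwise bound for the Green function used for the a priori estimates. -/
lemma greenC_le {δ : ℝ} (hδ : 0 < δ) {x x' : ℂ} (hx : δ ≤ x.re ∧ x.re ≤ 1 / δ)
    (hx' : δ ≤ x'.re ∧ x'.re ≤ 1 / δ) (hne : x ≠ x') (hd : ‖x - x'‖ ≤ 1) {B : ℝ}
    (hB : Real.log (1 / ‖x - x'‖) ≤ B) :
    greenC x x' ≤ 1 / δ ^ 2 * (20 + 2 / δ ^ 2 + 2 / δ + 2 * B) := by
  have h0 : 0 < x.re := hδ.trans_le hx.1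
  have h0' : 0 < x'.re := hδ.trans_le hx'.1
  have hn : 0 < ‖x - x'‖ := norm_pos_iff.2 (sub_ne_zero.2 hne)
  have hB0 : 0 ≤ B := by
    refine le_trans (Real.log_nonneg ?_) hB
    rwa [le_div_iff₀ hn, one_mul]
  rw [greenC_eq h0 h0']
  have h1 := profile_le hδ hx hx' hne hd
  have hpre0 : 0 ≤ √x.re * (x'.re * √x'.re) / (4 * π) := by positivity
  have hpre : √x.re * (x'.re * √x'.re) / (4 * π) ≤ 1 / δ ^ 2 := by
    have e1 : √x.re * (x'.re * √x'.re) ≤ 1 / δ ^ 2 := by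
      have a1 : √x.re ≤ √(1 / δ) := Real.sqrt_le_sqrt hx.2
      have a2 : √x'.re ≤ √(1 / δ) := Real.sqrt_le_sqrt hx'.2
      have a3 : √x.re * √x'.re ≤ 1 / δ := by
        calc √x.re * √x'.re ≤ √(1 / δ) * √(1 / δ) := by gcongr
          _ = 1 / δ := Real.mul_self_sqrt (by positivity)
      calc √x.re * (x'.re * √x'.re) = x'.re * (√x.re * √x'.re) := by ring
        _ ≤ (1 / δ) * (1 / δ) := by gcongr; exact hx'.2
        _ = _ := by rw [← one_div_pow, pow_two]
    have e2 : (1 : ℝ) ≤ 4 * π := by linarith [Real.pi_gt_three]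
    exact (div_le_self (by positivity) e2).trans e1
  have h2 : profile (‖x - x'‖ ^ 2 / (x.re * x'.re)) ≤ 20 + 2 / δ ^ 2 + 2 / δ + 2 * B := by
    linarith
  calc _ ≤ √x.re * (x'.re * √x'.re) / (4 * π) * (20 + 2 / δ ^ 2 + 2 / δ + 2 * B) :=
        mul_le_mul_of_nonneg_left h2 hpre0
    _ ≤ _ := mul_le_mul_of_nonneg_right hpre (by positivity)

namespace RingData

variable {κ W δ ε μ : ℝ} {A : Set ℂ} {ψ : ℂ → ℝ} {p : ℝ}

lemma isBounded (R : RingData κ W δ ε μ A ψ p) : Bornology.IsBounded A :=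
  (Metric.isBounded_closedBall (x := (p : ℂ)) (r := 1)).subset fun x hx => by
    simpa [dist_eq_norm] using R.diam x hx _ R.mem

lemma volume_ne_top (R : RingData κ W δ ε μ A ψ p) : volume A ≠ ⊤ :=
  R.isBounded.measure_lt_top.ne

lemma measurableSet (R : RingData κ W δ ε μ A ψ p) : MeasurableSet A :=
  R.isOpen.measurableSet

lemma re_pos (R : RingData κ W δ ε μ A ψ p) {x : ℂ} (hx : x ∈ A) : 0 < x.re :=
  R.delta_pos.trans_le (R.strip x hx).1

lemma integrableOn_bdd (R : RingData κ W δ ε μ A ψ p) {f : ℂ → ℝ} (hf : Measurable f) {C : ℝ}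
    (hC : ∀ x ∈ A, |f x| ≤ C) : IntegrableOn f A :=
  Measure.integrableOn_of_bounded R.volume_ne_top hf.aestronglyMeasurable
    ((ae_restrict_mem R.measurableSet).mono fun x hx => by simpa using hC x hx)

lemma integrableOn_re (R : RingData κ W δ ε μ A ψ p) : IntegrableOn (fun x : ℂ => x.re) A :=
  R.integrableOn_bdd Complex.measurable_re (C := 1 / δ) fun x hx => by
    rw [abs_of_pos (R.re_pos hx)]
    exact (R.strip x hx).2

lemma volume_le (R : RingData κ W δ ε μ A ψ p) : volume.real A ≤ κ / δ * ε ^ 2 := by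
  have h : ∫ _ in A, δ ≤ ∫ x in A, x.re :=
    setIntegral_mono_on (integrableOn_const R.volume_ne_top) R.integrableOn_re R.measurableSet
      fun x hx => (R.strip x hx).1
  rw [R.circ, setIntegral_const, smul_eq_mul] at h
  rw [div_mul_eq_mul_div, le_div_iff₀ R.delta_pos]
  exact h

lemma sqrt_volume_le (R : RingData κ W δ ε μ A ψ p) : √(volume.real A) ≤ √(κ / δ) * ε := by
  have := R.delta_pos
  have := R.kappa_pos
  refine (Real.sqrt_le_sqrt R.volume_le).trans ?_
  rw [Real.sqrt_mul (by positivity), Real.sqrt_sq R.eps_pos.le]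

lemma log_inv_norm_le (R : RingData κ W δ ε μ A ψ p) {v : ℂ} (hv : v ≠ 0) :
    Real.log (1 / ‖v‖) ≤ Real.log (1 / ε) + ε * ‖v‖⁻¹ := by
  have hn : 0 < ‖v‖ := norm_pos_iff.2 hv
  have hε := R.eps_pos
  have h := Real.log_le_sub_one_of_pos (div_pos hε hn)
  rw [Real.log_div hε.ne' hn.ne'] at h
  rw [one_div, Real.log_inv, one_div, Real.log_inv, ← div_eq_mul_inv]
  linarith

lemma setIntegral_greenC_le (R : RingData κ W δ ε μ A ψ p) {x : ℂ} (hx : x ∈ A) {E : Set ℂ}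
    (hE : MeasurableSet E) (hEA : E ⊆ A) {b c : ℝ} (hb : 0 ≤ b) (hc : 0 ≤ c)
    (hB : ∀ x' ∈ E, x ≠ x' → Real.log (1 / ‖x - x'‖) ≤ b + c * ‖x - x'‖⁻¹) :
    ∫ x' in E, greenC x x' ≤ 1 / δ ^ 2 * ((20 + 2 / δ ^ 2 + 2 / δ + 2 * b) * volume.real E
      + 16 * c * √(volume.real E)) := by
  have hδ := R.delta_pos
  have hv : volume E ≠ ⊤ := ne_top_of_le_ne_top R.volume_ne_top (measure_mono hEA)
  have hi := (integrableOn_inv_norm_sub hv x).1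
  set C := 20 + 2 / δ ^ 2 + 2 / δ + 2 * b with hC
  have hC0 : 0 ≤ C := by rw [hC]; positivity
  have hfi : IntegrableOn (fun x' => 1 / δ ^ 2 * (C + 2 * c * ‖x - x'‖⁻¹)) E :=
    ((integrableOn_const hv).add (hi.const_mul _)).const_mul _
  have h1 : ∫ x' in E, greenC x x' ≤ ∫ x' in E, 1 / δ ^ 2 * (C + 2 * c * ‖x - x'‖⁻¹) := by
    by_cases hg : IntegrableOn (fun x' => greenC x x') E
    · refine setIntegral_mono_ae_restrict hg hfi ?_
      have hne : ∀ᵐ y : ℂ ∂(volume.restrict E), y ≠ x :=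
        ae_restrict_of_ae (by simp [ae_iff])
      filter_upwards [hne, ae_restrict_mem hE] with y hy hyE
      have := greenC_le hδ (R.strip x hx) (R.strip y (hEA hyE)) (Ne.symm hy)
        (R.diam x hx y (hEA hyE)) (hB y hyE (Ne.symm hy))
      refine this.trans (le_of_eq ?_)
      rw [hC]
      ring
    · rw [integral_undef hg]
      refine setIntegral_nonneg hE fun y _ => ?_
      positivity
  refine h1.trans ?_
  rw [integral_const_mul]
  refine mul_le_mul_of_nonneg_left ?_ (by positivity)
  have hic : IntegrableOn (fun _ : ℂ => C) E := integrableOn_const hv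
  rw [integral_add hic (hi.const_mul _), integral_const_mul, setIntegral_const, smul_eq_mul]
  have := mul_le_mul_of_nonneg_left (integral_inv_norm_sub_le hv x)
    (by positivity : 0 ≤ 2 * c)
  linarith

end RingData

/-- The stream function is of order `log (1/ε)` on the cross-section. -/
lemma exists_stream_le (κ W δ : ℝ) : ∃ C > 0, ∀ ε μ A ψ p, RingData κ W δ ε μ A ψ p →
    ∀ x ∈ A, ψ x ≤ C * Real.log (1 / ε) := by
  by_cases hpos : 0 < κ ∧ 0 < δ
  swap
  · exact ⟨1, one_pos, fun ε μ A ψ p R => absurd ⟨R.kappa_pos, R.delta_pos⟩ hpos⟩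
  obtain ⟨hκ, hδ⟩ := hpos
  refine ⟨1 / δ ^ 2 * ((22 + 2 / δ ^ 2 + 2 / δ) * (κ / δ) + 16 * √(κ / δ)), by positivity, ?_⟩
  intro ε μ A ψ p R x hx
  have hε := R.eps_pos
  have hL := R.one_le_log
  rw [R.repr x (R.re_pos hx), div_le_iff₀ (by positivity)]
  have h := R.setIntegral_greenC_le hx R.measurableSet subset_rfl (b := Real.log (1 / ε)) (c := ε)
    (by linarith) hε.le (fun x' _ hne => R.log_inv_norm_le (sub_ne_zero.2 hne))
  refine h.trans ?_
  rw [mul_assoc (1 / δ ^ 2), mul_assoc (1 / δ ^ 2)]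
  refine mul_le_mul_of_nonneg_left ?_ (by positivity)
  set L := Real.log (1 / ε)
  have e1 : (20 + 2 / δ ^ 2 + 2 / δ + 2 * L) * volume.real A
      ≤ ((22 + 2 / δ ^ 2 + 2 / δ) * L) * (κ / δ * ε ^ 2) := by
    refine mul_le_mul ?_ R.volume_le measureReal_nonneg (by positivity)
    have : 0 ≤ 20 + 2 / δ ^ 2 + 2 / δ := by positivity
    nlinarith
  have e2 : 16 * ε * √(volume.real A) ≤ 16 * √(κ / δ) * L * ε ^ 2 := by
    have := R.sqrt_volume_le
    calc 16 * ε * √(volume.real A) ≤ 16 * ε * (√(κ / δ) * ε) := by gcongr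
      _ = 16 * √(κ / δ) * 1 * ε ^ 2 := by ring
      _ ≤ _ := by gcongr
  nlinarith

/-- Every ball of radius a small power of `ε` about a point of the cross-section contains a fixed
part of its area. -/
lemma exists_volume_inter_ball_ge (κ W δ : ℝ) : ∃ β > 0, ∃ c > 0, ∃ L₀ : ℝ, ∀ ε μ A ψ p,
    RingData κ W δ ε μ A ψ p → L₀ ≤ Real.log (1 / ε) → ∀ x ∈ A,
      c * ε ^ 2 ≤ volume.real (A ∩ Metric.ball x (Real.exp (-(β * Real.log (1 / ε))))) := by
  by_cases hpos : 0 < κ ∧ 0 < W ∧ 0 < δ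
  swap
  · exact ⟨1, one_pos, 1, one_pos, 0, fun ε μ A ψ p R =>
      absurd ⟨R.kappa_pos, R.W_pos, R.delta_pos⟩ hpos⟩
  obtain ⟨hκ, hW, hδ⟩ := hpos
  set C₁ := 20 + 2 / δ ^ 2 + 2 / δ with hC₁
  set a := W / 2 * δ ^ 2 with ha
  have ha0 : 0 < a := by positivity
  have hC₁0 : 0 < C₁ := by positivity
  set q := 1 / δ ^ 2 with hq
  have hq0 : 0 < q := by positivity
  set v := κ / δ with hv
  have hv0 : 0 < v := by positivity
  refine ⟨a / (8 * q * v), by positivity, a / (2 * q * (C₁ + 2)), by positivity,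
    4 * q * (C₁ * v + 16 * √v) / a, ?_⟩
  intro ε μ A ψ p R hL₀ x hx
  set L := Real.log (1 / ε) with hL
  set β := a / (8 * q * v) with hβ
  set r := Real.exp (-(β * L)) with hr
  have hr0 : 0 < r := Real.exp_pos _
  have hL1 : 1 ≤ L := R.one_le_log
  have hε := R.eps_pos
  have hβ0 : 0 < β := by positivity
  have hm1 : MeasurableSet (A ∩ Metric.ball x r) :=
    R.measurableSet.inter Metric.isOpen_ball.measurableSet
  have hm2 : MeasurableSet (A \ Metric.ball x r) :=
    R.measurableSet.diff Metric.isOpen_ball.measurableSet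
  have hψ : a * L ≤ ψ x := by
    have h1 := ((R.level x (R.re_pos hx)).1 hx).le
    have h2 : δ ^ 2 ≤ x.re ^ 2 := by
      have := (R.strip x hx).1
      gcongr
    have h3 : a * L ≤ W / 2 * x.re ^ 2 * L := by
      rw [ha]; gcongr
    linarith [R.mu_pos]
  rw [R.repr x (R.re_pos hx), le_div_iff₀ (by positivity)] at hψ
  have hsum : ∫ x' in A, greenC x x' ≤
      q * ((C₁ + 2 * L) * volume.real (A ∩ Metric.ball x r) + 16 * ε * (√v * ε))
      + q * ((C₁ + 2 * (β * L)) * (v * ε ^ 2)) := by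
    have e1 : ∫ x' in A ∩ Metric.ball x r, greenC x x' ≤
        q * ((C₁ + 2 * L) * volume.real (A ∩ Metric.ball x r) + 16 * ε * (√v * ε)) := by
      refine (R.setIntegral_greenC_le hx hm1 Set.inter_subset_left (b := L) (c := ε)
        (by linarith) hε.le
        (fun x' _ hne => R.log_inv_norm_le (sub_ne_zero.2 hne))).trans ?_
      have : √(volume.real (A ∩ Metric.ball x r)) ≤ √v * ε :=
        (Real.sqrt_le_sqrt (measureReal_mono Set.inter_subset_left R.volume_ne_top)).trans
          R.sqrt_volume_le
      gcongr
    have e2 : ∫ x' in A \ Metric.ball x r, greenC x x' ≤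
        q * ((C₁ + 2 * (β * L)) * (v * ε ^ 2)) := by
      refine (R.setIntegral_greenC_le hx hm2 Set.sdiff_subset (b := β * L) (c := 0)
        (by positivity) le_rfl (fun x' hx' hne => ?_)).trans ?_
      · have hge : r ≤ ‖x - x'‖ := by
          have := hx'.2
          rw [Metric.mem_ball, not_lt, dist_comm, dist_eq_norm] at this
          exact this
        have := Real.log_le_log hr0 hge
        rw [hr, Real.log_exp] at this
        rw [one_div, Real.log_inv]
        linarith
      · have : volume.real (A \ Metric.ball x r) ≤ v * ε ^ 2 :=
          (measureReal_mono Set.sdiff_subset R.volume_ne_top).trans R.volume_le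
        simp only [mul_zero, zero_mul, add_zero]
        gcongr
    by_cases hg : IntegrableOn (fun x' => greenC x x') A
    · rw [← integral_inter_add_sdiff (Metric.isOpen_ball (x := x) (ε := r)).measurableSet hg]
      exact add_le_add e1 e2
    · rw [integral_undef hg]
      positivity
  have h4 := hψ.trans hsum
  set V := volume.real (A ∩ Metric.ball x r) with hV
  rw [div_le_iff₀ ha0] at hL₀
  have hβ2 : q * (2 * (β * L) * (v * ε ^ 2)) = a * L / 4 * ε ^ 2 := by
    rw [hβ]
    field_simp
    ring
  have h5 : q * ((C₁ + 2 * L) * V) ≥ a * L / 2 * ε ^ 2 := by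
    have h6 : q * (C₁ * v + 16 * √v) * ε ^ 2 ≤ a * L / 4 * ε ^ 2 := by
      gcongr
      linarith
    nlinarith
  have hV0 : 0 ≤ V := measureReal_nonneg
  have h7 : q * ((C₁ + 2 * L) * V) ≤ q * (((C₁ + 2) * L) * V) := by
    gcongr
    nlinarith
  rw [div_mul_eq_mul_div, div_le_iff₀ (by positivity)]
  have h8 : a * ε ^ 2 * L ≤ V * (2 * q * (C₁ + 2)) * L := by nlinarith
  exact le_of_mul_le_mul_right h8 (by linarith)

/-- The cross-section is small compared with `1 / log (1/ε)`. -/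
theorem exists_log_mul_dist_le (κ W δ s : ℝ) (hs : 0 < s) : ∃ L₀ : ℝ, ∀ ε μ A ψ p,
    RingData κ W δ ε μ A ψ p → L₀ ≤ Real.log (1 / ε) → ∀ x ∈ A,
      Real.log (1 / ε) * ‖x - p‖ ≤ s := by
  by_cases hpos : 0 < κ ∧ 0 < δ
  swap
  · exact ⟨1, fun ε μ A ψ p R => absurd ⟨R.kappa_pos, R.delta_pos⟩ hpos⟩
  obtain ⟨hκ, hδ⟩ := hpos
  obtain ⟨β, hβ, c, hc, L₁, hmain⟩ := exists_volume_inter_ball_ge κ W δ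
  obtain ⟨N, hN⟩ := exists_nat_gt (κ / δ / c)
  have hlim : Tendsto (fun L : ℝ => 2 * N * (L * Real.exp (-(β * L)))) atTop (nhds 0) := by
    have := (Real.tendsto_pow_mul_exp_neg_atTop_nhds_zero 1).comp
      (tendsto_id.const_mul_atTop hβ)
    have h2 := (this.const_mul (2 * N / β))
    rw [mul_zero] at h2
    refine h2.congr fun L => ?_
    simp only [Function.comp, id, pow_one]
    field_simp
  obtain ⟨L₂, hL₂⟩ := eventually_atTop.1 (hlim.eventually (gt_mem_nhds hs))
  refine ⟨max L₁ L₂, fun ε μ A ψ p R hL x hx => ?_⟩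
  have hm := hmain ε μ A ψ p R ((le_max_left _ _).trans hL)
  have hlt := hL₂ _ ((le_max_right _ _).trans hL)
  set L := Real.log (1 / ε) with hLdef
  have hL1 : 1 ≤ L := R.one_le_log
  set r := Real.exp (-(β * L)) with hr
  have hr0 : 0 < r := Real.exp_pos _
  have hε := R.eps_pos
  suffices h : ‖x - p‖ ≤ 2 * N * r by
    calc L * ‖x - p‖ ≤ L * (2 * N * r) := by gcongr
      _ = 2 * N * (L * r) := by ring
      _ ≤ s := hlt.le
  by_contra hcon
  push Not at hcon
  have hex : ∀ j : Fin N, ∃ z ∈ A, ‖z - p‖ = 2 * j * r := by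
    intro j
    have hpre := R.preconn.image (fun z : ℂ => ‖z - p‖) (by fun_prop)
    have h0 : (0 : ℝ) ∈ (fun z : ℂ => ‖z - p‖) '' A := ⟨p, R.mem, by simp⟩
    have h1 : ‖x - p‖ ∈ (fun z : ℂ => ‖z - p‖) '' A := ⟨x, hx, rfl⟩
    have hj : (j : ℝ) ≤ N := by exact_mod_cast j.2.le
    have := hpre.ordConnected.out h0 h1 (show 2 * (j : ℝ) * r ∈ Set.Icc 0 ‖x - p‖ from
      ⟨by positivity, by
        refine le_trans ?_ hcon.le
        gcongr⟩)
    obtain ⟨z, hz, hz2⟩ := this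
    exact ⟨z, hz, hz2⟩
  choose z hzA hz using hex
  have hdisj : Pairwise (Function.onFun Disjoint fun j : Fin N => A ∩ Metric.ball (z j) r) := by
    intro i j hij
    refine Disjoint.mono Set.inter_subset_right Set.inter_subset_right ?_
    apply Metric.ball_disjoint_ball
    have h1 : |‖z i - p‖ - ‖z j - p‖| ≤ ‖z i - z j‖ := by
      have := abs_norm_sub_norm_le (z i - p) (z j - p)
      rwa [sub_sub_sub_cancel_right] at this
    rw [hz, hz] at h1
    rw [dist_eq_norm]
    refine le_trans ?_ h1
    have h2 : (1 : ℝ) ≤ |(i : ℝ) - j| := by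
      have : (1 : ℤ) ≤ |(i : ℤ) - j| := by
        apply Int.one_le_abs
        intro h
        apply hij
        ext
        omega
      exact_mod_cast this
    rw [show 2 * (i : ℝ) * r - 2 * j * r = (2 * r) * (i - j) by ring, abs_mul,
      abs_of_pos (by positivity : 0 < 2 * r)]
    nlinarith
  have hsum : (N : ℝ) * (c * ε ^ 2) ≤ volume.real A := by
    have hU : (⋃ j : Fin N, A ∩ Metric.ball (z j) r) ⊆ A :=
      Set.iUnion_subset fun j => Set.inter_subset_left
    have e1 := measureReal_mono hU R.volume_ne_top
    have e2 : volume.real (⋃ j : Fin N, A ∩ Metric.ball (z j) r)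
        = ∑ j : Fin N, volume.real (A ∩ Metric.ball (z j) r) := by
      rw [Measure.real, measure_iUnion hdisj
        (fun j => R.measurableSet.inter Metric.isOpen_ball.measurableSet), tsum_fintype,
        ENNReal.toReal_sum]
      · rfl
      · intro j _
        exact ne_top_of_le_ne_top R.volume_ne_top (measure_mono Set.inter_subset_left)
    have e3 : ∑ _j : Fin N, c * ε ^ 2 ≤ ∑ j : Fin N, volume.real (A ∩ Metric.ball (z j) r) :=
      Finset.sum_le_sum fun j _ => hm (z j) (hzA j)
    simp only [Finset.sum_const, Finset.card_univ, Fintype.card_fin, nsmul_eq_mul] at e3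
    linarith
  have h3 := hsum.trans R.volume_le
  rw [div_lt_iff₀ hc] at hN
  have : 0 < ε ^ 2 := by positivity
  nlinarith

end VortexRing

namespace VortexRing

/-- A `C²` function is close to its tangent, uniformly on compact subintervals of `(0, ∞)`. -/
lemma exists_linearization {f : ℝ → ℝ} (hf : ContDiffOn ℝ 2 f (Set.Ioi 0)) {m M : ℝ}
    (hm : 0 < m) : ∃ K ≥ 0, ∀ z ∈ Set.Icc m M, ∀ a ∈ Set.Icc m M, ∀ b ∈ Set.Icc m M, ∀ ϱ : ℝ,
      |a - z| ≤ ϱ → |b - z| ≤ ϱ → |f b - f a - deriv f z * (b - a)| ≤ K * ϱ * |b - a| := by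
  have hI : Set.Icc m M ⊆ Set.Ioi 0 := fun x hx => hm.trans_le hx.1
  have h2 : ContDiffOn ℝ 1 (deriv f) (Set.Ioi 0) :=
    ((contDiffOn_succ_iff_deriv_of_isOpen (n := 1) isOpen_Ioi).1
      (by rwa [one_add_one_eq_two])).2.2
  have h3 : ContinuousOn (deriv (deriv f)) (Set.Ioi 0) :=
    h2.continuousOn_deriv_of_isOpen isOpen_Ioi le_rfl
  obtain ⟨K, hK⟩ := (isCompact_Icc (a := m) (b := M)).exists_bound_of_continuousOn (h3.mono hI)
  have hd1 : ∀ x ∈ Set.Icc m M, HasDerivAt f (deriv f x) x := fun x hx =>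
    (((hf.differentiableOn (by norm_num)) x (hI hx)).differentiableAt
      (isOpen_Ioi.mem_nhds (hI hx))).hasDerivAt
  have hd2 : ∀ x ∈ Set.Icc m M, HasDerivAt (deriv f) (deriv (deriv f) x) x := fun x hx =>
    (((h2.differentiableOn (by norm_num)) x (hI hx)).differentiableAt
      (isOpen_Ioi.mem_nhds (hI hx))).hasDerivAt
  refine ⟨max K 0, le_max_right _ _, fun z hz a ha b hb ϱ haz hbz => ?_⟩
  have hsub : ∀ x ∈ Set.uIcc a b, x ∈ Set.Icc m M := fun x hx =>
    Set.uIcc_subset_Icc ha hb hx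
  have key : ∀ x ∈ Set.uIcc a b, ‖deriv f x - deriv f z‖ ≤ max K 0 * ϱ := by
    intro x hx
    have h := Convex.norm_image_sub_le_of_norm_hasDerivWithin_le (f := deriv f)
      (C := max K 0) (s := Set.Icc m M)
      (fun y hy => (hd2 y hy).hasDerivWithinAt)
      (fun y hy => (hK y hy).trans (le_max_left _ _)) (convex_Icc m M) hz (hsub x hx)
    refine h.trans (mul_le_mul_of_nonneg_left ?_ (le_max_right _ _))
    rw [Real.norm_eq_abs, abs_le]
    have := abs_le.1 haz
    have := abs_le.1 hbz
    rcases Set.mem_uIcc.1 hx with h | h <;> constructor <;> linarith [h.1, h.2]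
  have h := Convex.norm_image_sub_le_of_norm_hasDerivWithin_le
    (f := fun x => f x - deriv f z * x) (f' := fun x => deriv f x - deriv f z)
    (C := max K 0 * ϱ) (s := Set.uIcc a b)
    (fun y hy => ((hd1 y (hsub y hy)).sub
      (by simpa using (hasDerivAt_id y).const_mul (deriv f z))).hasDerivWithinAt)
    key (convex_uIcc a b) Set.left_mem_uIcc Set.right_mem_uIcc
  simp only [Real.norm_eq_abs] at h
  convert h using 2
  ring

/-- The denominator of the Möbius chart. -/
def mobN (e α y : ℂ) : ℂ := 1 + α * e * y

/-- The Möbius chart. -/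
def mobS (p : ℝ) (e α y : ℂ) : ℂ := p + e * y / mobN e α y

/-- The inverse of the Möbius chart. -/
def mobT (p : ℝ) (e α x : ℂ) : ℂ := (starRingEnd ℂ) e * (x - p) / (1 - α * (x - p))

/-- Smallness conditions on the parameters of the Möbius chart. -/
structure Mob (δ D p : ℝ) (e α : ℂ) : Prop where
  delta_pos : 0 < δ
  le_p : δ ≤ p
  p_le : p ≤ 1 / δ
  norm_e : ‖e‖ = 1
  norm_α : ‖α‖ ≤ 1 / δ + 1
  D_pos : 0 < D
  small : D * (1 / δ + 1) ≤ 1 / 32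

namespace Mob

variable {δ D p : ℝ} {e α : ℂ}

lemma conj_mul_e (H : Mob δ D p e α) : (starRingEnd ℂ) e * e = 1 := by
  rw [mul_comm, Complex.mul_conj, Complex.normSq_eq_norm_sq, H.norm_e]
  simp

lemma norm_aey_le (H : Mob δ D p e α) {y : ℂ} (hy : ‖y‖ ≤ 8 * D) :
    ‖α * e * y‖ ≤ 8 * (1 / δ + 1) * D := by
  rw [norm_mul, norm_mul, H.norm_e, mul_one]
  have := mul_le_mul H.norm_α hy (norm_nonneg _) ((norm_nonneg _).trans H.norm_α)
  linarith

lemma norm_N (H : Mob δ D p e α) {y : ℂ} (hy : ‖y‖ ≤ 8 * D) :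
    3 / 4 ≤ ‖mobN e α y‖ ∧ ‖mobN e α y‖ ≤ 5 / 4 := by
  have h := H.norm_aey_le hy
  have h2 := H.small
  have h3 := norm_add_le (1 : ℂ) (α * e * y)
  have h4 := norm_sub_le_norm_add (1 : ℂ) (α * e * y)
  rw [norm_one] at h3 h4
  unfold mobN
  constructor <;> linarith

lemma N_ne_zero (H : Mob δ D p e α) {y : ℂ} (hy : ‖y‖ ≤ 8 * D) : mobN e α y ≠ 0 := by
  have := (H.norm_N hy).1
  intro h
  rw [h, norm_zero] at this
  linarith

lemma S_sub_S (H : Mob δ D p e α) {y₁ y₂ : ℂ} (h1 : ‖y₁‖ ≤ 8 * D) (h2 : ‖y₂‖ ≤ 8 * D) :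
    mobS p e α y₁ - mobS p e α y₂ = e * (y₁ - y₂) / (mobN e α y₁ * mobN e α y₂) := by
  have n1 := H.N_ne_zero h1
  have n2 := H.N_ne_zero h2
  unfold mobS
  field_simp
  unfold mobN
  ring

lemma norm_S_sub_S (H : Mob δ D p e α) {y₁ y₂ : ℂ} (h1 : ‖y₁‖ ≤ 8 * D) (h2 : ‖y₂‖ ≤ 8 * D) :
    ‖mobS p e α y₁ - mobS p e α y₂‖ = ‖y₁ - y₂‖ / (‖mobN e α y₁‖ * ‖mobN e α y₂‖) := by
  rw [H.S_sub_S h1 h2, norm_div, norm_mul, norm_mul, H.norm_e, one_mul]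

lemma norm_S_sub_S_le (H : Mob δ D p e α) {y₁ y₂ : ℂ} (h1 : ‖y₁‖ ≤ 8 * D) (h2 : ‖y₂‖ ≤ 8 * D) :
    ‖mobS p e α y₁ - mobS p e α y₂‖ ≤ 2 * ‖y₁ - y₂‖ := by
  rw [H.norm_S_sub_S h1 h2]
  have n1 := (H.norm_N h1).1
  have n2 := (H.norm_N h2).1
  rw [div_le_iff₀ (by positivity)]
  have : 1 / 2 ≤ ‖mobN e α y₁‖ * ‖mobN e α y₂‖ := by nlinarith
  nlinarith [norm_nonneg (y₁ - y₂)]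

lemma S_zero : mobS p e α 0 = p := by simp [mobS]

lemma norm_S_sub_p (H : Mob δ D p e α) {y : ℂ} (hy : ‖y‖ ≤ 8 * D) :
    ‖mobS p e α y - p‖ ≤ 11 * D := by
  have n := (H.norm_N hy).1
  have hD := H.D_pos
  have : mobS p e α y - p = e * y / mobN e α y := by simp [mobS]
  rw [this, norm_div, norm_mul, H.norm_e, one_mul, div_le_iff₀ (by linarith)]
  nlinarith

lemma eleven_D_le (H : Mob δ D p e α) : 11 * D ≤ δ / 2 := by
  have h := H.small
  have hδ := H.delta_pos
  have hD := H.D_pos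
  have : D * (1 / δ) ≤ 1 / 32 := by nlinarith
  rw [mul_one_div, div_le_iff₀ hδ] at this
  linarith

lemma re_mem (H : Mob δ D p e α) {x : ℂ} (hx : ‖x - p‖ ≤ 11 * D) :
    x.re ∈ Set.Icc (δ / 2) (2 / δ) := by
  have h := (Complex.abs_re_le_norm _).trans hx
  have h2 := H.eleven_D_le
  have h3 := abs_le.1 h
  simp only [Complex.sub_re, Complex.ofReal_re] at h3
  have := H.le_p
  have := H.p_le
  have e : 2 / δ = 2 * (1 / δ) := by ring
  constructor
  · linarith [h3.1]
  · rw [e]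
    linarith [h3.2]

lemma re_S_mem (H : Mob δ D p e α) {y : ℂ} (hy : ‖y‖ ≤ 8 * D) :
    (mobS p e α y).re ∈ Set.Icc (δ / 2) (2 / δ) := H.re_mem (H.norm_S_sub_p hy)

lemma p_mem (H : Mob δ D p e α) : p ∈ Set.Icc (δ / 2) (2 / δ) := by
  simpa using H.re_mem (x := p) (by simpa using H.D_pos.le)

lemma abs_re_S_sub_p (H : Mob δ D p e α) {y : ℂ} (hy : ‖y‖ ≤ 8 * D) :
    |(mobS p e α y).re - p| ≤ 11 * D := by
  have h := (Complex.abs_re_le_norm _).trans (H.norm_S_sub_p hy)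
  simpa using h

lemma abs_re_S_sub_re_S (H : Mob δ D p e α) {y₁ y₂ : ℂ} (h1 : ‖y₁‖ ≤ 8 * D)
    (h2 : ‖y₂‖ ≤ 8 * D) :
    |(mobS p e α y₂).re - (mobS p e α y₁).re| ≤ 2 * ‖y₂ - y₁‖ := by
  have h := (Complex.abs_re_le_norm _).trans (H.norm_S_sub_S_le h2 h1)
  simpa using h

lemma norm_sub_of_im_eq {y₁ y₂ : ℂ} (him : y₁.im = y₂.im) (hre : y₁.re ≤ y₂.re) :
    y₂ - y₁ = ((y₂.re - y₁.re : ℝ) : ℂ) ∧ ‖y₂ - y₁‖ = y₂.re - y₁.re := by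
  have h : y₂ - y₁ = ((y₂.re - y₁.re : ℝ) : ℂ) := by
    apply Complex.ext <;> simp [him]
  refine ⟨h, ?_⟩
  rw [h, Complex.norm_real, Real.norm_eq_abs, abs_of_nonneg (by linarith)]

lemma re_S_sub_linear (H : Mob δ D p e α) {y₁ y₂ : ℂ} (h1 : ‖y₁‖ ≤ 8 * D) (h2 : ‖y₂‖ ≤ 8 * D)
    (him : y₁.im = y₂.im) (hre : y₁.re ≤ y₂.re) :
    |(mobS p e α y₂).re - (mobS p e α y₁).re - (y₂.re - y₁.re) * e.re|
      ≤ 32 * (1 / δ + 1) * D * (y₂.re - y₁.re) := by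
  obtain ⟨hd, -⟩ := norm_sub_of_im_eq him hre
  have n1 := H.norm_N h1
  have n2 := H.norm_N h2
  have n1' := H.N_ne_zero h1
  have n2' := H.N_ne_zero h2
  set t := y₂.re - y₁.re with ht
  have ht0 : 0 ≤ t := by linarith
  have e1 : mobS p e α y₂ - mobS p e α y₁ - t * e
      = t * e * ((1 - mobN e α y₁) * mobN e α y₂ + (1 - mobN e α y₂))
        / (mobN e α y₂ * mobN e α y₁) := by
    rw [H.S_sub_S h2 h1, hd]
    field_simp
    ring
  have e2 : (mobS p e α y₂).re - (mobS p e α y₁).re - t * e.re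
      = (mobS p e α y₂ - mobS p e α y₁ - t * e).re := by simp
  rw [e2]
  refine (Complex.abs_re_le_norm _).trans ?_
  rw [e1, norm_div, norm_mul, norm_mul, norm_mul, H.norm_e, Complex.norm_real, Real.norm_eq_abs,
    abs_of_nonneg ht0, mul_one]
  have q : ∀ y : ℂ, 1 - mobN e α y = -(α * e * y) := fun y => by unfold mobN; ring
  have a1 := H.norm_aey_le h1
  have a2 := H.norm_aey_le h2
  have b : ‖(1 - mobN e α y₁) * mobN e α y₂ + (1 - mobN e α y₂)‖ ≤ 18 * (1 / δ + 1) * D := by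
    refine (norm_add_le _ _).trans ?_
    rw [norm_mul, q, q, norm_neg, norm_neg]
    nlinarith [norm_nonneg (α * e * y₁)]
  have hc : 9 / 16 ≤ ‖mobN e α y₂‖ * ‖mobN e α y₁‖ := by nlinarith
  rw [div_le_iff₀ (by linarith)]
  have hp : 0 ≤ 32 * (1 / δ + 1) * D * t := by
    have := H.delta_pos
    have := H.D_pos
    positivity
  calc t * _ ≤ t * (18 * (1 / δ + 1) * D) := mul_le_mul_of_nonneg_left b ht0
    _ = 32 * (1 / δ + 1) * D * t * (9 / 16) := by ring
    _ ≤ _ := mul_le_mul_of_nonneg_left hc hp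

lemma normSq_N_linear (H : Mob δ D p e α) {y₁ y₂ : ℂ} (h1 : ‖y₁‖ ≤ 8 * D) (h2 : ‖y₂‖ ≤ 8 * D)
    (him : y₁.im = y₂.im) (hre : y₁.re ≤ y₂.re) :
    |‖mobN e α y₂‖ ^ 2 - ‖mobN e α y₁‖ ^ 2 - (y₂.re - y₁.re) * (2 * (α * e).re)|
      ≤ 16 * (1 / δ + 1) ^ 2 * D * (y₂.re - y₁.re) := by
  have q : ∀ y : ℂ, ‖mobN e α y‖ ^ 2
      = 1 + 2 * (α * e * y).re + ‖α * e‖ ^ 2 * ‖y‖ ^ 2 := by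
    intro y
    rw [← mul_pow, ← norm_mul, ← Complex.normSq_eq_norm_sq, ← Complex.normSq_eq_norm_sq]
    simp only [mobN, Complex.normSq_apply, Complex.add_re, Complex.add_im, Complex.one_re,
      Complex.one_im]
    ring
  obtain ⟨hd, hn⟩ := norm_sub_of_im_eq him hre
  have e1 : (α * e * y₂).re - (α * e * y₁).re = (α * e).re * (y₂.re - y₁.re) := by
    simp only [Complex.mul_re, him]
    ring
  have e2 : ‖mobN e α y₂‖ ^ 2 - ‖mobN e α y₁‖ ^ 2 - (y₂.re - y₁.re) * (2 * (α * e).re)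
      = ‖α * e‖ ^ 2 * (‖y₂‖ ^ 2 - ‖y₁‖ ^ 2) := by
    rw [q, q]
    linear_combination 2 * e1
  have hae : ‖α * e‖ ≤ 1 / δ + 1 := by
    rw [norm_mul, H.norm_e, mul_one]
    exact H.norm_α
  have b : |‖y₂‖ ^ 2 - ‖y₁‖ ^ 2| ≤ 16 * D * (y₂.re - y₁.re) := by
    rw [sq_sub_sq, abs_mul, ← hn]
    have := abs_norm_sub_norm_le y₂ y₁
    rw [abs_of_nonneg (by positivity)]
    exact mul_le_mul (by linarith) this (abs_nonneg _) (by linarith [H.D_pos])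
  rw [e2, abs_mul, abs_of_nonneg (by positivity)]
  calc _ ≤ (1 / δ + 1) ^ 2 * (16 * D * (y₂.re - y₁.re)) := by gcongr
    _ = _ := by ring

lemma normSq_N_mem (H : Mob δ D p e α) {y : ℂ} (hy : ‖y‖ ≤ 8 * D) :
    ‖mobN e α y‖ ^ 2 ∈ Set.Icc (9 / 16 : ℝ) (25 / 16) := by
  have := H.norm_N hy
  constructor <;> nlinarith

lemma abs_normSq_N_sub_one (H : Mob δ D p e α) {y : ℂ} (hy : ‖y‖ ≤ 8 * D) :
    |‖mobN e α y‖ ^ 2 - 1| ≤ 18 * (1 / δ + 1) * D := by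
  have h := H.norm_N hy
  have h1 : |‖mobN e α y‖ - 1| ≤ 8 * (1 / δ + 1) * D := by
    have := abs_norm_sub_norm_le (mobN e α y) 1
    rw [norm_one] at this
    refine this.trans ?_
    have e : mobN e α y - 1 = α * e * y := by unfold mobN; ring
    rw [e]
    exact H.norm_aey_le hy
  have e' : ‖mobN e α y‖ ^ 2 - 1 = (‖mobN e α y‖ + 1) * (‖mobN e α y‖ - 1) := by ring
  rw [e', abs_mul, abs_of_nonneg (by positivity)]
  nlinarith [abs_nonneg (‖mobN e α y‖ - 1)]

lemma norm_alpha_mul_le (H : Mob δ D p e α) {x : ℂ} (hx : ‖x - p‖ ≤ D) :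
    ‖α * (x - p)‖ ≤ 1 / 32 := by
  rw [norm_mul, mul_comm]
  refine le_trans ?_ H.small
  exact mul_le_mul hx H.norm_α (norm_nonneg _) H.D_pos.le

lemma denom_norm (H : Mob δ D p e α) {x : ℂ} (hx : ‖x - p‖ ≤ D) :
    31 / 32 ≤ ‖1 - α * (x - p)‖ := by
  have h := H.norm_alpha_mul_le hx
  have := norm_sub_norm_le (1 : ℂ) (α * (x - p))
  rw [norm_one] at this
  linarith

lemma denom_ne_zero (H : Mob δ D p e α) {x : ℂ} (hx : ‖x - p‖ ≤ D) : 1 - α * (x - p) ≠ 0 := by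
  have := H.denom_norm hx
  intro h
  rw [h, norm_zero] at this
  linarith

lemma norm_T_le (H : Mob δ D p e α) {x : ℂ} (hx : ‖x - p‖ ≤ D) : ‖mobT p e α x‖ ≤ 2 * D := by
  have h := H.denom_norm hx
  unfold mobT
  rw [norm_div, norm_mul, RCLike.norm_conj, H.norm_e, one_mul, div_le_iff₀ (by linarith)]
  nlinarith [H.D_pos]

lemma N_T (H : Mob δ D p e α) {x : ℂ} (hx : ‖x - p‖ ≤ D) :
    mobN e α (mobT p e α x) = (1 - α * (x - p))⁻¹ := by
  have h := H.denom_ne_zero hx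
  unfold mobN mobT
  field_simp
  linear_combination (α * (x - p)) * H.conj_mul_e

lemma S_T (H : Mob δ D p e α) {x : ℂ} (hx : ‖x - p‖ ≤ D) : mobS p e α (mobT p e α x) = x := by
  have h := H.denom_ne_zero hx
  unfold mobS
  rw [H.N_T hx]
  have h2 : e * mobT p e α x / (1 - α * (x - p))⁻¹ = (starRingEnd ℂ) e * e * (x - p) := by
    unfold mobT
    rw [div_inv_eq_mul, mul_div_assoc', div_mul_cancel₀ _ h]
    ring
  rw [h2, H.conj_mul_e]
  ring

lemma T_S (H : Mob δ D p e α) {y : ℂ} (hy : ‖y‖ ≤ 8 * D) : mobT p e α (mobS p e α y) = y := by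
  have h := H.N_ne_zero hy
  unfold mobT mobS
  have e1 : (p : ℂ) + e * y / mobN e α y - p = e * y / mobN e α y := by ring
  have e2 : 1 - α * (e * y / mobN e α y) = (mobN e α y)⁻¹ := by
    field_simp
    unfold mobN
    ring
  rw [e1, e2]
  field_simp
  linear_combination y * H.conj_mul_e

lemma injOn_S (H : Mob δ D p e α) : Set.InjOn (mobS p e α) (Metric.closedBall 0 (8 * D)) := by
  intro y hy z hz h
  rw [← H.T_S (y := y) (by simpa using hy), h, H.T_S (by simpa using hz)]

lemma hasDerivAt_S (H : Mob δ D p e α) {y : ℂ} (hy : ‖y‖ ≤ 8 * D) :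
    HasDerivAt (mobS p e α) (e / mobN e α y ^ 2) y := by
  have h := H.N_ne_zero hy
  have hN : HasDerivAt (mobN e α) (α * e) y := by
    have := ((hasDerivAt_id y).const_mul (α * e)).const_add 1
    rwa [mul_one] at this
  have h1 : HasDerivAt (fun y => e * y) e y := by
    simpa using (hasDerivAt_id y).const_mul e
  have h2 := (h1.div hN h).const_add (p : ℂ)
  have h3 : (e * mobN e α y - e * y * (α * e)) / mobN e α y ^ 2 = e / mobN e α y ^ 2 := by
    congr 1
    unfold mobN
    ring
  rwa [h3] at h2

end Mob

end VortexRing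

namespace VortexRing

/-- The real determinant of multiplication by a complex number. -/
lemma abs_det_smul_one (c : ℂ) : |(c • (1 : ℂ →L[ℝ] ℂ)).det| = ‖c‖ ^ 2 := by
  have h : (c • (1 : ℂ →L[ℝ] ℂ)).det = Algebra.norm ℝ c := by
    rw [Algebra.norm_apply, ContinuousLinearMap.det]
    congr 1
  rw [h, Algebra.norm_complex_apply, Complex.normSq_eq_norm_sq, abs_of_nonneg (by positivity)]

/-- The weight `x₁^{3/2}`. -/
def dens (x : ℂ) : ℝ := x.re * √x.re

/-- The weight transported by the Möbius chart. -/
def mobDens (p : ℝ) (e α y : ℂ) : ℝ := ‖e / mobN e α y ^ 2‖ ^ 2 * dens (mobS p e α y)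

lemma measurable_dens : Measurable dens := by
  unfold dens
  exact Complex.measurable_re.mul (Complex.measurable_re.sqrt)

lemma measurable_mobN (e α : ℂ) : Measurable (mobN e α) := by
  unfold mobN
  fun_prop

lemma measurable_mobS (p : ℝ) (e α : ℂ) : Measurable (mobS p e α) := by
  unfold mobS
  have := measurable_mobN e α
  fun_prop

lemma measurable_mobT (p : ℝ) (e α : ℂ) : Measurable (mobT p e α) := by
  unfold mobT
  fun_prop

lemma measurable_mobDens (p : ℝ) (e α : ℂ) : Measurable (mobDens p e α) := by
  unfold mobDens
  have := measurable_mobN e α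
  have := measurable_dens.comp (measurable_mobS p e α)
  exact (((measurable_const.div ((measurable_mobN e α).pow_const 2)).norm).pow_const 2).mul this

namespace Mob

variable {δ D p : ℝ} {e α : ℂ} {A : Set ℂ}

lemma image_eq (H : Mob δ D p e α) (hA : ∀ x ∈ A, ‖x - p‖ ≤ D) :
    mobT p e α '' A = Metric.ball 0 (4 * D) ∩ mobS p e α ⁻¹' A := by
  ext y
  constructor
  · rintro ⟨x, hx, rfl⟩
    refine ⟨?_, ?_⟩
    · have := H.norm_T_le (hA x hx)
      rw [mem_ball_zero_iff]
      linarith [H.D_pos]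
    · rw [Set.mem_preimage, H.S_T (hA x hx)]
      exact hx
  · rintro ⟨h1, h2⟩
    rw [mem_ball_zero_iff] at h1
    exact ⟨_, h2, H.T_S (by linarith [H.D_pos])⟩

lemma mem_image_iff (H : Mob δ D p e α) (hA : ∀ x ∈ A, ‖x - p‖ ≤ D) {y : ℂ}
    (hy : ‖y‖ ≤ 8 * D) : y ∈ mobT p e α '' A ↔ mobS p e α y ∈ A := by
  constructor
  · rintro ⟨x, hx, rfl⟩
    rwa [H.S_T (hA x hx)]
  · intro h
    exact ⟨_, h, H.T_S hy⟩

lemma isOpen_image (H : Mob δ D p e α) (hA : ∀ x ∈ A, ‖x - p‖ ≤ D) (hO : IsOpen A) :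
    IsOpen (mobT p e α '' A) := by
  rw [H.image_eq hA]
  refine ContinuousOn.isOpen_inter_preimage (fun y hy => ?_) Metric.isOpen_ball hO
  rw [mem_ball_zero_iff] at hy
  exact (H.hasDerivAt_S (by linarith [H.D_pos])).continuousAt.continuousWithinAt

lemma norm_le_of_mem_image (H : Mob δ D p e α) (hA : ∀ x ∈ A, ‖x - p‖ ≤ D) {y : ℂ}
    (hy : y ∈ mobT p e α '' A) : ‖y‖ ≤ 2 * D := by
  obtain ⟨x, hx, rfl⟩ := hy
  exact H.norm_T_le (hA x hx)

lemma integral_dens_mul (H : Mob δ D p e α) (hA : ∀ x ∈ A, ‖x - p‖ ≤ D) (hO : IsOpen A)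
    (f : ℂ → ℝ) : ∫ y in mobT p e α '' A, mobDens p e α y * f y
      = ∫ x in A, dens x * f (mobT p e α x) := by
  have hb : ∀ y ∈ mobT p e α '' A, ‖y‖ ≤ 8 * D := fun y hy => by
    linarith [H.norm_le_of_mem_image hA hy, H.D_pos]
  have himg : mobS p e α '' (mobT p e α '' A) = A := by
    rw [Set.image_image]
    conv_rhs => rw [← Set.image_id' A]
    exact Set.image_congr fun x hx => H.S_T (hA x hx)
  have h := integral_image_eq_integral_abs_det_fderiv_smul volume
    (H.isOpen_image hA hO).measurableSet
    (f := mobS p e α) (f' := fun y => (e / mobN e α y ^ 2) • (1 : ℂ →L[ℝ] ℂ))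
    (fun y hy => (H.hasDerivAt_S (hb y hy)).complexToReal_fderiv.hasFDerivWithinAt)
    (H.injOn_S.mono fun y hy => by simpa using hb y hy)
    (fun x => dens x * f (mobT p e α x))
  rw [himg] at h
  rw [h]
  refine setIntegral_congr_fun (H.isOpen_image hA hO).measurableSet fun y hy => ?_
  simp only [smul_eq_mul]
  rw [abs_det_smul_one, H.T_S (hb y hy), mobDens]
  ring

lemma norm_deriv (H : Mob δ D p e α) (y : ℂ) :
    ‖e / mobN e α y ^ 2‖ ^ 2 = (‖mobN e α y‖ ^ 2)⁻¹ ^ 2 := by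
  rw [norm_div, H.norm_e, norm_pow, one_div]

lemma mobDens_pos (H : Mob δ D p e α) {y : ℂ} (hy : ‖y‖ ≤ 8 * D) : 0 < mobDens p e α y := by
  have hX := (H.re_S_mem hy).1
  have hX0 : 0 < (mobS p e α y).re := lt_of_lt_of_le (by linarith [H.delta_pos]) hX
  have := (H.normSq_N_mem hy).1
  have : 0 < ‖mobN e α y‖ ^ 2 := by linarith
  rw [mobDens, H.norm_deriv, dens]
  positivity

lemma mobDens_le (H : Mob δ D p e α) {y : ℂ} (hy : ‖y‖ ≤ 8 * D) :
    mobDens p e α y ≤ 4 * (2 / δ * √(2 / δ)) := by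
  have hX := H.re_S_mem hy
  have hX0 : 0 < (mobS p e α y).re := lt_of_lt_of_le (by linarith [H.delta_pos]) hX.1
  have hY := (H.normSq_N_mem hy).1
  have hY0 : 0 < ‖mobN e α y‖ ^ 2 := by linarith
  have h1 : (‖mobN e α y‖ ^ 2)⁻¹ ≤ 16 / 9 := by
    rw [inv_le_comm₀ hY0 (by norm_num)]
    norm_num
    linarith
  have hinv : 0 < (‖mobN e α y‖ ^ 2)⁻¹ := by positivity
  rw [mobDens, H.norm_deriv, dens]
  have h2 : √(mobS p e α y).re ≤ √(2 / δ) := Real.sqrt_le_sqrt hX.2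
  have h3 : (mobS p e α y).re * √(mobS p e α y).re ≤ 2 / δ * √(2 / δ) :=
    mul_le_mul hX.2 h2 (Real.sqrt_nonneg _) (hX0.le.trans hX.2)
  exact mul_le_mul (by nlinarith) h3 (by positivity) (by norm_num)

lemma log_mobDens (H : Mob δ D p e α) {y : ℂ} (hy : ‖y‖ ≤ 8 * D) :
    Real.log (mobDens p e α y)
      = 3 / 2 * Real.log (mobS p e α y).re - 2 * Real.log (‖mobN e α y‖ ^ 2) := by
  have hX := (H.re_S_mem hy).1
  have hX0 : 0 < (mobS p e α y).re := lt_of_lt_of_le (by linarith [H.delta_pos]) hX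
  have hY := (H.normSq_N_mem hy).1
  have hY0 : 0 < ‖mobN e α y‖ ^ 2 := by linarith
  have hs := Real.sqrt_pos.2 hX0
  rw [mobDens, H.norm_deriv, dens, Real.log_mul (by positivity) (by positivity),
    Real.log_mul hX0.ne' hs.ne', Real.log_pow, Real.log_inv, Real.log_sqrt hX0.le]
  push_cast
  ring

end Mob

/-- First order expansion of a function of the first coordinate in the Möbius chart. -/
lemma exists_expansion_re {f : ℝ → ℝ} (hf : ContDiffOn ℝ 2 f (Set.Ioi 0)) {δ : ℝ} (hδ : 0 < δ) :
    ∃ C ≥ 0, ∀ (D p : ℝ) (e α : ℂ), Mob δ D p e α → ∀ y₁ y₂ : ℂ, ‖y₁‖ ≤ 8 * D → ‖y₂‖ ≤ 8 * D →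
      y₁.im = y₂.im → y₁.re ≤ y₂.re →
      |f (mobS p e α y₂).re - f (mobS p e α y₁).re - (y₂.re - y₁.re) * (deriv f p * e.re)|
        ≤ C * D * (y₂.re - y₁.re) := by
  obtain ⟨K, hK, hlin⟩ := exists_linearization hf (m := δ / 2) (M := 2 / δ) (by positivity)
  have h2 : ContDiffOn ℝ 1 (deriv f) (Set.Ioi 0) :=
    ((contDiffOn_succ_iff_deriv_of_isOpen (n := 1) isOpen_Ioi).1
      (by rwa [one_add_one_eq_two])).2.2
  obtain ⟨B, hB⟩ := (isCompact_Icc (a := δ / 2) (b := 2 / δ)).exists_bound_of_continuousOn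
    (h2.continuousOn.mono fun x hx => lt_of_lt_of_le (by positivity) hx.1)
  refine ⟨22 * K + max B 0 * (32 * (1 / δ + 1)), by positivity, ?_⟩
  intro D p e α H y₁ y₂ h1 h2 him hre
  obtain ⟨-, hn⟩ := Mob.norm_sub_of_im_eq him hre
  have a1 := hlin p H.p_mem _ (H.re_S_mem h1) _ (H.re_S_mem h2) (11 * D)
    (H.abs_re_S_sub_p h1) (H.abs_re_S_sub_p h2)
  have a2 := H.abs_re_S_sub_re_S h1 h2
  rw [hn] at a2
  have a3 := H.re_S_sub_linear h1 h2 him hre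
  have a4 := (hB p H.p_mem).trans (le_max_left B 0)
  rw [Real.norm_eq_abs] at a4
  have hD := H.D_pos
  set t := y₂.re - y₁.re
  set X₁ := (mobS p e α y₁).re
  set X₂ := (mobS p e α y₂).re
  have e1 : f X₂ - f X₁ - t * (deriv f p * e.re)
      = (f X₂ - f X₁ - deriv f p * (X₂ - X₁)) + deriv f p * (X₂ - X₁ - t * e.re) := by ring
  rw [e1]
  refine (abs_add_le _ _).trans ?_
  rw [abs_mul (deriv f p)]
  have b1 : K * (11 * D) * |X₂ - X₁| ≤ K * (11 * D) * (2 * t) := by gcongr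
  have b2 := mul_le_mul a4 a3 (abs_nonneg _) (le_max_right B 0)
  linarith

lemma contDiffOn_log : ContDiffOn ℝ 2 Real.log (Set.Ioi 0) := fun _ hx =>
  (Real.contDiffAt_log.2 (ne_of_gt hx)).contDiffWithinAt

lemma contDiffOn_inv_sqrt : ContDiffOn ℝ 2 (fun x : ℝ => (√x)⁻¹) (Set.Ioi 0) := fun _ hx =>
  ((Real.contDiffAt_sqrt (ne_of_gt hx)).inv (Real.sqrt_pos.2 hx).ne').contDiffWithinAt

lemma contDiffOn_mul_sqrt : ContDiffOn ℝ 2 (fun x : ℝ => x * √x) (Set.Ioi 0) := fun _ hx =>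
  (contDiffAt_id.mul (Real.contDiffAt_sqrt (ne_of_gt hx))).contDiffWithinAt

/-- First order expansion of the conformal factor in the Möbius chart. -/
lemma exists_expansion_log_normSq {δ : ℝ} (hδ : 0 < δ) :
    ∃ C ≥ 0, ∀ (D p : ℝ) (e α : ℂ), Mob δ D p e α → ∀ y₁ y₂ : ℂ, ‖y₁‖ ≤ 8 * D → ‖y₂‖ ≤ 8 * D →
      y₁.im = y₂.im → y₁.re ≤ y₂.re →
      |Real.log (‖mobN e α y₂‖ ^ 2) - Real.log (‖mobN e α y₁‖ ^ 2)
        - (y₂.re - y₁.re) * (2 * (α * e).re)| ≤ C * D * (y₂.re - y₁.re) := by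
  obtain ⟨K, hK, hlin⟩ := exists_linearization contDiffOn_log (m := 9 / 16) (M := 25 / 16)
    (by norm_num)
  refine ⟨K * (18 * (1 / δ + 1)) * (3 * (1 / δ + 1)) + 16 * (1 / δ + 1) ^ 2, by positivity, ?_⟩
  intro D p e α H y₁ y₂ h1 h2 him hre
  have a1 := hlin 1 ⟨by norm_num, by norm_num⟩ _ (H.normSq_N_mem h1) _ (H.normSq_N_mem h2)
    (18 * (1 / δ + 1) * D) (H.abs_normSq_N_sub_one h1) (H.abs_normSq_N_sub_one h2)
  have a2 := H.normSq_N_linear h1 h2 him hre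
  have hα : |(α * e).re| ≤ 1 / δ + 1 := by
    refine (Complex.abs_re_le_norm _).trans ?_
    rw [norm_mul, H.norm_e, mul_one]
    exact H.norm_α
  have hD := H.D_pos
  have hs := H.small
  rw [Real.deriv_log, inv_one, one_mul] at a1
  set t := y₂.re - y₁.re with ht
  have ht0 : 0 ≤ t := by linarith
  set Y₁ := ‖mobN e α y₁‖ ^ 2
  set Y₂ := ‖mobN e α y₂‖ ^ 2
  have a3 : |Y₂ - Y₁| ≤ 3 * (1 / δ + 1) * t := by
    have e1 : Y₂ - Y₁ = (Y₂ - Y₁ - t * (2 * (α * e).re)) + t * (2 * (α * e).re) := by ring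
    rw [e1]
    refine (abs_add_le _ _).trans ?_
    rw [abs_mul t, abs_mul 2, abs_of_nonneg ht0, abs_of_pos (zero_lt_two' ℝ)]
    have b1 : t * (2 * |(α * e).re|) ≤ t * (2 * (1 / δ + 1)) := by gcongr
    have b2 : 16 * (1 / δ + 1) ^ 2 * D * t = 16 * (D * (1 / δ + 1)) * ((1 / δ + 1) * t) := by ring
    have b3 : 0 ≤ (1 / δ + 1) * t := by positivity
    nlinarith
  have e2 : Real.log Y₂ - Real.log Y₁ - t * (2 * (α * e).re)
      = (Real.log Y₂ - Real.log Y₁ - (Y₂ - Y₁)) + (Y₂ - Y₁ - t * (2 * (α * e).re)) := by ring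
  rw [e2]
  refine (abs_add_le _ _).trans ?_
  have b1 : K * (18 * (1 / δ + 1) * D) * |Y₂ - Y₁|
    ≤ K * (18 * (1 / δ + 1) * D) * (3 * (1 / δ + 1) * t) := by gcongr
  linarith

/-- The density in the Möbius chart is nonincreasing in the first variable as soon as the
parameter of the chart is tilted enough. -/
lemma exists_mobDens_antitone {δ : ℝ} (hδ : 0 < δ) :
    ∃ C > 0, ∀ (D p : ℝ) (e α : ℂ), Mob δ D p e α →
      C * D ≤ ((α - (3 / (8 * p) : ℝ)) * e).re → ∀ y₁ y₂ : ℂ, ‖y₁‖ ≤ 8 * D → ‖y₂‖ ≤ 8 * D →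
      y₁.im = y₂.im → y₁.re ≤ y₂.re → mobDens p e α y₂ ≤ mobDens p e α y₁ := by
  obtain ⟨C₁, hC₁, hX⟩ := exists_expansion_re contDiffOn_log hδ
  obtain ⟨C₂, hC₂, hY⟩ := exists_expansion_log_normSq hδ
  refine ⟨C₁ + C₂ + 1, by positivity, ?_⟩
  intro D p e α H hα y₁ y₂ h1 h2 him hre
  have a1 := (abs_le.1 (hX D p e α H y₁ y₂ h1 h2 him hre)).2
  have a2 := (abs_le.1 (hY D p e α H y₁ y₂ h1 h2 him hre)).1
  have hD := H.D_pos
  have hp : 0 < p := hδ.trans_le H.le_p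
  rw [← Real.log_le_log_iff (H.mobDens_pos h2) (H.mobDens_pos h1), H.log_mobDens h1,
    H.log_mobDens h2]
  rw [sub_mul, Complex.sub_re, Complex.re_ofReal_mul] at hα
  rw [Real.deriv_log] at a1
  set t := y₂.re - y₁.re with ht
  have ht0 : 0 ≤ t := by linarith
  have e1 : p⁻¹ * e.re = 8 / 3 * (3 / (8 * p) * e.re) := by
    field_simp
  rw [e1] at a1
  have b1 := mul_le_mul_of_nonneg_left hα ht0
  have b2 : 0 ≤ C₁ * D * t := by positivity
  have b3 : 0 ≤ C₂ * D * t := by positivity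
  have b4 : 0 ≤ D * t := by positivity
  nlinarith

end VortexRing

namespace VortexRing

/-- The normalized squared distance in the Möbius chart. -/
def mobDist (p : ℝ) (e α y x' : ℂ) : ℝ :=
  ‖mobS p e α y - x'‖ ^ 2 / ((mobS p e α y).re * x'.re)

/-- The regular part of the kernel in the Möbius chart. -/
def mobKer (p : ℝ) (e α y x' : ℂ) : ℝ :=
  Real.log (‖mobN e α y‖ ^ 2) + Real.log (mobS p e α y).re
    + (Real.log (‖mobN e α (mobT p e α x')‖ ^ 2) + Real.log x'.re)
    + profileReg (mobDist p e α y x')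

/-- The external potential in the Möbius chart. -/
def mobPot (W ε μ : ℝ) (A : Set ℂ) (ψ : ℂ → ℝ) (p : ℝ) (e α y : ℂ) : ℝ :=
  4 * π * ε ^ 2 / √(mobS p e α y).re * (ψ (mobS p e α y)
    - (μ + W / 2 * (mobS p e α y).re ^ 2 * Real.log (1 / ε)))
    - logPot (mobT p e α '' A) (mobDens p e α) y

namespace RingData

variable {κ W δ ε μ : ℝ} {A : Set ℂ} {ψ : ℂ → ℝ} {p : ℝ} {D : ℝ} {e α : ℂ}

lemma dens_pos (R : RingData κ W δ ε μ A ψ p) {x : ℂ} (hx : x ∈ A) : 0 < dens x := by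
  have := R.re_pos hx
  have := Real.sqrt_pos.2 this
  unfold dens
  positivity

lemma dens_le (R : RingData κ W δ ε μ A ψ p) {x : ℂ} (hx : x ∈ A) :
    dens x ≤ 1 / δ * √(1 / δ) :=
  mul_le_mul (R.strip x hx).2 (Real.sqrt_le_sqrt (R.strip x hx).2) (Real.sqrt_nonneg _)
    ((R.re_pos hx).le.trans (R.strip x hx).2)

lemma integrableOn_dens (R : RingData κ W δ ε μ A ψ p) : IntegrableOn dens A :=
  R.integrableOn_bdd measurable_dens fun x hx => by
    rw [abs_of_pos (R.dens_pos hx)]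
    exact R.dens_le hx

lemma integrableOn_dens_mul (R : RingData κ W δ ε μ A ψ p) {f : ℂ → ℝ}
    (hf : IntegrableOn f A) : IntegrableOn (fun x => dens x * f x) A := by
  refine Integrable.bdd_mul hf measurable_dens.aestronglyMeasurable (c := 1 / δ * √(1 / δ))
    ((ae_restrict_mem R.measurableSet).mono fun x hx => ?_)
  rw [Real.norm_eq_abs, abs_of_pos (R.dens_pos hx)]
  exact R.dens_le hx

lemma mass_le (R : RingData κ W δ ε μ A ψ p) :
    ∫ x in A, dens x ≤ 1 / δ * √(1 / δ) * (κ / δ * ε ^ 2) := by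
  have hδ := R.delta_pos
  have h : ∫ x in A, dens x ≤ ∫ _ in A, (1 / δ * √(1 / δ)) :=
    setIntegral_mono_on R.integrableOn_dens (integrableOn_const R.volume_ne_top) R.measurableSet
      fun x hx => R.dens_le hx
  rw [setIntegral_const, smul_eq_mul, mul_comm] at h
  exact h.trans (mul_le_mul_of_nonneg_left R.volume_le (by positivity))

lemma le_mass (R : RingData κ W δ ε μ A ψ p) : √δ * (κ * ε ^ 2) ≤ ∫ x in A, dens x := by
  rw [← R.circ, ← integral_const_mul]
  refine setIntegral_mono_on (R.integrableOn_re.const_mul _) R.integrableOn_dens R.measurableSet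
    fun x hx => ?_
  unfold dens
  rw [mul_comm]
  exact mul_le_mul_of_nonneg_left (Real.sqrt_le_sqrt (R.strip x hx).1) (R.re_pos hx).le

lemma mass_pos (R : RingData κ W δ ε μ A ψ p) : 0 < ∫ x in A, dens x := by
  refine lt_of_lt_of_le ?_ R.le_mass
  have := R.kappa_pos
  have := R.eps_pos
  have := Real.sqrt_pos.2 R.delta_pos
  positivity

lemma mobDist_nonneg (R : RingData κ W δ ε μ A ψ p) (H : Mob δ D p e α) {y : ℂ}
    (hy : ‖y‖ ≤ 8 * D) {x' : ℂ} (hx' : x' ∈ A) : 0 ≤ mobDist p e α y x' := by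
  have hX := (H.re_S_mem hy).1
  have hX0 : 0 < (mobS p e α y).re := lt_of_lt_of_le (by linarith [H.delta_pos]) hX
  have := R.re_pos hx'
  unfold mobDist
  positivity

lemma norm_S_sub_le (hA : ∀ x ∈ A, ‖x - p‖ ≤ D) (H : Mob δ D p e α) {y : ℂ}
    (hy : ‖y‖ ≤ 8 * D) {x' : ℂ} (hx' : x' ∈ A) : ‖mobS p e α y - x'‖ ≤ 12 * D := by
  have h1 := H.norm_S_sub_p hy
  have h2 := hA x' hx'
  have e1 : mobS p e α y - x' = (mobS p e α y - p) - (x' - p) := by ring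
  rw [e1]
  refine (norm_sub_le _ _).trans ?_
  linarith

lemma mobDist_le (R : RingData κ W δ ε μ A ψ p) (hA : ∀ x ∈ A, ‖x - p‖ ≤ D)
    (H : Mob δ D p e α) {y : ℂ} (hy : ‖y‖ ≤ 8 * D) {x' : ℂ} (hx' : x' ∈ A) :
    mobDist p e α y x' ≤ 2 / δ ^ 2 := by
  have hδ := H.delta_pos
  have hX := (H.re_S_mem hy).1
  have h := norm_S_sub_le hA H hy hx'
  have hx := (R.strip x' hx').1
  have hs := H.small
  have hD := H.D_pos
  have hD1 : D ≤ 1 / 32 := by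
    have : 0 < 1 / δ := by positivity
    nlinarith
  unfold mobDist
  have e1 : 2 / δ ^ 2 = 1 / (δ / 2 * δ) := by field_simp
  rw [e1]
  apply div_le_div₀ zero_le_one _ (by positivity)
  · exact mul_le_mul hX hx hδ.le (by linarith)
  · have : ‖mobS p e α y - x'‖ ≤ 1 := by linarith
    nlinarith [norm_nonneg (mobS p e α y - x')]

lemma norm_T_le (hA : ∀ x ∈ A, ‖x - p‖ ≤ D) (H : Mob δ D p e α) {x : ℂ} (hx : x ∈ A) :
    ‖mobT p e α x‖ ≤ 8 * D := by
  linarith [H.norm_T_le (hA x hx), H.D_pos]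

lemma abs_log_normSq_le (H : Mob δ D p e α) {y : ℂ} (hy : ‖y‖ ≤ 8 * D) :
    |Real.log (‖mobN e α y‖ ^ 2)| ≤ 1 := by
  have h := H.normSq_N_mem hy
  have h1 := abs_log_sub_log_le (a := ‖mobN e α y‖ ^ 2) (b := 1) (m := 9 / 16) (by norm_num)
    h.1 (by norm_num)
  rw [Real.log_one, sub_zero] at h1
  refine h1.trans ?_
  rw [div_le_one (by norm_num), abs_le]
  constructor <;> linarith [h.1, h.2]

lemma measurable_log_normSq_T (p : ℝ) (e α : ℂ) :
    Measurable fun x' => Real.log (‖mobN e α (mobT p e α x')‖ ^ 2) :=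
  (((measurable_mobN e α).comp (measurable_mobT p e α)).norm.pow_const 2).log

lemma measurable_mobDist (p : ℝ) (e α y : ℂ) : Measurable (mobDist p e α y) := by
  unfold mobDist
  exact (((measurable_const.sub measurable_id).norm).pow_const 2).div
    (measurable_const.mul Complex.measurable_re)

lemma integrableOn_log_normSq_T (R : RingData κ W δ ε μ A ψ p) (hA : ∀ x ∈ A, ‖x - p‖ ≤ D)
    (H : Mob δ D p e α) :
    IntegrableOn (fun x' => Real.log (‖mobN e α (mobT p e α x')‖ ^ 2)) A :=
  R.integrableOn_bdd (measurable_log_normSq_T p e α)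
    fun _ hx => abs_log_normSq_le H (norm_T_le hA H hx)

lemma integrableOn_log_re (R : RingData κ W δ ε μ A ψ p) :
    IntegrableOn (fun x : ℂ => Real.log x.re) A := by
  refine R.integrableOn_bdd Complex.measurable_re.log (C := |Real.log δ| + |Real.log (1 / δ)|)
    fun x hx => ?_
  have h := R.strip x hx
  have h1 := Real.log_le_log R.delta_pos h.1
  have h2 := Real.log_le_log (R.re_pos hx) h.2
  rw [abs_le]
  constructor
  · linarith [neg_abs_le (Real.log δ), abs_nonneg (Real.log (1 / δ))]
  · linarith [le_abs_self (Real.log (1 / δ)), abs_nonneg (Real.log δ)]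

lemma integrableOn_profileReg (R : RingData κ W δ ε μ A ψ p) (hA : ∀ x ∈ A, ‖x - p‖ ≤ D)
    (H : Mob δ D p e α) {y : ℂ} (hy : ‖y‖ ≤ 8 * D) :
    IntegrableOn (fun x' => profileReg (mobDist p e α y x')) A := by
  have hδ := H.delta_pos
  refine R.integrableOn_bdd (measurable_profileReg.comp (measurable_mobDist p e α y))
    (C := 20 + 2 * (2 / δ ^ 2) + |profileReg 0|) fun x' hx' => ?_
  rcases (R.mobDist_nonneg H hy hx').eq_or_lt with h | h
  · rw [← h]
    have : 0 < 2 / δ ^ 2 := by positivity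
    linarith
  · have h1 := abs_profileReg_le h
    have h2 := R.mobDist_le hA H hy hx'
    linarith [abs_nonneg (profileReg 0)]

lemma integrableOn_mobKer (R : RingData κ W δ ε μ A ψ p) (hA : ∀ x ∈ A, ‖x - p‖ ≤ D)
    (H : Mob δ D p e α) {y : ℂ} (hy : ‖y‖ ≤ 8 * D) : IntegrableOn (mobKer p e α y) A := by
  unfold mobKer
  exact ((integrableOn_const R.volume_ne_top).add
    ((R.integrableOn_log_normSq_T hA H).add R.integrableOn_log_re)).add
    (R.integrableOn_profileReg hA H hy)

/-- The kernel splits in the Möbius chart into a logarithm and a regular part. -/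
lemma profile_mobDist (R : RingData κ W δ ε μ A ψ p) (hA : ∀ x ∈ A, ‖x - p‖ ≤ D)
    (H : Mob δ D p e α) {y : ℂ} (hy : ‖y‖ ≤ 8 * D) {x' : ℂ} (hx' : x' ∈ A)
    (hne : mobS p e α y ≠ x') :
    profile (mobDist p e α y x') = mobKer p e α y x' + -2 * Real.log ‖y - mobT p e α x'‖
      ∧ -2 * Real.log ‖y - mobT p e α x'‖ = -2 * Real.log ‖mobS p e α y - x'‖
        - Real.log (‖mobN e α y‖ ^ 2) - Real.log (‖mobN e α (mobT p e α x')‖ ^ 2) := by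
  have hT := norm_T_le hA H hx'
  have hX := (H.re_S_mem hy).1
  have hX0 : 0 < (mobS p e α y).re := lt_of_lt_of_le (by linarith [H.delta_pos]) hX
  have hx0 := R.re_pos hx'
  have hn : 0 < ‖mobS p e α y - x'‖ := norm_pos_iff.2 (sub_ne_zero.2 hne)
  have hS := H.norm_S_sub_S (p := p) hy hT
  rw [H.S_T (hA x' hx')] at hS
  have hN1 : 0 < ‖mobN e α y‖ := norm_pos_iff.2 (H.N_ne_zero hy)
  have hN2 : 0 < ‖mobN e α (mobT p e α x')‖ := norm_pos_iff.2 (H.N_ne_zero hT)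
  have hm : ‖y - mobT p e α x'‖
      = ‖mobS p e α y - x'‖ * (‖mobN e α y‖ * ‖mobN e α (mobT p e α x')‖) := by
    rw [hS, div_mul_cancel₀ _ (by positivity)]
  have h2 : -2 * Real.log ‖y - mobT p e α x'‖ = -2 * Real.log ‖mobS p e α y - x'‖
        - Real.log (‖mobN e α y‖ ^ 2) - Real.log (‖mobN e α (mobT p e α x')‖ ^ 2) := by
    rw [hm, Real.log_mul hn.ne' (by positivity), Real.log_mul hN1.ne' hN2.ne', Real.log_pow,
      Real.log_pow]
    push_cast
    ring
  refine ⟨?_, h2⟩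
  have hτ : 0 < mobDist p e α y x' := by
    unfold mobDist
    positivity
  have hl : Real.log (mobDist p e α y x') = 2 * Real.log ‖mobS p e α y - x'‖
      - Real.log (mobS p e α y).re - Real.log x'.re := by
    unfold mobDist
    rw [Real.log_div (by positivity) (by positivity), Real.log_pow,
      Real.log_mul hX0.ne' hx0.ne']
    push_cast
    ring
  rw [profile_eq hτ, hl, h2, mobKer]
  ring

lemma mobPot_eq (R : RingData κ W δ ε μ A ψ p) (hA : ∀ x ∈ A, ‖x - p‖ ≤ D)
    (H : Mob δ D p e α) {y : ℂ} (hy : ‖y‖ ≤ 8 * D) :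
    mobPot W ε μ A ψ p e α y = (∫ x' in A, dens x' * mobKer p e α y x')
      - 4 * π * ε ^ 2 * (μ * (√(mobS p e α y).re)⁻¹
        + W / 2 * Real.log (1 / ε) * ((mobS p e α y).re * √(mobS p e α y).re)) := by
  have hX := (H.re_S_mem hy).1
  have hX0 : 0 < (mobS p e α y).re := lt_of_lt_of_le (by linarith [H.delta_pos]) hX
  have hs := Real.sqrt_pos.2 hX0
  have hε := R.eps_pos
  have hne : ∀ᵐ x' : ℂ, x' ≠ mobS p e α y := by
    simp [ae_iff, measure_singleton]
  have hi1 : IntegrableOn (fun x' => dens x' * mobKer p e α y x') A :=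
    R.integrableOn_dens_mul (R.integrableOn_mobKer hA H hy)
  have hi2 : IntegrableOn (fun x' => dens x' * (-2 * Real.log ‖y - mobT p e α x'‖)) A := by
    refine R.integrableOn_dens_mul ?_
    have h3 : IntegrableOn (fun x' => -2 * Real.log ‖mobS p e α y - x'‖
        - Real.log (‖mobN e α y‖ ^ 2) - Real.log (‖mobN e α (mobT p e α x')‖ ^ 2)) A :=
      (((integrableOn_log_norm_sub R.measurableSet R.isBounded _).const_mul _).sub
        (integrableOn_const R.volume_ne_top)).sub (R.integrableOn_log_normSq_T hA H)
    refine h3.congr ?_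
    filter_upwards [ae_restrict_mem R.measurableSet, ae_restrict_of_ae hne] with x' h1 h2
    exact (R.profile_mobDist hA H hy h1 h2.symm).2.symm
  have h1 : 4 * π * ε ^ 2 / √(mobS p e α y).re * ψ (mobS p e α y)
      = ∫ x' in A, dens x' * profile (mobDist p e α y x') := by
    rw [R.repr _ hX0]
    have : ∫ x' in A, greenC (mobS p e α y) x' = ∫ x' in A, √(mobS p e α y).re / (4 * π)
        * (dens x' * profile (mobDist p e α y x')) := by
      refine setIntegral_congr_fun R.measurableSet fun x' hx' => ?_
      rw [greenC_eq hX0 (R.re_pos hx'), mobDist, dens]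
      ring
    rw [this, integral_const_mul]
    field_simp
  have h2 : ∫ x' in A, dens x' * profile (mobDist p e α y x')
      = (∫ x' in A, dens x' * mobKer p e α y x')
        + ∫ x' in A, dens x' * (-2 * Real.log ‖y - mobT p e α x'‖) := by
    rw [← integral_add hi1 hi2]
    refine integral_congr_ae ?_
    filter_upwards [ae_restrict_mem R.measurableSet, ae_restrict_of_ae hne] with x' h1 h2
    rw [(R.profile_mobDist hA H hy h1 h2.symm).1]
    ring
  have h3 : logPot (mobT p e α '' A) (mobDens p e α) y
      = ∫ x' in A, dens x' * (-2 * Real.log ‖y - mobT p e α x'‖) :=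
    H.integral_dens_mul hA R.isOpen (fun y' => -2 * Real.log ‖y - y'‖)
  rw [mobPot, mul_sub, h1, h2, h3]
  have h4 : 4 * π * ε ^ 2 / √(mobS p e α y).re
      * (μ + W / 2 * (mobS p e α y).re ^ 2 * Real.log (1 / ε))
      = 4 * π * ε ^ 2 * (μ * (√(mobS p e α y).re)⁻¹
        + W / 2 * Real.log (1 / ε) * ((mobS p e α y).re * √(mobS p e α y).re)) := by
    have e1 := Real.sq_sqrt hX0.le
    have e2 : (mobS p e α y).re ^ 2 * (√(mobS p e α y).re)⁻¹
        = (mobS p e α y).re * √(mobS p e α y).re := by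
      field_simp
      linear_combination -e1
    rw [← e2]
    ring
  rw [h4]
  ring

end RingData

end VortexRing

namespace VortexRing

namespace RingData

variable {κ W δ ε μ : ℝ} {A : Set ℂ} {ψ : ℂ → ℝ} {p : ℝ} {D : ℝ} {e α : ℂ}

lemma eps_le_one (R : RingData κ W δ ε μ A ψ p) : ε ≤ 1 := by
  have h := R.one_le_log
  by_contra hc
  push Not at hc
  rw [one_div, Real.log_inv] at h
  linarith [Real.log_pos hc]

lemma D_le (H : Mob δ D p e α) : D ≤ 1 / 32 := by
  have hs := H.small
  have : 0 < 1 / δ := by have := H.delta_pos; positivity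
  nlinarith [H.D_pos]

lemma abs_mobDist_sub_le (R : RingData κ W δ ε μ A ψ p) (hA : ∀ x ∈ A, ‖x - p‖ ≤ D)
    (H : Mob δ D p e α) {y₁ y₂ : ℂ} (h1 : ‖y₁‖ ≤ 8 * D) (h2 : ‖y₂‖ ≤ 8 * D) {x' : ℂ}
    (hx' : x' ∈ A) : |mobDist p e α y₁ x' - mobDist p e α y₂ x'|
      ≤ (96 / δ ^ 2 + 36 / δ ^ 3) * D * ‖y₂ - y₁‖ := by
  have hδ := H.delta_pos
  have hD := H.D_pos
  have hD2 := D_le H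
  have hX1 := (H.re_S_mem h1).1
  have hX2 := (H.re_S_mem h2).1
  have hX' := (R.strip x' hx').1
  have n1 := norm_S_sub_le hA H h1 hx'
  have n2 := norm_S_sub_le hA H h2 hx'
  have hd := H.abs_re_S_sub_re_S (p := p) h1 h2
  have hn : |‖mobS p e α y₁ - x'‖ - ‖mobS p e α y₂ - x'‖| ≤ 2 * ‖y₂ - y₁‖ := by
    refine (abs_norm_sub_norm_le _ _).trans ?_
    rw [sub_sub_sub_cancel_right, ← norm_sub_rev]
    exact H.norm_S_sub_S_le h2 h1
  unfold mobDist
  set X₁ := (mobS p e α y₁).re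
  set X₂ := (mobS p e α y₂).re
  set a := ‖mobS p e α y₁ - x'‖ with ha
  set b := ‖mobS p e α y₂ - x'‖ with hb
  set t := ‖y₂ - y₁‖ with ht
  have ha0 : 0 ≤ a := norm_nonneg _
  have hb0 : 0 ≤ b := norm_nonneg _
  have ht0 : 0 ≤ t := norm_nonneg _
  have p1 : 0 < X₁ := by linarith
  have p2 : 0 < X₂ := by linarith
  have p3 : 0 < x'.re := by linarith
  have e1 : a ^ 2 / (X₁ * x'.re) - b ^ 2 / (X₂ * x'.re)
      = (a + b) * (a - b) / (X₁ * x'.re) + b ^ 2 * (X₂ - X₁) / (X₁ * X₂ * x'.re) := by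
    field_simp
    ring
  rw [e1]
  refine (abs_add_le _ _).trans ?_
  have c1 : |(a + b) * (a - b) / (X₁ * x'.re)| ≤ 48 * D * t / (δ / 2 * δ) := by
    rw [abs_div, abs_of_pos (mul_pos p1 p3), abs_mul, abs_of_nonneg (add_nonneg ha0 hb0)]
    apply div_le_div₀ (by positivity) _ (by positivity)
    · exact mul_le_mul hX1 hX' hδ.le p1.le
    · calc (a + b) * |a - b| ≤ (24 * D) * (2 * t) :=
          mul_le_mul (by linarith) hn (abs_nonneg _) (by linarith)
        _ = 48 * D * t := by ring
  have c2 : |b ^ 2 * (X₂ - X₁) / (X₁ * X₂ * x'.re)| ≤ 9 * D * t / (δ / 2 * (δ / 2) * δ) := by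
    rw [abs_div, abs_of_pos (mul_pos (mul_pos p1 p2) p3), abs_mul, abs_of_nonneg (sq_nonneg b)]
    apply div_le_div₀ (by positivity) _ (by positivity)
    · exact mul_le_mul (mul_le_mul hX1 hX2 (by linarith) p1.le) hX' hδ.le (by positivity)
    · have : b ^ 2 ≤ 9 / 2 * D := by nlinarith
      calc b ^ 2 * |X₂ - X₁| ≤ (9 / 2 * D) * (2 * t) :=
          mul_le_mul this hd (abs_nonneg _) (by linarith)
        _ = 9 * D * t := by ring
  have e2 : 48 * D * t / (δ / 2 * δ) = 96 / δ ^ 2 * D * t := by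
    field_simp
    ring
  have e3 : 9 * D * t / (δ / 2 * (δ / 2) * δ) = 36 / δ ^ 3 * D * t := by
    field_simp
    ring
  linarith

lemma abs_profileReg_mobDist_sub_le (R : RingData κ W δ ε μ A ψ p) (hA : ∀ x ∈ A, ‖x - p‖ ≤ D)
    (H : Mob δ D p e α) {y₁ y₂ : ℂ} (h1 : ‖y₁‖ ≤ 8 * D) (h2 : ‖y₂‖ ≤ 8 * D) {x' : ℂ}
    (hx' : x' ∈ A) (hne1 : x' ≠ mobS p e α y₁) (hne2 : x' ≠ mobS p e α y₂) :
    |profileReg (mobDist p e α y₁ x') - profileReg (mobDist p e α y₂ x')|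
      ≤ (96 / δ ^ 2 + 36 / δ ^ 3) * D * ‖y₂ - y₁‖
        * (8 / δ * ε * ‖mobS p e α y₁ - x'‖⁻¹ + 13 * Real.log (1 / ε)) := by
  have hδ := H.delta_pos
  have hD := H.D_pos
  have hε := R.eps_pos
  have hL := R.one_le_log
  have hX1 := H.re_S_mem (p := p) h1
  have hX2 := (H.re_S_mem (p := p) h2).1
  have hX' := R.strip x' hx'
  have n1 : 0 < ‖mobS p e α y₁ - x'‖ := norm_pos_iff.2 (sub_ne_zero.2 hne1.symm)
  have n2 : 0 < ‖mobS p e α y₂ - x'‖ := norm_pos_iff.2 (sub_ne_zero.2 hne2.symm)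
  have p1 : 0 < (mobS p e α y₁).re := by linarith [hX1.1]
  have p2 : 0 < (mobS p e α y₂).re := by linarith
  have p3 : 0 < x'.re := by linarith [hX'.1]
  have t1 : 0 < mobDist p e α y₁ x' := by unfold mobDist; positivity
  have t2 : 0 < mobDist p e α y₂ x' := by unfold mobDist; positivity
  have hE := abs_profileReg_sub_le t1 t2 hε R.eps_le_one
  have hd := R.abs_mobDist_sub_le hA H h1 h2 hx'
  have hs : 2 * ε / √(mobDist p e α y₁ x') ≤ 8 / δ * ε * ‖mobS p e α y₁ - x'‖⁻¹ := by
    have q : ‖mobS p e α y₁ - x'‖ * (δ / 2) ≤ √(mobDist p e α y₁ x') := by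
      apply Real.le_sqrt_of_sq_le
      unfold mobDist
      rw [le_div_iff₀ (by positivity), mul_pow]
      have q2 : (mobS p e α y₁).re * x'.re ≤ 2 / δ * (1 / δ) :=
        mul_le_mul hX1.2 hX'.2 p3.le (by positivity)
      have q3 : (δ / 2) ^ 2 * ((mobS p e α y₁).re * x'.re) ≤ 1 := by
        calc (δ / 2) ^ 2 * ((mobS p e α y₁).re * x'.re) ≤ (δ / 2) ^ 2 * (2 / δ * (1 / δ)) := by
              gcongr
          _ = 1 / 2 := by field_simp
          _ ≤ 1 := by norm_num
      nlinarith [sq_nonneg ‖mobS p e α y₁ - x'‖]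
    calc 2 * ε / √(mobDist p e α y₁ x') ≤ 2 * ε / (‖mobS p e α y₁ - x'‖ * (δ / 2)) := by gcongr
      _ = 4 / δ * ε * ‖mobS p e α y₁ - x'‖⁻¹ := by field_simp; norm_num
      _ ≤ _ := by gcongr; norm_num
  refine hE.trans ?_
  have hnn : 0 ≤ 2 * ε / √(mobDist p e α y₁ x') := by positivity
  exact mul_le_mul hd (by linarith) (by linarith) (by positivity)

lemma abs_integral_profileReg_sub_le (R : RingData κ W δ ε μ A ψ p)
    (hA : ∀ x ∈ A, ‖x - p‖ ≤ D) (H : Mob δ D p e α) {y₁ y₂ : ℂ} (h1 : ‖y₁‖ ≤ 8 * D)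
    (h2 : ‖y₂‖ ≤ 8 * D) :
    |∫ x' in A, dens x' * (profileReg (mobDist p e α y₁ x') - profileReg (mobDist p e α y₂ x'))|
      ≤ 1 / δ * √(1 / δ) * ((96 / δ ^ 2 + 36 / δ ^ 3) * (64 / δ * √(κ / δ) + 13 * (κ / δ)))
        * (D * Real.log (1 / ε) * ε ^ 2) * ‖y₂ - y₁‖ := by
  have hδ := H.delta_pos
  have hD := H.D_pos
  have hε := R.eps_pos
  have hκ := R.kappa_pos
  have hL := R.one_le_log
  set L := Real.log (1 / ε) with hLdef
  set c := 1 / δ * √(1 / δ) with hc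
  set c₂ := 96 / δ ^ 2 + 36 / δ ^ 3 with hc2
  have hc0 : 0 ≤ c := by positivity
  have hc20 : 0 ≤ c₂ := by positivity
  have hI := integrableOn_inv_norm_sub R.volume_ne_top (mobS p e α y₁)
  have hfi : IntegrableOn (fun x' => c * (c₂ * D * ‖y₂ - y₁‖
        * (8 / δ * ε * ‖mobS p e α y₁ - x'‖⁻¹ + 13 * L))) A :=
    (((hI.1.const_mul _).add (integrableOn_const R.volume_ne_top)).const_mul _).const_mul _
  have hne : ∀ z : ℂ, ∀ᵐ x' : ℂ, x' ≠ z := fun z => by simp [ae_iff, measure_singleton]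
  have hb := norm_integral_le_of_norm_le hfi
    (f := fun x' => dens x' *
      (profileReg (mobDist p e α y₁ x') - profileReg (mobDist p e α y₂ x'))) (by
      filter_upwards [ae_restrict_mem R.measurableSet, ae_restrict_of_ae (hne (mobS p e α y₁)),
        ae_restrict_of_ae (hne (mobS p e α y₂))] with x' hx' g1 g2
      rw [norm_mul, Real.norm_eq_abs, Real.norm_eq_abs, abs_of_pos (R.dens_pos hx')]
      exact mul_le_mul (R.dens_le hx') (R.abs_profileReg_mobDist_sub_le hA H h1 h2 hx' g1 g2)
        (abs_nonneg _) hc0)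
  rw [Real.norm_eq_abs] at hb
  refine hb.trans ?_
  rw [integral_const_mul, integral_const_mul, integral_add (hI.1.const_mul _)
    (integrableOn_const R.volume_ne_top), integral_const_mul, setIntegral_const, smul_eq_mul]
  have i1 := (integral_inv_norm_sub_le R.volume_ne_top (mobS p e α y₁)).trans
    (mul_le_mul_of_nonneg_left R.sqrt_volume_le (by norm_num : (0 : ℝ) ≤ 8))
  have i2 := R.volume_le
  have hb2 : 8 / δ * ε * (∫ x' in A, ‖mobS p e α y₁ - x'‖⁻¹) + volume.real A * (13 * L)
      ≤ (64 / δ * √(κ / δ) + 13 * (κ / δ)) * (L * ε ^ 2) := by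
    have j1 : 8 / δ * ε * (∫ x' in A, ‖mobS p e α y₁ - x'‖⁻¹)
        ≤ 8 / δ * ε * (8 * (√(κ / δ) * ε)) := by gcongr
    have j2 : volume.real A * (13 * L) ≤ κ / δ * ε ^ 2 * (13 * L) := by gcongr
    have j3 : 64 / δ * √(κ / δ) * ε ^ 2 * 1 ≤ 64 / δ * √(κ / δ) * ε ^ 2 * L := by gcongr
    have j4 : 8 / δ * ε * (8 * (√(κ / δ) * ε)) = 64 / δ * √(κ / δ) * ε ^ 2 * 1 := by ring
    linarith
  calc _ ≤ c * (c₂ * D * ‖y₂ - y₁‖ * ((64 / δ * √(κ / δ) + 13 * (κ / δ)) * (L * ε ^ 2))) := by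
        gcongr
    _ = _ := by ring

end RingData

/-- The leading coefficient of the slope of the external potential. -/
def slopeCoeff (W ε μ : ℝ) (A : Set ℂ) (p : ℝ) : ℝ :=
  (∫ x in A, dens x) * (2 * (3 / (8 * p)) + p⁻¹)
    - 4 * π * ε ^ 2 * (μ * deriv (fun x : ℝ => (√x)⁻¹) p
      + W / 2 * Real.log (1 / ε) * deriv (fun x : ℝ => x * √x) p)

/-- Admissible tilts of the Möbius chart. -/
structure Tilt (C D p : ℝ) (e α : ℂ) : Prop where
  norm_e : ‖e‖ = 1
  norm_le : ‖α - (3 / (8 * p) : ℝ)‖ ≤ 2 * C * D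
  le_re : C * D ≤ ((α - (3 / (8 * p) : ℝ)) * e).re

lemma exists_slope_expansion (κ W δ C₁ : ℝ) (hκ : 0 < κ) (hW : 0 < W) (hδ : 0 < δ)
    (hC₁ : 0 ≤ C₁) :
    ∃ C > 0, ∀ ε μ A ψ p D e α, RingData κ W δ ε μ A ψ p → (∀ x ∈ A, ‖x - p‖ ≤ D) →
      Mob δ D p e α → Tilt C₁ D p e α → ∀ y₁ y₂ : ℂ, ‖y₁‖ ≤ 8 * D → ‖y₂‖ ≤ 8 * D →
      y₁.im = y₂.im → y₁.re ≤ y₂.re →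
      |mobPot W ε μ A ψ p e α y₂ - mobPot W ε μ A ψ p e α y₁
        - (y₂.re - y₁.re) * (slopeCoeff W ε μ A p * e.re)|
        ≤ C * (D * Real.log (1 / ε) * ε ^ 2) * (y₂.re - y₁.re) := by
  obtain ⟨Cl, hCl, hl⟩ := exists_expansion_re contDiffOn_log hδ
  obtain ⟨Ci, hCi, hi⟩ := exists_expansion_re contDiffOn_inv_sqrt hδ
  obtain ⟨Cm, hCm, hm⟩ := exists_expansion_re contDiffOn_mul_sqrt hδ
  obtain ⟨Cn, hCn, hn⟩ := exists_expansion_log_normSq hδ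
  obtain ⟨Cμ, hCμ, hψ⟩ := exists_stream_le κ W δ
  set c := 1 / δ * √(1 / δ) with hc
  set CE := c * ((96 / δ ^ 2 + 36 / δ ^ 3) * (64 / δ * √(κ / δ) + 13 * (κ / δ))) with hCE
  have hc0 : 0 < c := by positivity
  have hCE0 : 0 ≤ CE := by positivity
  refine ⟨c * (κ / δ) * (Cn + 4 * C₁ + Cl) + CE + 4 * π * (Cμ * Ci + W / 2 * Cm) + 1,
    by positivity, ?_⟩
  intro ε μ A ψ p D e α R hA H hT y₁ y₂ h1 h2 him hre
  have a1 := hl D p e α H y₁ y₂ h1 h2 him hre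
  have a2 := hi D p e α H y₁ y₂ h1 h2 him hre
  have a3 := hm D p e α H y₁ y₂ h1 h2 him hre
  have a4 := hn D p e α H y₁ y₂ h1 h2 him hre
  have hE := R.abs_integral_profileReg_sub_le hA H h2 h1
  rw [norm_sub_rev, (Mob.norm_sub_of_im_eq him hre).2] at hE
  rw [R.mobPot_eq hA H h1, R.mobPot_eq hA H h2]
  have hL := R.one_le_log
  have hD := H.D_pos
  have hε := R.eps_pos
  have hμ0 := R.mu_pos
  have hp : 0 < p := hδ.trans_le H.le_p
  have hμ : μ ≤ Cμ * Real.log (1 / ε) := by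
    have g1 := hψ ε μ A ψ p R p R.mem
    have g2 := (R.level p (by simpa using hp)).1 R.mem
    have : 0 ≤ W / 2 * (p : ℂ).re ^ 2 * Real.log (1 / ε) := by positivity
    linarith
  have hker : (∫ x' in A, dens x' * mobKer p e α y₂ x') - ∫ x' in A, dens x' * mobKer p e α y₁ x'
      = (∫ x in A, dens x) * ((Real.log (‖mobN e α y₂‖ ^ 2) - Real.log (‖mobN e α y₁‖ ^ 2))
          + (Real.log (mobS p e α y₂).re - Real.log (mobS p e α y₁).re))
        + ∫ x' in A, dens x' *
          (profileReg (mobDist p e α y₂ x') - profileReg (mobDist p e α y₁ x')) := by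
    have i1 : IntegrableOn (fun x' => dens x' *
        (profileReg (mobDist p e α y₂ x') - profileReg (mobDist p e α y₁ x'))) A :=
      R.integrableOn_dens_mul
        ((R.integrableOn_profileReg hA H h2).sub (R.integrableOn_profileReg hA H h1))
    rw [← integral_sub (R.integrableOn_dens_mul (R.integrableOn_mobKer hA H h2))
      (R.integrableOn_dens_mul (R.integrableOn_mobKer hA H h1)), ← integral_mul_const,
      ← integral_add (R.integrableOn_dens.mul_const _) i1]
    congr 1
    ext x'
    unfold mobKer
    ring
  have hM0 := R.mass_pos
  have hM := R.mass_le
  rw [← hc] at hM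
  unfold slopeCoeff
  set M := ∫ x in A, dens x
  set t := y₂.re - y₁.re with ht
  have ht0 : 0 ≤ t := by linarith
  set L := Real.log (1 / ε) with hLdef
  set I := ∫ x' in A, dens x' *
          (profileReg (mobDist p e α y₂ x') - profileReg (mobDist p e α y₁ x'))
  set X₁ := (mobS p e α y₁).re
  set X₂ := (mobS p e α y₂).re
  set d₁ := deriv (fun x : ℝ => (√x)⁻¹) p
  set d₂ := deriv (fun x : ℝ => x * √x) p
  rw [Real.deriv_log] at a1
  have hα : |((α - (3 / (8 * p) : ℝ)) * e).re| ≤ 2 * C₁ * D := by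
    refine (Complex.abs_re_le_norm _).trans ?_
    rw [norm_mul, H.norm_e, mul_one]
    exact hT.norm_le
  have hαe : (α * e).re = 3 / (8 * p) * e.re + ((α - (3 / (8 * p) : ℝ)) * e).re := by
    rw [sub_mul, Complex.sub_re, Complex.re_ofReal_mul]
    ring
  set β := ((α - (3 / (8 * p) : ℝ)) * e).re
  rw [hαe] at a4
  set P := Real.log (‖mobN e α y₂‖ ^ 2) - Real.log (‖mobN e α y₁‖ ^ 2)
  set Q := Real.log X₂ - Real.log X₁
  have hid : (∫ x' in A, dens x' * mobKer p e α y₂ x')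
        - 4 * π * ε ^ 2 * (μ * (√X₂)⁻¹ + W / 2 * L * (X₂ * √X₂))
      - ((∫ x' in A, dens x' * mobKer p e α y₁ x')
        - 4 * π * ε ^ 2 * (μ * (√X₁)⁻¹ + W / 2 * L * (X₁ * √X₁)))
      - t * ((M * (2 * (3 / (8 * p)) + p⁻¹) - 4 * π * ε ^ 2 * (μ * d₁ + W / 2 * L * d₂)) * e.re)
      = M * ((P - t * (2 * (3 / (8 * p) * e.re + β))) + 2 * t * β + (Q - t * (p⁻¹ * e.re))) + I
        - 4 * π * ε ^ 2 * (μ * ((√X₂)⁻¹ - (√X₁)⁻¹ - t * (d₁ * e.re))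
          + W / 2 * L * (X₂ * √X₂ - X₁ * √X₁ - t * (d₂ * e.re))) := by
    linear_combination hker
  rw [hid]
  have b1 : |(P - t * (2 * (3 / (8 * p) * e.re + β))) + 2 * t * β + (Q - t * (p⁻¹ * e.re))|
      ≤ (Cn + 4 * C₁ + Cl) * D * t := by
    refine (abs_add_three _ _ _).trans ?_
    rw [abs_mul (2 * t), abs_of_nonneg (by positivity : 0 ≤ 2 * t)]
    have := mul_le_mul_of_nonneg_left hα (by positivity : 0 ≤ 2 * t)
    linarith
  have b2 : |M * ((P - t * (2 * (3 / (8 * p) * e.re + β))) + 2 * t * β + (Q - t * (p⁻¹ * e.re)))|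
      ≤ c * (κ / δ) * (Cn + 4 * C₁ + Cl) * (D * L * ε ^ 2) * t := by
    rw [abs_mul, abs_of_pos hM0]
    calc _ ≤ (c * (κ / δ * ε ^ 2)) * ((Cn + 4 * C₁ + Cl) * D * t) :=
          mul_le_mul hM b1 (abs_nonneg _) (by positivity)
      _ = c * (κ / δ) * (Cn + 4 * C₁ + Cl) * (D * 1 * ε ^ 2) * t := by ring
      _ ≤ _ := by gcongr
  have b3 : |μ * ((√X₂)⁻¹ - (√X₁)⁻¹ - t * (d₁ * e.re))
          + W / 2 * L * (X₂ * √X₂ - X₁ * √X₁ - t * (d₂ * e.re))|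
      ≤ (Cμ * Ci + W / 2 * Cm) * L * D * t := by
    refine (abs_add_le _ _).trans ?_
    rw [abs_mul μ, abs_mul (W / 2 * L), abs_of_pos hμ0,
      abs_of_nonneg (by positivity : 0 ≤ W / 2 * L)]
    have g1 := mul_le_mul hμ a2 (abs_nonneg _) (by positivity)
    have g2 := mul_le_mul_of_nonneg_left a3 (by positivity : 0 ≤ W / 2 * L)
    linarith
  have b4 : |4 * π * ε ^ 2 * (μ * ((√X₂)⁻¹ - (√X₁)⁻¹ - t * (d₁ * e.re))
          + W / 2 * L * (X₂ * √X₂ - X₁ * √X₁ - t * (d₂ * e.re)))|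
      ≤ 4 * π * (Cμ * Ci + W / 2 * Cm) * (D * L * ε ^ 2) * t := by
    rw [abs_mul, abs_of_nonneg (by positivity : 0 ≤ 4 * π * ε ^ 2)]
    calc _ ≤ 4 * π * ε ^ 2 * ((Cμ * Ci + W / 2 * Cm) * L * D * t) := by gcongr
      _ = _ := by ring
  refine (abs_sub _ _).trans ?_
  refine (add_le_add ((abs_add_le _ _).trans (add_le_add b2 hE)) b4).trans ?_
  have : 0 ≤ D * L * ε ^ 2 * t := by positivity
  linarith

end VortexRing

namespace VortexRing

lemma Tilt.mob {C D p δ : ℝ} {e α : ℂ} (T : Tilt C D p e α) (hδ : 0 < δ) (h1 : δ ≤ p)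
    (h2 : p ≤ 1 / δ) (hD : 0 < D) (hs : D * (1 / δ + 1) ≤ 1 / 32) (hC : C * D ≤ 1 / 4) :
    Mob δ D p e α where
  delta_pos := hδ
  le_p := h1
  p_le := h2
  norm_e := T.norm_e
  norm_α := by
    have hp : 0 < p := hδ.trans_le h1
    have e1 : α = (3 / (8 * p) : ℝ) + (α - (3 / (8 * p) : ℝ)) := by ring
    rw [e1]
    refine (norm_add_le _ _).trans ?_
    rw [Complex.norm_real, Real.norm_eq_abs, abs_of_pos (by positivity)]
    have a1 : 3 / (8 * p) ≤ 1 / δ := by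
      rw [div_le_div_iff₀ (by positivity) hδ]
      linarith
    linarith [T.norm_le]
  D_pos := hD
  small := hs

/-- The basic tilts in the horizontal direction. -/
lemma tilt_real {C D p : ℝ} (hC : 0 ≤ C) (hD : 0 ≤ D) {σ : ℝ} (hσ : σ = 1 ∨ σ = -1) :
    Tilt C D p (σ : ℂ) ((3 / (8 * p) + σ * (C * D) : ℝ) : ℂ) where
  norm_e := by
    rw [Complex.norm_real, Real.norm_eq_abs]
    rcases hσ with h | h <;> simp [h]
  norm_le := by
    rw [← Complex.ofReal_sub, Complex.norm_real, Real.norm_eq_abs, add_sub_cancel_left, abs_mul,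
      abs_of_nonneg (mul_nonneg hC hD)]
    have : |σ| = 1 := by rcases hσ with h | h <;> simp [h]
    rw [this]
    nlinarith [mul_nonneg hC hD]
  le_re := by
    rw [← Complex.ofReal_sub, ← Complex.ofReal_mul, Complex.ofReal_re, add_sub_cancel_left]
    have : σ * (C * D) * σ = C * D := by rcases hσ with h | h <;> rw [h] <;> ring
    rw [this]

lemma Mob.integral_mobDens {δ D p : ℝ} {e α : ℂ} {A : Set ℂ} (H : Mob δ D p e α)
    (hA : ∀ x ∈ A, ‖x - p‖ ≤ D) (hO : IsOpen A) :
    ∫ y in mobT p e α '' A, mobDens p e α y = ∫ x in A, dens x := by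
  simpa using H.integral_dens_mul hA hO (fun _ => 1)

namespace RingData

variable {κ W δ ε μ : ℝ} {A : Set ℂ} {ψ : ℂ → ℝ} {p : ℝ} {D : ℝ} {e α : ℂ}

lemma p_mem (R : RingData κ W δ ε μ A ψ p) : δ ≤ p ∧ p ≤ 1 / δ := by
  simpa using R.strip p R.mem

lemma logPot_add_mobPot (y : ℂ) :
    logPot (mobT p e α '' A) (mobDens p e α) y + mobPot W ε μ A ψ p e α y
      = 4 * π * ε ^ 2 / √(mobS p e α y).re * (ψ (mobS p e α y)
        - (μ + W / 2 * (mobS p e α y).re ^ 2 * Real.log (1 / ε))) := by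
  unfold mobPot
  ring

lemma planeData (R : RingData κ W δ ε μ A ψ p) (hA : ∀ x ∈ A, ‖x - p‖ ≤ D)
    (H : Mob δ D p e α) {η : ℝ}
    (hanti : ∀ y₁ y₂ : ℂ, ‖y₁‖ ≤ 8 * D → ‖y₂‖ ≤ 8 * D → y₁.im = y₂.im → y₁.re ≤ y₂.re →
      mobDens p e α y₂ ≤ mobDens p e α y₁)
    (hslope : ∀ y₁ y₂ : ℂ, ‖y₁‖ ≤ 8 * D → ‖y₂‖ ≤ 8 * D → y₁.im = y₂.im → y₁.re ≤ y₂.re →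
      mobPot W ε μ A ψ p e α y₂ - mobPot W ε μ A ψ p e α y₁ ≤ η * (y₂.re - y₁.re)) :
    PlaneData (mobT p e α '' A) (mobDens p e α) (mobPot W ε μ A ψ p e α) (2 * D)
      (4 * (2 / δ * √(2 / δ))) η where
  pos := by linarith [H.D_pos]
  isOpen := H.isOpen_image hA R.isOpen
  sub := fun y hy => by simpa using H.norm_le_of_mem_image hA hy
  meas := measurable_mobDens p e α
  nonneg := fun y hy => (H.mobDens_pos (by linarith)).le
  le := fun y hy => H.mobDens_le (by linarith)
  anti := fun y₁ y₂ h1 h2 => hanti y₁ y₂ (by linarith) (by linarith)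
  level := fun y hy => by
    have hy' : ‖y‖ ≤ 8 * D := by linarith
    have hX0 : 0 < (mobS p e α y).re :=
      lt_of_lt_of_le (by linarith [H.delta_pos]) (H.re_S_mem hy').1
    have hs := Real.sqrt_pos.2 hX0
    have hε := R.eps_pos
    rw [H.mem_image_iff hA hy', R.level _ hX0, logPot_add_mobPot, mul_pos_iff_of_pos_left
      (by positivity), sub_pos]
  slope := fun y₁ y₂ h1 h2 => hslope y₁ y₂ (by linarith) (by linarith)

end RingData

/-- The method of moving planes applies to the tilted Möbius charts. -/
theorem exists_planeData (κ W δ : ℝ) (hκ : 0 < κ) (hW : 0 < W) (hδ : 0 < δ) :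
    ∃ C₁ > 0, ∃ C > 0, ∃ d > 0, ∀ ε μ A ψ p D, RingData κ W δ ε μ A ψ p →
      (∀ x ∈ A, ‖x - p‖ ≤ D) → 0 < D → D ≤ d →
      D * (1 / δ + 1) ≤ 1 / 32 ∧ C₁ * D ≤ 1 / 4 ∧ ∀ e α, Tilt C₁ D p e α →
        PlaneData (mobT p e α '' A) (mobDens p e α) (mobPot W ε μ A ψ p e α) (2 * D)
          (4 * (2 / δ * √(2 / δ))) (C * (D * Real.log (1 / ε) * ε ^ 2)) := by
  obtain ⟨C₁, hC₁, hanti⟩ := exists_mobDens_antitone hδ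
  obtain ⟨C, hC, hexp⟩ := exists_slope_expansion κ W δ C₁ hκ hW hδ hC₁.le
  refine ⟨C₁, hC₁, 2 * C, by positivity, min (1 / (32 * (1 / δ + 1))) (1 / (4 * C₁)),
    by positivity, ?_⟩
  intro ε μ A ψ p D R hA hD hd
  have hd1 : D * (1 / δ + 1) ≤ 1 / 32 := by
    have := hd.trans (min_le_left _ _)
    rw [le_div_iff₀ (by positivity)] at this
    linarith
  have hd2 : C₁ * D ≤ 1 / 4 := by
    have := hd.trans (min_le_right _ _)
    rw [le_div_iff₀ (by positivity)] at this
    linarith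
  refine ⟨hd1, hd2, ?_⟩
  set B := slopeCoeff W ε μ A p
  set η := C * (D * Real.log (1 / ε) * ε ^ 2) with hη
  have hmob : ∀ e α, Tilt C₁ D p e α → Mob δ D p e α := fun e α T =>
    T.mob hδ R.p_mem.1 R.p_mem.2 hD hd1 hd2
  have main : ∀ e α, Tilt C₁ D p e α →
      PlaneData (mobT p e α '' A) (mobDens p e α) (mobPot W ε μ A ψ p e α) (2 * D)
        (4 * (2 / δ * √(2 / δ))) (B * e.re + η) := fun e α T => by
    refine R.planeData hA (hmob e α T) (hanti D p e α (hmob e α T) T.le_re) ?_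
    intro y₁ y₂ h1 h2 him hre
    have := (abs_le.1 (hexp ε μ A ψ p D e α R hA (hmob e α T) T y₁ y₂ h1 h2 him hre)).2
    linarith
  have hB : ∀ σ : ℝ, σ = 1 ∨ σ = -1 → 0 ≤ B * σ + η := fun σ hσ => by
    have T := tilt_real (p := p) hC₁.le hD.le hσ
    have := (main _ _ T).slope_nonneg (by
      rw [(hmob _ _ T).integral_mobDens hA R.isOpen]
      exact R.mass_pos)
    simpa using this
  have hB1 := hB 1 (Or.inl rfl)
  have hB2 := hB (-1) (Or.inr rfl)
  intro e α T
  refine R.planeData hA (hmob e α T) (hanti D p e α (hmob e α T) T.le_re) ?_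
  intro y₁ y₂ h1 h2 him hre
  have h := (main e α T).slope y₁ y₂ (by linarith) (by linarith) him hre
  have he := abs_le.1 ((Complex.abs_re_le_norm e).trans T.norm_e.le)
  have : B * e.re ≤ η := by nlinarith
  have ht : 0 ≤ y₂.re - y₁.re := by linarith
  nlinarith

end VortexRing

namespace VortexRing

/-- The abscissa of the center of mass of the cross-section in a Möbius chart. -/
def mobCent (A : Set ℂ) (p : ℝ) (e α : ℂ) : ℝ :=
  (∫ x in A, dens x * (mobT p e α x).re) / ∫ x in A, dens x

namespace RingData

variable {κ W δ ε μ : ℝ} {A : Set ℂ} {ψ : ℂ → ℝ} {p : ℝ} {D : ℝ} {e α : ℂ}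

lemma integrableOn_dens_mul_of_le (R : RingData κ W δ ε μ A ψ p) {f : ℂ → ℝ} (hf : Measurable f)
    {C : ℝ} (hC : ∀ x ∈ A, |f x| ≤ C) : IntegrableOn (fun x => dens x * f x) A :=
  R.integrableOn_dens_mul (R.integrableOn_bdd hf hC)

/-- Averages with respect to the density of functions bounded by `C`. -/
lemma abs_integral_dens_mul_le (R : RingData κ W δ ε μ A ψ p) {f : ℂ → ℝ} (hf : Measurable f)
    {C : ℝ} (hC : ∀ x ∈ A, |f x| ≤ C) :
    |(∫ x in A, dens x * f x) / ∫ x in A, dens x| ≤ C := by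
  have hM := R.mass_pos
  rw [abs_div, abs_of_pos hM, div_le_iff₀ hM, ← integral_const_mul]
  refine (abs_integral_le_integral_abs).trans ?_
  refine setIntegral_mono_on (R.integrableOn_dens_mul_of_le hf hC).abs
    (R.integrableOn_dens.const_mul C) R.measurableSet (fun x hx => ?_)
  have h1 := R.dens_pos hx
  rw [abs_mul, abs_of_pos h1, mul_comm]
  exact mul_le_mul_of_nonneg_right (hC x hx) h1.le

lemma abs_mobCent_le (R : RingData κ W δ ε μ A ψ p) (H : Mob δ D p e α)
    (hA : ∀ x ∈ A, ‖x - p‖ ≤ D) : |mobCent A p e α| ≤ 2 * D :=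
  R.abs_integral_dens_mul_le (Complex.measurable_re.comp (measurable_mobT p e α))
    (fun x hx => (Complex.abs_re_le_norm _).trans (H.norm_T_le (hA x hx)))

lemma integral_mobDens_mul_sub_re (R : RingData κ W δ ε μ A ψ p) (H : Mob δ D p e α)
    (hA : ∀ x ∈ A, ‖x - p‖ ≤ D) {h : ℂ → ℝ} {r K η : ℝ}
    (P : PlaneData (mobT p e α '' A) (mobDens p e α) h r K η) (l : ℝ) :
    ∫ y in mobT p e α '' A, mobDens p e α y * (l - y.re)
      = (∫ x in A, dens x) * (l - mobCent A p e α) := by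
  rw [P.integral_sub_re, H.integral_mobDens hA R.isOpen,
    H.integral_dens_mul hA R.isOpen (fun y => y.re), mobCent]
  have := R.mass_pos.ne'
  field_simp

end RingData

theorem exists_excess_eq_empty (κ W δ : ℝ) (hκ : 0 < κ) (hW : 0 < W) (hδ : 0 < δ) :
    ∃ C₁ > 0, ∃ C > 0, ∃ K > 0, ∃ d > 0, ∀ ε μ A ψ p D, RingData κ W δ ε μ A ψ p →
      (∀ x ∈ A, ‖x - p‖ ≤ D) → 0 < D → D ≤ d →
      D * (1 / δ + 1) ≤ 1 / 32 ∧ C₁ * D ≤ 1 / 4 ∧ ∀ e α, Tilt C₁ D p e α →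
        PlaneData (mobT p e α '' A) (mobDens p e α) (mobPot W ε μ A ψ p e α) (2 * D)
          (4 * (2 / δ * √(2 / δ))) (C * (D * Real.log (1 / ε) * ε ^ 2)) ∧
        ∀ l, mobCent A p e α + K * (Real.log (1 / ε) * D ^ 3) ≤ l →
          excess (mobT p e α '' A) l = ∅ := by
  obtain ⟨C₁, hC₁, C, hC, d, hd, h⟩ := exists_planeData κ W δ hκ hW hδ
  refine ⟨C₁, hC₁, C, hC, 16 * C / (√δ * κ), by positivity, d, hd, ?_⟩
  intro ε μ A ψ p D R hA hD hDd
  obtain ⟨h1, h2, h3⟩ := h ε μ A ψ p D R hA hD hDd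
  refine ⟨h1, h2, fun e α T => ⟨h3 e α T, fun l hl => ?_⟩⟩
  have H := T.mob hδ R.p_mem.1 R.p_mem.2 hD h1 h2
  have hL := R.one_le_log
  have hε := R.eps_pos
  have hpos : 0 < 16 * C / (√δ * κ) * (Real.log (1 / ε) * D ^ 3) := by positivity
  refine (h3 e α T).excess_eq_empty ?_ ?_
  · linarith [(abs_le.1 (R.abs_mobCent_le H hA)).1]
  · rw [R.integral_mobDens_mul_sub_re H hA (h3 e α T), lt_div_iff₀ (by positivity)]
    have h4 : √δ * (κ * ε ^ 2) * (16 * C / (√δ * κ) * (Real.log (1 / ε) * D ^ 3))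
        ≤ (∫ x in A, dens x) * (l - mobCent A p e α) :=
      mul_le_mul R.le_mass (by linarith) hpos.le R.mass_pos.le
    have h5 : √δ * (κ * ε ^ 2) * (16 * C / (√δ * κ) * (Real.log (1 / ε) * D ^ 3))
        = 16 * (C * (D * Real.log (1 / ε) * ε ^ 2)) * D ^ 2 := by
      field_simp
    have h6 : 0 < C * (D * Real.log (1 / ε) * ε ^ 2) * D ^ 2 := by positivity
    nlinarith

lemma Mob.mem_of_excess_eq_empty {δ D p : ℝ} {e α : ℂ} {A : Set ℂ} (H : Mob δ D p e α)
    {x y : ℂ} (hx : x ∈ A) (hyD : ‖y - p‖ ≤ D)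
    (hA : ∀ x ∈ A, ‖x - p‖ ≤ D)
    (him : (mobT p e α x).im = (mobT p e α y).im)
    (hre : (mobT p e α y).re < (mobT p e α x).re)
    (hE : excess (mobT p e α '' A) (((mobT p e α x).re + (mobT p e α y).re) / 2) = ∅) :
    y ∈ A := by
  set l := ((mobT p e α x).re + (mobT p e α y).re) / 2 with hl
  have hm : mirror l (mobT p e α x) = mobT p e α y := by
    apply Complex.ext
    · rw [mirror_re, hl]; ring
    · rw [mirror_im, him]
  have : mobT p e α x ∉ excess (mobT p e α '' A) l := by rw [hE]; exact Set.notMem_empty _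
  have hmem : mirror l (mobT p e α x) ∈ mobT p e α '' A := by
    by_contra hc
    exact this ⟨⟨x, hx, rfl⟩, by rw [hl]; linarith, hc⟩
  rw [hm, H.mem_image_iff hA (by linarith [H.norm_T_le hyD, H.D_pos]), H.S_T hyD] at hmem
  exact hmem

end VortexRing

namespace VortexRing

/-- The Möbius chart which is conformally adapted to the kernel at `p`. -/
def baseT (p : ℝ) (x : ℂ) : ℂ := mobT p 1 (3 / (8 * p) : ℝ) x

lemma baseT_eq (p : ℝ) (x : ℂ) : baseT p x = (x - p) / (1 - (3 / (8 * p) : ℝ) * (x - p)) := by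
  simp [baseT, mobT]

lemma mob_base {D p δ : ℝ} (hδ : 0 < δ) (h1 : δ ≤ p) (h2 : p ≤ 1 / δ) (hD : 0 < D)
    (hs : D * (1 / δ + 1) ≤ 1 / 32) : Mob δ D p 1 (3 / (8 * p) : ℝ) :=
  Tilt.mob (C := 0) ⟨by simp, by simp, by simp⟩ hδ h1 h2 hD hs (by norm_num)

lemma norm_baseT_le {D p δ : ℝ} (hδ : 0 < δ) (h1 : δ ≤ p) (h2 : p ≤ 1 / δ) (hD : 0 < D)
    (hs : D * (1 / δ + 1) ≤ 1 / 32) {x : ℂ} (hx : ‖x - p‖ ≤ D) : ‖baseT p x‖ ≤ 2 * D :=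
  (mob_base hδ h1 h2 hD hs).norm_T_le hx

lemma norm_mobT_sub_baseT_le {C D p δ : ℝ} {e α : ℂ} (T : Tilt C D p e α) (hC : 0 ≤ C)
    (hδ : 0 < δ) (h1 : δ ≤ p) (h2 : p ≤ 1 / δ) (hD : 0 < D) (hs : D * (1 / δ + 1) ≤ 1 / 32)
    (hCD : C * D ≤ 1 / 4) {x : ℂ} (hx : ‖x - p‖ ≤ D) :
    ‖mobT p e α x - (starRingEnd ℂ) e * baseT p x‖ ≤ 3 * (C * D ^ 3) := by
  have H := T.mob hδ h1 h2 hD hs hCD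
  have H₀ := mob_base hδ h1 h2 hD hs
  have n1 := H.denom_norm hx
  have n2 := H₀.denom_norm hx
  have z1 := H.denom_ne_zero hx
  have z2 := H₀.denom_ne_zero hx
  rw [baseT_eq, mobT]
  set α₀ : ℂ := ((3 / (8 * p) : ℝ) : ℂ)
  set ξ : ℂ := x - p
  have e1 : (starRingEnd ℂ) e * ξ / (1 - α * ξ) - (starRingEnd ℂ) e * (ξ / (1 - α₀ * ξ))
      = (starRingEnd ℂ) e * ((α - α₀) * ξ ^ 2) / ((1 - α * ξ) * (1 - α₀ * ξ)) := by
    rw [← mul_div_assoc, div_sub_div _ _ z1 z2]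
    congr 1
    ring
  rw [e1, norm_div, norm_mul, norm_mul, norm_mul, norm_pow, RCLike.norm_conj, T.norm_e, one_mul]
  have hden : (31 / 32) * (31 / 32) ≤ ‖1 - α * ξ‖ * ‖1 - α₀ * ξ‖ :=
    mul_le_mul n1 n2 (by norm_num) (norm_nonneg _)
  rw [div_le_iff₀ (by linarith)]
  have hnum : ‖α - α₀‖ * ‖ξ‖ ^ 2 ≤ 2 * C * D * D ^ 2 :=
    mul_le_mul T.norm_le (pow_le_pow_left₀ (norm_nonneg _) hx 2) (by positivity) (by positivity)
  have h0 : 0 ≤ C * D ^ 3 := by positivity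
  nlinarith

lemma norm_normalize_sub_one_le {w : ℂ} {t : ℝ} (ht : t ≤ 1 / 16) (hw : ‖w - 1‖ ≤ t) :
    w ≠ 0 ∧ ‖w / (‖w‖ : ℂ) - 1‖ ≤ 11 / 5 * t := by
  have h1 : |‖w‖ - 1| ≤ t := by
    have := abs_norm_sub_norm_le w 1
    rw [norm_one] at this
    exact this.trans hw
  have h2 := abs_le.1 h1
  have hw0 : 0 < ‖w‖ := by linarith
  refine ⟨norm_pos_iff.1 hw0, ?_⟩
  have hne : (‖w‖ : ℂ) ≠ 0 := by exact_mod_cast hw0.ne'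
  have e1 : w / (‖w‖ : ℂ) - 1 = ((w - 1) + ((1 - ‖w‖ : ℝ) : ℂ)) / (‖w‖ : ℂ) := by
    field_simp
    push_cast
    ring
  rw [e1, norm_div, Complex.norm_real, Real.norm_eq_abs, abs_of_pos hw0, div_le_iff₀ hw0]
  refine (norm_add_le _ _).trans ?_
  rw [Complex.norm_real, Real.norm_eq_abs, abs_sub_comm]
  have ht0 : 0 ≤ t := (norm_nonneg _).trans hw
  nlinarith

lemma norm_ratio_sub_one_le {C D p δ : ℝ} {e α : ℂ} (T : Tilt C D p e α)
    (hδ : 0 < δ) (h1 : δ ≤ p) (h2 : p ≤ 1 / δ) (hD : 0 < D) (hs : D * (1 / δ + 1) ≤ 1 / 32)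
    (hCD : C * D ≤ 1 / 4) {x : ℂ} (hx : ‖x - p‖ ≤ D) :
    ‖(1 - (3 / (8 * p) : ℝ) * (x - p)) / (1 - α * (x - p)) - 1‖ ≤ 11 / 5 * (C * D ^ 2) := by
  have H := T.mob hδ h1 h2 hD hs hCD
  have n1 := H.denom_norm hx
  have z1 := H.denom_ne_zero hx
  set α₀ : ℂ := ((3 / (8 * p) : ℝ) : ℂ)
  set ξ : ℂ := x - p
  have e1 : (1 - α₀ * ξ) / (1 - α * ξ) - 1 = (α - α₀) * ξ / (1 - α * ξ) := by
    rw [div_sub_one z1]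
    congr 1
    ring
  rw [e1, norm_div, norm_mul, div_le_iff₀ (by linarith)]
  have h0 := (norm_nonneg _).trans T.norm_le
  have h3 : ‖α - α₀‖ * ‖ξ‖ ≤ 2 * C * D * D :=
    mul_le_mul T.norm_le hx (norm_nonneg _) h0
  have h4 : 0 ≤ C * D ^ 2 := by nlinarith
  nlinarith

lemma sub_div_eq_mul_ratio {a b a₀ b₀ u v c : ℂ} (ha : a ≠ 0) (hb : b ≠ 0) (ha₀ : a₀ ≠ 0)
    (hb₀ : b₀ ≠ 0) (h : u * b - v * a = u * b₀ - v * a₀) :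
    c * u / a - c * v / b = c * ((u / a₀ - v / b₀) * (a₀ / a * (b₀ / b))) := by
  field_simp
  linear_combination c * h

/-- Any two distinct points can be put on a horizontal line by an admissible tilt. -/
lemma exists_tilt {C D p δ : ℝ} (hC : 0 ≤ C)
    (hδ : 0 < δ) (h1 : δ ≤ p) (h2 : p ≤ 1 / δ) (hD : 0 < D) (hs : D * (1 / δ + 1) ≤ 1 / 32)
    (hCD : C * D ≤ 1 / 4) {x y : ℂ} (hx : ‖x - p‖ ≤ D) (hy : ‖y - p‖ ≤ D)
    (hne : baseT p x ≠ baseT p y) :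
    ∃ e α e₀ : ℂ, Tilt C D p e α ∧ ‖e₀‖ = 1 ∧ e₀ * ‖baseT p x - baseT p y‖ = baseT p x - baseT p y ∧
      ‖e - e₀‖ ≤ 11 * (C * D ^ 2) ∧ (mobT p e α x).im = (mobT p e α y).im ∧
      (mobT p e α y).re < (mobT p e α x).re := by
  have hD32 : D ≤ 1 / 32 := by
    have : D * 1 ≤ D * (1 / δ + 1) := by gcongr; linarith [one_div_pos.2 hδ]
    linarith
  have H₀ := mob_base hδ h1 h2 hD hs
  have zx := H₀.denom_ne_zero hx
  have zy := H₀.denom_ne_zero hy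
  have hXY : 0 < ‖baseT p x - baseT p y‖ := norm_pos_iff.2 (sub_ne_zero.2 hne)
  set R := ‖baseT p x - baseT p y‖ with hR
  have hRne : (R : ℂ) ≠ 0 := by exact_mod_cast hXY.ne'
  set e₀ : ℂ := (baseT p x - baseT p y) / R with he₀
  have hn₀ : ‖e₀‖ = 1 := by
    rw [he₀, norm_div, Complex.norm_real, norm_norm, ← hR, div_self hXY.ne']
  have he₀R : e₀ * R = baseT p x - baseT p y := by rw [he₀]; field_simp
  set α : ℂ := (3 / (8 * p) : ℝ) + (3 / 2 * (C * D) : ℝ) * (starRingEnd ℂ) e₀ with hα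
  have hsub : α - (3 / (8 * p) : ℝ) = (3 / 2 * (C * D) : ℝ) * (starRingEnd ℂ) e₀ := by
    rw [hα]; ring
  have hCD0 : 0 ≤ C * D := by positivity
  have hαn : ‖α - (3 / (8 * p) : ℝ)‖ ≤ 2 * C * D := by
    rw [hsub, norm_mul, RCLike.norm_conj, hn₀, Complex.norm_real, Real.norm_eq_abs,
      abs_of_nonneg (by positivity)]
    linarith
  have hre : ∀ e : ℂ, ((α - (3 / (8 * p) : ℝ)) * e).re
      = 3 / 2 * (C * D) * ((starRingEnd ℂ) e₀ * e).re := fun e => by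
    rw [hsub, mul_assoc, Complex.re_ofReal_mul]
  have hcc : (starRingEnd ℂ) e₀ * e₀ = 1 := by
    rw [← Complex.normSq_eq_conj_mul_self, Complex.normSq_eq_norm_sq, hn₀]; norm_num
  have T₀ : Tilt C D p e₀ α := ⟨hn₀, hαn, by rw [hre, hcc, Complex.one_re]; linarith⟩
  have H := T₀.mob hδ h1 h2 hD hs hCD
  have zx' := H.denom_ne_zero hx
  have zy' := H.denom_ne_zero hy
  have ux := norm_ratio_sub_one_le T₀ hδ h1 h2 hD hs hCD hx
  have uy := norm_ratio_sub_one_le T₀ hδ h1 h2 hD hs hCD hy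
  set α₀ : ℂ := ((3 / (8 * p) : ℝ) : ℂ) with hα₀
  set wx := (1 - α₀ * (x - p)) / (1 - α * (x - p)) with hwx
  set wy := (1 - α₀ * (y - p)) / (1 - α * (y - p)) with hwy
  set t := C * D ^ 2 with ht
  have ht0 : 0 ≤ t := by positivity
  have ht1 : t ≤ 1 / 128 := by
    have : t = C * D * D := by rw [ht]; ring
    rw [this]
    nlinarith
  have hw : ‖wx * wy - 1‖ ≤ 5 * t := by
    have : wx * wy - 1 = (wx - 1) + (wy - 1) + (wx - 1) * (wy - 1) := by ring
    rw [this]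
    refine (norm_add_le _ _).trans ?_
    have a1 := norm_add_le (wx - 1) (wy - 1)
    have a2 : ‖(wx - 1) * (wy - 1)‖ ≤ 11 / 5 * t * (11 / 5 * t) := by
      rw [norm_mul]
      exact mul_le_mul ux uy (norm_nonneg _) (by positivity)
    nlinarith
  obtain ⟨hw0, hwn⟩ := norm_normalize_sub_one_le (by linarith) hw
  set w := wx * wy with hwdef
  have hwpos : 0 < ‖w‖ := norm_pos_iff.2 hw0
  have hwne : (‖w‖ : ℂ) ≠ 0 := by exact_mod_cast hwpos.ne'
  set e : ℂ := e₀ * (w / (‖w‖ : ℂ)) with he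
  have hee : ‖e - e₀‖ ≤ 11 * t := by
    have : e - e₀ = e₀ * (w / (‖w‖ : ℂ) - 1) := by rw [he]; ring
    rw [this, norm_mul, hn₀, one_mul]
    linarith
  have hne1 : ‖e‖ = 1 := by
    rw [he, norm_mul, hn₀, norm_div, Complex.norm_real, norm_norm, div_self hwpos.ne', one_mul]
  have T : Tilt C D p e α := by
    refine ⟨hne1, hαn, ?_⟩
    rw [hre]
    have e3 : (starRingEnd ℂ) e₀ * e = 1 + (starRingEnd ℂ) e₀ * (e - e₀) := by
      rw [mul_sub, hcc]; ring
    have a1 : |((starRingEnd ℂ) e₀ * (e - e₀)).re| ≤ 11 * t := by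
      refine (Complex.abs_re_le_norm _).trans ?_
      rw [norm_mul, RCLike.norm_conj, hn₀, one_mul]
      exact hee
    rw [e3, Complex.add_re, Complex.one_re]
    have := (abs_le.1 a1).1
    nlinarith
  have hdiff : mobT p e α x - mobT p e α y = ((R * ‖w‖ : ℝ) : ℂ) := by
    have e4 : mobT p e α x - mobT p e α y
        = (starRingEnd ℂ) e * ((baseT p x - baseT p y) * w) := by
      rw [baseT_eq, baseT_eq, mobT, mobT, hwdef, hwx, hwy]
      refine sub_div_eq_mul_ratio zx' zy' zx zy ?_
      ring
    have e5 : (baseT p x - baseT p y) * w = ((R * ‖w‖ : ℝ) : ℂ) * e := by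
      rw [← he₀R, he]
      push_cast
      field_simp
    have e6 : (starRingEnd ℂ) e * e = 1 := by
      rw [← Complex.normSq_eq_conj_mul_self, Complex.normSq_eq_norm_sq, hne1]; norm_num
    rw [e4, e5, mul_left_comm, e6, mul_one]
  refine ⟨e, α, e₀, T, hn₀, he₀R, hee, ?_, ?_⟩
  · have := congrArg Complex.im hdiff
    rw [Complex.sub_im, Complex.ofReal_im] at this
    linarith
  · have := congrArg Complex.re hdiff
    rw [Complex.sub_re, Complex.ofReal_re] at this
    have : 0 < R * ‖w‖ := by positivity
    linarith

end VortexRing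

namespace VortexRing

lemma measurePreserving_conj : MeasurePreserving (starRingEnd ℂ : ℂ → ℂ) :=
  Complex.conjLIE.measurePreserving

lemma measurableEmbedding_conj : MeasurableEmbedding (starRingEnd ℂ : ℂ → ℂ) :=
  Complex.conjLIE.toHomeomorph.measurableEmbedding

lemma baseT_conj (p : ℝ) (x : ℂ) : baseT p ((starRingEnd ℂ) x) = (starRingEnd ℂ) (baseT p x) := by
  simp only [baseT_eq, map_div₀, map_sub, map_mul, map_one, Complex.conj_ofReal]

lemma measurable_baseT (p : ℝ) : Measurable (baseT p) := measurable_mobT p 1 _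

/-- The center of mass of the cross-section in the base chart. -/
def baseCent (A : Set ℂ) (p : ℝ) : ℝ := mobCent A p 1 (3 / (8 * p) : ℝ)

namespace RingData

variable {κ W δ ε μ : ℝ} {A : Set ℂ} {ψ : ℂ → ℝ} {p : ℝ} {D C : ℝ} {e α : ℂ}

lemma conj_preimage (R : RingData κ W δ ε μ A ψ p) : (starRingEnd ℂ : ℂ → ℂ) ⁻¹' A = A := by
  ext x
  exact ⟨fun h => by simpa using R.symm _ h, R.symm x⟩

lemma integral_dens_mul_im (R : RingData κ W δ ε μ A ψ p) :
    ∫ x in A, dens x * (baseT p x).im = 0 := by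
  have h := measurePreserving_conj.setIntegral_preimage_emb measurableEmbedding_conj
    (fun x => dens x * (baseT p x).im) A
  rw [R.conj_preimage] at h
  have h2 : ∀ x, dens ((starRingEnd ℂ) x) * (baseT p ((starRingEnd ℂ) x)).im
      = -(dens x * (baseT p x).im) := fun x => by
    rw [baseT_conj, Complex.conj_im, dens, dens, Complex.conj_re]
    ring
  simp only [h2, integral_neg] at h
  linarith

lemma abs_baseCent_le (R : RingData κ W δ ε μ A ψ p) (hA : ∀ x ∈ A, ‖x - p‖ ≤ D) (hD : 0 < D)
    (hs : D * (1 / δ + 1) ≤ 1 / 32) : |baseCent A p| ≤ 2 * D :=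
  R.abs_mobCent_le (mob_base R.delta_pos R.p_mem.1 R.p_mem.2 hD hs) hA

lemma abs_mobCent_sub_le (R : RingData κ W δ ε μ A ψ p) (hA : ∀ x ∈ A, ‖x - p‖ ≤ D)
    (T : Tilt C D p e α) (hC : 0 ≤ C) (hD : 0 < D) (hs : D * (1 / δ + 1) ≤ 1 / 32)
    (hCD : C * D ≤ 1 / 4) :
    |mobCent A p e α - e.re * baseCent A p| ≤ 3 * (C * D ^ 3) := by
  have H := T.mob R.delta_pos R.p_mem.1 R.p_mem.2 hD hs hCD
  have hm1 : Measurable fun x => (mobT p e α x).re :=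
    Complex.measurable_re.comp (measurable_mobT p e α)
  have hm2 : Measurable fun x => (baseT p x).re := Complex.measurable_re.comp (measurable_baseT p)
  have hm3 : Measurable fun x => (baseT p x).im := Complex.measurable_im.comp (measurable_baseT p)
  have hb : ∀ x ∈ A, ‖baseT p x‖ ≤ 2 * D := fun x hx =>
    norm_baseT_le R.delta_pos R.p_mem.1 R.p_mem.2 hD hs (hA x hx)
  have i1 := R.integrableOn_dens_mul_of_le hm1
    (fun x hx => (Complex.abs_re_le_norm _).trans (H.norm_T_le (hA x hx)))
  have i2 := R.integrableOn_dens_mul_of_le hm2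
    (fun x hx => (Complex.abs_re_le_norm _).trans (hb x hx))
  have i3 := R.integrableOn_dens_mul_of_le hm3
    (fun x hx => (Complex.abs_im_le_norm _).trans (hb x hx))
  have key := R.abs_integral_dens_mul_le
    (f := fun x => (mobT p e α x).re - (e.re * (baseT p x).re + e.im * (baseT p x).im))
    (hm1.sub ((hm2.const_mul _).add (hm3.const_mul _))) (C := 3 * (C * D ^ 3)) (fun x hx => by
      have h1 := norm_mobT_sub_baseT_le T hC R.delta_pos R.p_mem.1 R.p_mem.2 hD hs hCD (hA x hx)
      have h2 : (mobT p e α x - (starRingEnd ℂ) e * baseT p x).re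
          = (mobT p e α x).re - (e.re * (baseT p x).re + e.im * (baseT p x).im) := by
        simp [Complex.sub_re, Complex.mul_re]
      rw [← h2]
      exact (Complex.abs_re_le_norm _).trans h1)
  have e1 : (∫ x in A, dens x * ((mobT p e α x).re
      - (e.re * (baseT p x).re + e.im * (baseT p x).im)))
      = (∫ x in A, dens x * (mobT p e α x).re) - e.re * (∫ x in A, dens x * (baseT p x).re) := by
    have e2 : ∀ x, dens x * ((mobT p e α x).re - (e.re * (baseT p x).re + e.im * (baseT p x).im))
        = dens x * (mobT p e α x).re - (e.re * (dens x * (baseT p x).re)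
          + e.im * (dens x * (baseT p x).im)) := fun x => by ring
    simp only [e2]
    have i4 : IntegrableOn (fun x => e.re * (dens x * (baseT p x).re)
        + e.im * (dens x * (baseT p x).im)) A := (i2.const_mul _).add (i3.const_mul _)
    rw [integral_sub i1 i4, integral_add (i2.const_mul _) (i3.const_mul _), integral_const_mul, integral_const_mul,
      R.integral_dens_mul_im, mul_zero, add_zero]
  rw [e1, sub_div, mul_div_assoc] at key
  exact key

end RingData

lemma normSq_sub_normSq_eq {X Y e₀ : ℂ} (c : ℝ) (h : e₀ * ‖X - Y‖ = X - Y) :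
    ‖X - c‖ ^ 2 - ‖Y - c‖ ^ 2
      = 2 * ‖X - Y‖ * ((starRingEnd ℂ) e₀ * ((X + Y) / 2 - c)).re := by
  have h2 : 2 * ‖X - Y‖ * ((starRingEnd ℂ) e₀ * ((X + Y) / 2 - c)).re
      = ((starRingEnd ℂ) (e₀ * ‖X - Y‖) * (X + Y - 2 * c)).re := by
    rw [map_mul, Complex.conj_ofReal,
      show (starRingEnd ℂ) e₀ * (‖X - Y‖ : ℂ) * (X + Y - 2 * c)
        = ((2 * ‖X - Y‖ : ℝ) : ℂ) * ((starRingEnd ℂ) e₀ * ((X + Y) / 2 - c)) by push_cast; ring,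
      Complex.re_ofReal_mul]
  rw [h2, h, ← Complex.normSq_eq_norm_sq, ← Complex.normSq_eq_norm_sq, Complex.normSq_apply,
    Complex.normSq_apply]
  simp only [Complex.mul_re, Complex.sub_re, Complex.sub_im, Complex.add_re, Complex.add_im,
    Complex.conj_re, Complex.conj_im, Complex.ofReal_re, Complex.ofReal_im, map_sub,
    Complex.re_ofNat, Complex.im_ofNat, Complex.mul_im]
  ring

/-- Points which are closer to the center than a point of `A`, by a fixed margin, lie in `A`. -/
theorem RingData.mem_of_normSq_le {κ W δ ε μ : ℝ} {A : Set ℂ} {ψ : ℂ → ℝ} {p D C K : ℝ}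
    (R : RingData κ W δ ε μ A ψ p) (hA : ∀ x ∈ A, ‖x - p‖ ≤ D) (hC : 0 < C) (hK : 0 < K)
    (hD : 0 < D) (hs : D * (1 / δ + 1) ≤ 1 / 32) (hCD : C * D ≤ 1 / 4)
    (hE : ∀ e α, Tilt C D p e α → ∀ l,
      mobCent A p e α + K * (Real.log (1 / ε) * D ^ 3) ≤ l → excess (mobT p e α '' A) l = ∅)
    {x y : ℂ} (hx : x ∈ A) (hy : ‖y - p‖ ≤ D)
    (hxy : 8 * (K + 50 * C) * (Real.log (1 / ε) * D ^ 4)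
      ≤ ‖baseT p x - baseCent A p‖ ^ 2 - ‖baseT p y - baseCent A p‖ ^ 2) : y ∈ A := by
  have hL := R.one_le_log
  have hxD := hA x hx
  obtain ⟨hp1, hp2⟩ := R.p_mem
  have hδ := R.delta_pos
  set L := Real.log (1 / ε)
  set c := baseCent A p with hc
  have hgap : 0 < 8 * (K + 50 * C) * (L * D ^ 4) := by positivity
  have hne : baseT p x ≠ baseT p y := by
    intro h
    rw [h, sub_self] at hxy
    linarith
  obtain ⟨e, α, e₀, T, -, he₀, hee, him, hre⟩ :=
    exists_tilt hC.le hδ hp1 hp2 hD hs hCD hxD hy hne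
  have H := T.mob hδ hp1 hp2 hD hs hCD
  refine H.mem_of_excess_eq_empty hx hy hA him hre (hE e α T _ ?_)
  have hcent := (abs_le.1 (R.abs_mobCent_sub_le hA T hC.le hD hs hCD)).2
  have nx := norm_baseT_le hδ hp1 hp2 hD hs hxD
  have ny := norm_baseT_le hδ hp1 hp2 hD hs hy
  have nc : ‖(c : ℂ)‖ ≤ 2 * D := by
    rw [Complex.norm_real]
    exact R.abs_baseCent_le hA hD hs
  have dx := (abs_le.1 ((Complex.abs_re_le_norm _).trans
    (norm_mobT_sub_baseT_le T hC.le hδ hp1 hp2 hD hs hCD hxD))).1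
  have dy := (abs_le.1 ((Complex.abs_re_le_norm _).trans
    (norm_mobT_sub_baseT_le T hC.le hδ hp1 hp2 hD hs hCD hy))).1
  have hid := normSq_sub_normSq_eq c he₀
  rw [hid] at hxy
  set X := baseT p x
  set Y := baseT p y
  have hXY : ‖X - Y‖ ≤ 4 * D := (norm_sub_le _ _).trans (by linarith)
  have hXY0 : 0 ≤ ‖X - Y‖ := norm_nonneg _
  set Q := (X + Y) / 2 - (c : ℂ) with hQ
  have hQn : ‖Q‖ ≤ 4 * D := by
    rw [hQ]
    refine (norm_sub_le _ _).trans ?_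
    rw [norm_div, Complex.norm_ofNat]
    have := norm_add_le X Y
    linarith
  have h1 : (K + 50 * C) * (L * D ^ 3) ≤ ((starRingEnd ℂ) e₀ * Q).re := by
    by_contra hcon
    push Not at hcon
    have h2 : 0 ≤ (K + 50 * C) * (L * D ^ 3) := by positivity
    have h3 : 2 * ‖X - Y‖ * ((starRingEnd ℂ) e₀ * Q).re < 8 * D * ((K + 50 * C) * (L * D ^ 3)) := by
      rcases le_or_gt ((starRingEnd ℂ) e₀ * Q).re 0 with h | h
      · have : 2 * ‖X - Y‖ * ((starRingEnd ℂ) e₀ * Q).re ≤ 0 :=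
          mul_nonpos_of_nonneg_of_nonpos (by positivity) h
        have : 0 < 8 * D * ((K + 50 * C) * (L * D ^ 3)) := by positivity
        linarith
      · calc 2 * ‖X - Y‖ * ((starRingEnd ℂ) e₀ * Q).re
            ≤ 8 * D * ((starRingEnd ℂ) e₀ * Q).re := by
              apply mul_le_mul_of_nonneg_right _ h.le; linarith
          _ < _ := by
              apply mul_lt_mul_of_pos_left hcon; linarith
    have h4 : 8 * D * ((K + 50 * C) * (L * D ^ 3)) = 8 * (K + 50 * C) * (L * D ^ 4) := by ring
    linarith
  have h5 : |((starRingEnd ℂ) (e - e₀) * Q).re| ≤ 11 * (C * D ^ 2) * (4 * D) := by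
    refine (Complex.abs_re_le_norm _).trans ?_
    rw [norm_mul, RCLike.norm_conj]
    exact mul_le_mul hee hQn (norm_nonneg _) (by positivity)
  have h6 : ((starRingEnd ℂ) e * Q).re
      = ((starRingEnd ℂ) e₀ * Q).re + ((starRingEnd ℂ) (e - e₀) * Q).re := by
    rw [← Complex.add_re, map_sub]
    congr 1
    ring
  have h7 : ((starRingEnd ℂ) e * Q).re
      = (((starRingEnd ℂ) e * X).re + ((starRingEnd ℂ) e * Y).re) / 2 - e.re * c := by
    rw [hQ]
    simp only [Complex.mul_re, Complex.sub_re, Complex.sub_im, Complex.add_re, Complex.add_im,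
      Complex.conj_re, Complex.conj_im, Complex.ofReal_re, Complex.ofReal_im, Complex.div_ofNat_re,
      Complex.div_ofNat_im]
    ring
  rw [Complex.sub_re] at dx dy
  have h8 : C * D ^ 3 ≤ C * (L * D ^ 3) := by
    have : 0 ≤ C * D ^ 3 := by positivity
    nlinarith
  have h5' := (abs_le.1 h5).1
  nlinarith

end VortexRing

namespace VortexRing

lemma exists_lipschitz_Icc {f : ℝ → ℝ} (hf : ContDiffOn ℝ 2 f (Set.Ioi 0)) {a : ℝ} (b : ℝ)
    (ha : 0 < a) : ∃ C ≥ 0, ∀ x ∈ Set.Icc a b, ∀ y ∈ Set.Icc a b, |f x - f y| ≤ C * |x - y| := by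
  obtain ⟨K, hK⟩ := (hf.mono fun x (hx : x ∈ Set.Icc a b) =>
    ha.trans_le hx.1).exists_lipschitzOnWith two_ne_zero (convex_Icc a b) isCompact_Icc
  exact ⟨K, K.2, fun x hx y hy => by simpa [Real.dist_eq] using hK.dist_le_mul x hx y hy⟩

/-- The relative stream function increases at most at the rate `ε² log (1/ε)` away from its
maximum point. -/
lemma exists_potential_sub_le (κ W δ : ℝ) (hδ : 0 < δ) : ∃ C > 0, ∀ ε μ A ψ p D e α,
    RingData κ W δ ε μ A ψ p → Mob δ D p e α → ∀ y : ℂ, ‖y‖ ≤ 8 * D → mobS p e α y ∈ A →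
      (logPot (mobT p e α '' A) (mobDens p e α) y + mobPot W ε μ A ψ p e α y)
        - (logPot (mobT p e α '' A) (mobDens p e α) 0 + mobPot W ε μ A ψ p e α 0)
        ≤ C * (Real.log (1 / ε) * ε ^ 2) * ‖y‖ := by
  obtain ⟨K₁, hK₁, h₁⟩ := exists_lipschitz_Icc contDiffOn_inv_sqrt (2 / δ) (half_pos hδ)
  obtain ⟨K₂, hK₂, h₂⟩ := exists_lipschitz_Icc contDiffOn_mul_sqrt (2 / δ) (half_pos hδ)
  obtain ⟨C₀, hC₀, hψ⟩ := exists_stream_le κ W δ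
  refine ⟨4 * π * (C₀ * K₁ + |W| / 2 * K₂) * 2 + 1, by positivity, ?_⟩
  intro ε μ A ψ p D e α R H y hy hmem
  have hL := R.one_le_log
  have hW := R.W_pos
  have hμ := R.mu_pos
  have hX := H.re_S_mem hy
  have hp := H.p_mem
  rw [RingData.logPot_add_mobPot, RingData.logPot_add_mobPot, Mob.S_zero, Complex.ofReal_re, abs_of_pos hW]
  have hdist : |(mobS p e α y).re - p| ≤ 2 * ‖y‖ := by
    have h3 := H.norm_S_sub_S_le hy (y₂ := 0) (by simpa using H.D_pos.le)
    rw [Mob.S_zero, sub_zero] at h3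
    have h4 := Complex.abs_re_le_norm (mobS p e α y - p)
    rw [Complex.sub_re, Complex.ofReal_re] at h4
    exact h4.trans h3
  have hmax := R.max _ hmem
  have hlev := (R.level p (by simpa using R.delta_pos.trans_le R.p_mem.1)).1 R.mem
  have hup := hψ ε μ A ψ p R p R.mem
  rw [Complex.ofReal_re] at hlev
  set X := (mobS p e α y).re
  set L := Real.log (1 / ε)
  have hX0 : 0 < X := lt_of_lt_of_le (by positivity) hX.1
  have hp0 : 0 < p := lt_of_lt_of_le (by positivity) hp.1
  have hf : ∀ (Z s : ℝ), 0 < Z → 4 * π * ε ^ 2 / √Z * (s - (μ + W / 2 * Z ^ 2 * L))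
      = 4 * π * ε ^ 2 * ((s - μ) * (√Z)⁻¹ - W / 2 * L * (Z * √Z)) := by
    intro Z s hZ
    have h5 := Real.sqrt_pos.2 hZ
    have h6 : Z ^ 2 = Z * √Z * √Z := by rw [mul_assoc, Real.mul_self_sqrt hZ.le, sq]
    rw [h6]
    field_simp
    ring
  rw [hf X _ hX0, hf p _ hp0, ← mul_sub]
  have g1 := (le_abs_self _).trans (h₁ X hX p hp)
  have g2 := (neg_abs_le _).trans' (neg_le_neg (h₂ X hX p hp))
  have b1 : (ψ (mobS p e α y) - μ) * (√X)⁻¹ ≤ (ψ p - μ) * (√X)⁻¹ := by gcongr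
  have c0 : 0 ≤ ψ p - μ := by
    have : 0 ≤ W / 2 * p ^ 2 * L := by positivity
    linarith
  have b2 : (ψ p - μ) * ((√X)⁻¹ - (√p)⁻¹) ≤ C₀ * L * (K₁ * (2 * ‖y‖)) := by
    calc (ψ p - μ) * ((√X)⁻¹ - (√p)⁻¹) ≤ (ψ p - μ) * (K₁ * (2 * ‖y‖)) :=
          mul_le_mul_of_nonneg_left (g1.trans (by gcongr)) c0
      _ ≤ _ := by gcongr; linarith
  have b3 : W / 2 * L * (p * √p - X * √X) ≤ W / 2 * L * (K₂ * (2 * ‖y‖)) := by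
    refine mul_le_mul_of_nonneg_left ?_ (by positivity)
    have : K₂ * |X - p| ≤ K₂ * (2 * ‖y‖) := by gcongr
    linarith
  have b4 : (ψ (mobS p e α y) - μ) * (√X)⁻¹ - W / 2 * L * (X * √X)
      - ((ψ p - μ) * (√p)⁻¹ - W / 2 * L * (p * √p))
      ≤ (C₀ * K₁ + W / 2 * K₂) * 2 * (L * ‖y‖) := by nlinarith
  have hε := R.eps_pos
  have b5 : 0 ≤ L * ε ^ 2 * ‖y‖ := by positivity
  calc _ ≤ 4 * π * ε ^ 2 * ((C₀ * K₁ + W / 2 * K₂) * 2 * (L * ‖y‖)) := by gcongr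
    _ ≤ _ := by nlinarith

/-- The center of mass lies within `O(D² log (1/ε))` of the maximum point. -/
theorem exists_mobCent_ge (κ W δ : ℝ) (hκ : 0 < κ) (hδ : 0 < δ) {C K : ℝ} (hC : 0 ≤ C)
    (hK : 0 ≤ K) : ∃ C' > 0, ∀ ε μ A ψ p D e α,
    RingData κ W δ ε μ A ψ p → (∀ x ∈ A, ‖x - p‖ ≤ D) → Mob δ D p e α →
    PlaneData (mobT p e α '' A) (mobDens p e α) (mobPot W ε μ A ψ p e α) (2 * D)
          (4 * (2 / δ * √(2 / δ))) (C * (D * Real.log (1 / ε) * ε ^ 2)) →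
    (∀ l, mobCent A p e α + K * (Real.log (1 / ε) * D ^ 3) ≤ l →
          excess (mobT p e α '' A) l = ∅) →
    -(C' * (Real.log (1 / ε) * D ^ 2)) ≤ mobCent A p e α := by
  obtain ⟨C₂, hC₂, hpot⟩ := exists_potential_sub_le κ W δ hδ
  refine ⟨2 * K + 16 * (C + C₂) / (√δ * κ), by positivity, ?_⟩
  intro ε μ A ψ p D e α R hA H P hE
  have hL := R.one_le_log
  have hD := H.D_pos
  have hε := R.eps_pos
  have hD1 := RingData.D_le H
  set L := Real.log (1 / ε)
  set m := -mobCent A p e α with hm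
  by_contra hcon
  push Not at hcon
  have hsplit : 0 ≤ 16 * (C + C₂) / (√δ * κ) * (L * D ^ 2) := by positivity
  have hm1 : 2 * (K * (L * D ^ 3)) ≤ m := by
    have h0 : 0 ≤ K * (L * D ^ 2) := by positivity
    have h1 : K * (L * D ^ 3) = K * (L * D ^ 2) * D := by ring
    rw [h1]
    nlinarith
  have hm2 : 16 * (C + C₂) / (√δ * κ) * (L * D ^ 2) < m := by
    have h0 : 0 ≤ K * (L * D ^ 2) := by positivity
    nlinarith
  have hm0 : 0 < m := hsplit.trans_lt hm2
  have hT0 : mobT p e α p = 0 := by simp [mobT]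
  obtain ⟨r₀, hr₀, hball⟩ := Metric.isOpen_iff.1 P.isOpen 0 ⟨p, R.mem, hT0⟩
  set t := min (r₀ / 2) m with ht
  have ht0 : 0 < t := lt_min (by linarith) hm0
  have htm : t ≤ m := min_le_right _ _
  have hy : (-(t : ℂ)) ∈ mobT p e α '' A := hball (by
    rw [mem_ball_zero_iff, norm_neg, Complex.norm_real, Real.norm_eq_abs, abs_of_pos ht0]
    exact (min_le_left _ _).trans_lt (by linarith))
  have hyn : ‖(-(t : ℂ))‖ = t := by
    rw [norm_neg, Complex.norm_real, Real.norm_eq_abs, abs_of_pos ht0]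
  have hy2 : t ≤ 2 * D := hyn ▸ P.norm_le hy
  have hS := (H.mem_image_iff hA (by rw [hyn]; linarith)).1 hy
  have hup := hpot ε μ A ψ p D e α R H (-(t : ℂ)) (by rw [hyn]; linarith) hS
  rw [hyn] at hup
  have hlow := P.logPot_mirror_sub_ge_of_empty (l := -t / 2) (x := 0) (by simpa using P.pos.le)
    (by rw [Complex.zero_re]; linarith) (hE _ (by linarith))
  have hmir : mirror (-t / 2) 0 = -(t : ℂ) := by
    apply Complex.ext
    · simp only [mirror_re, Complex.zero_re, Complex.neg_re, Complex.ofReal_re]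
      ring
    · simp
  rw [hmir, R.integral_mobDens_mul_sub_re H hA P, Complex.zero_re] at hlow
  have hsl := P.slope (-(t : ℂ)) 0 (by rw [hyn]; linarith) (by simpa using P.pos.le) (by simp)
    (by simpa using ht0.le)
  simp only [Complex.zero_re, Complex.neg_re, Complex.ofReal_re, sub_neg_eq_add, zero_add] at hsl
  have hM : √δ * (κ * ε ^ 2) * (m / 2) ≤ (∫ x in A, dens x) * (-t / 2 - mobCent A p e α) :=
    mul_le_mul R.le_mass (by linarith) (by linarith) R.mass_pos.le
  have hδ' := Real.sqrt_pos.2 hδ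
  have key : t * (√δ * (κ * ε ^ 2) * m / (16 * D ^ 2))
      ≤ t * ((C + C₂) * (L * ε ^ 2)) := by
    have k1 : (0 - -t / 2) * (√δ * (κ * ε ^ 2) * (m / 2) / (2 * D) ^ 2)
        ≤ (0 - -t / 2) * ((∫ x in A, dens x) * (-t / 2 - mobCent A p e α) / (2 * D) ^ 2) :=
      mul_le_mul_of_nonneg_left (by gcongr) (by linarith)
    have k2 : (0 - -t / 2) * (√δ * (κ * ε ^ 2) * (m / 2) / (2 * D) ^ 2)
        = t * (√δ * (κ * ε ^ 2) * m / (16 * D ^ 2)) := by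
      field_simp
      ring
    have k3 : C * (D * L * ε ^ 2) * t ≤ C * (L * ε ^ 2) * t := by
      have : D * L * ε ^ 2 ≤ 1 * L * ε ^ 2 := by gcongr; linarith
      rw [one_mul] at this
      gcongr
    linarith
  have key2 := le_of_mul_le_mul_left key ht0
  rw [div_le_iff₀ (by positivity)] at key2
  have hm3 : 16 * (C + C₂) * (L * D ^ 2) < m * (√δ * κ) := by
    have := mul_lt_mul_of_pos_right hm2 (show 0 < √δ * κ by positivity)
    have e1 : 16 * (C + C₂) / (√δ * κ) * (L * D ^ 2) * (√δ * κ)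
        = 16 * (C + C₂) * (L * D ^ 2) := by field_simp
    linarith
  have hε2 : 0 < ε ^ 2 := by positivity
  nlinarith

/-- In the base chart the cross-section is close to a disc about its center of mass. -/
theorem exists_ball_comparison (κ W δ : ℝ) (hκ : 0 < κ) (hW : 0 < W) (hδ : 0 < δ) :
    ∃ K > 0, ∃ d > 0, ∀ ε μ A ψ p D, RingData κ W δ ε μ A ψ p →
      (∀ x ∈ A, ‖x - p‖ ≤ D) → 0 < D → D ≤ d →
      D * (1 / δ + 1) ≤ 1 / 32 ∧ |baseCent A p| ≤ K * (Real.log (1 / ε) * D ^ 2) ∧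
      ∀ x ∈ A, ∀ y : ℂ, ‖y - p‖ ≤ D → K * (Real.log (1 / ε) * D ^ 4)
        ≤ ‖baseT p x - baseCent A p‖ ^ 2 - ‖baseT p y - baseCent A p‖ ^ 2 → y ∈ A := by
  obtain ⟨C₁, hC₁, C, hC, K, hK, d, hd, h⟩ := exists_excess_eq_empty κ W δ hκ hW hδ
  obtain ⟨C', hC', hcent⟩ := exists_mobCent_ge κ W δ hκ hδ hC.le hK.le
  refine ⟨8 * (K + 50 * C₁) + (C' + 3 * C₁), by positivity, d, hd, ?_⟩
  intro ε μ A ψ p D R hA hD hDd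
  obtain ⟨hs, hCD, hT⟩ := h ε μ A ψ p D R hA hD hDd
  have hL := R.one_le_log
  refine ⟨hs, ?_, fun x hx y hy hxy =>
    R.mem_of_normSq_le hA hC₁ hK hD hs hCD (fun e α T => (hT e α T).2) hx hy ?_⟩
  · have hb : ∀ σ : ℝ, σ = 1 ∨ σ = -1 →
        -((C' + 3 * C₁) * (Real.log (1 / ε) * D ^ 2)) ≤ σ * baseCent A p := fun σ hσ => by
      have T := tilt_real (p := p) hC₁.le hD.le hσ
      have H := T.mob hδ R.p_mem.1 R.p_mem.2 hD hs hCD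
      have h1 := hcent ε μ A ψ p D _ _ R hA H (hT _ _ T).1 (hT _ _ T).2
      have h2 := (abs_le.1 (R.abs_mobCent_sub_le hA T hC₁.le hD hs hCD)).2
      rw [Complex.ofReal_re] at h2
      have h3 : C₁ * D ^ 3 ≤ C₁ * (Real.log (1 / ε) * D ^ 2) := by
        have := RingData.D_le H
        have h4 : D ^ 3 = D * D ^ 2 := by ring
        rw [h4]
        gcongr
        linarith
      linarith
    have h1 := hb 1 (Or.inl rfl)
    have h2 := hb (-1) (Or.inr rfl)
    have h3 : 0 ≤ 8 * (K + 50 * C₁) * (Real.log (1 / ε) * D ^ 2) := by positivity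
    rw [abs_le]
    constructor <;> linarith
  · have : 0 ≤ (C' + 3 * C₁) * (Real.log (1 / ε) * D ^ 4) := by positivity
    linarith

end VortexRing

namespace VortexRing

/-- The curvature-type coefficient of the preimage of a disc under the base chart. -/
def discQ (a c ρ : ℝ) : ℝ := (1 + a * c) ^ 2 - a ^ 2 * ρ

/-- The center of the preimage of a disc under the base chart, up to normalization. -/
def discG (a c ρ : ℝ) : ℝ := c * (1 + a * c) - a * ρ

lemma discQ_mul_norm_sub_sq (a c ρ : ℝ) {ξ : ℂ} (h : 1 - a * ξ ≠ 0) :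
    discQ a c ρ * ‖1 - a * ξ‖ ^ 2 * (‖ξ / (1 - a * ξ) - c‖ ^ 2 - ρ)
      = ‖discQ a c ρ * ξ - discG a c ρ‖ ^ 2 - ρ := by
  have h1 : ‖1 - a * ξ‖ ^ 2 * ‖ξ / (1 - a * ξ) - c‖ ^ 2 = ‖ξ - c * (1 - a * ξ)‖ ^ 2 := by
    rw [← mul_pow, ← norm_mul]
    congr 2
    field_simp
  have h2 : discQ a c ρ * ‖1 - a * ξ‖ ^ 2 * (‖ξ / (1 - a * ξ) - c‖ ^ 2 - ρ)
      = discQ a c ρ * (‖ξ - c * (1 - a * ξ)‖ ^ 2 - ρ * ‖1 - a * ξ‖ ^ 2) := by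
    rw [← h1]; ring
  rw [h2]
  simp only [← Complex.normSq_eq_norm_sq, Complex.normSq_apply, Complex.sub_re, Complex.sub_im,
    Complex.mul_re, Complex.mul_im, Complex.one_re, Complex.one_im, Complex.ofReal_re,
    Complex.ofReal_im, discQ, discG]
  ring

section Disc

variable {p c ρ : ℝ} {x : ℂ}

lemma discQ_mul_norm_baseT_sub (hq : 0 < discQ (3 / (8 * p)) c ρ)
    (h : 1 - ((3 / (8 * p) : ℝ) : ℂ) * (x - p) ≠ 0) :
    discQ (3 / (8 * p)) c ρ * ‖1 - ((3 / (8 * p) : ℝ) : ℂ) * (x - p)‖ ^ 2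
      * (‖baseT p x - c‖ ^ 2 - ρ)
      = (discQ (3 / (8 * p)) c ρ
        * ‖x - (p + discG (3 / (8 * p)) c ρ / discQ (3 / (8 * p)) c ρ : ℝ)‖) ^ 2 - ρ := by
  rw [baseT_eq, discQ_mul_norm_sub_sq _ _ _ h]
  congr 2
  have hn : discQ (3 / (8 * p)) c ρ = ‖(discQ (3 / (8 * p)) c ρ : ℂ)‖ := by
    rw [Complex.norm_real, Real.norm_eq_abs, abs_of_pos hq]
  conv_rhs => arg 1; rw [hn]
  rw [← norm_mul]
  congr 1
  have : (discQ (3 / (8 * p)) c ρ : ℂ) ≠ 0 := by exact_mod_cast hq.ne'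
  push_cast
  field_simp
  ring

lemma norm_baseT_sub_sq_lt (hq : 0 < discQ (3 / (8 * p)) c ρ) (hρ : 0 ≤ ρ)
    (h : 1 - ((3 / (8 * p) : ℝ) : ℂ) * (x - p) ≠ 0)
    (hx : ‖x - (p + discG (3 / (8 * p)) c ρ / discQ (3 / (8 * p)) c ρ : ℝ)‖
      < √ρ / discQ (3 / (8 * p)) c ρ) : ‖baseT p x - c‖ ^ 2 < ρ := by
  have e := discQ_mul_norm_baseT_sub hq h
  rw [lt_div_iff₀ hq, mul_comm] at hx
  have h1 := pow_lt_pow_left₀ hx (by positivity) two_ne_zero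
  rw [Real.sq_sqrt hρ] at h1
  have h2 : 0 < discQ (3 / (8 * p)) c ρ * ‖1 - ((3 / (8 * p) : ℝ) : ℂ) * (x - p)‖ ^ 2 := by
    have := norm_pos_iff.2 h
    positivity
  by_contra hcon
  push Not at hcon
  have := mul_nonneg h2.le (sub_nonneg.2 hcon)
  linarith

lemma norm_sub_le_of_norm_baseT_sub_sq_le (hq : 0 < discQ (3 / (8 * p)) c ρ)
    (h : 1 - ((3 / (8 * p) : ℝ) : ℂ) * (x - p) ≠ 0) (hx : ‖baseT p x - c‖ ^ 2 ≤ ρ) :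
    ‖x - (p + discG (3 / (8 * p)) c ρ / discQ (3 / (8 * p)) c ρ : ℝ)‖
      ≤ √ρ / discQ (3 / (8 * p)) c ρ := by
  have e := discQ_mul_norm_baseT_sub hq h
  rw [le_div_iff₀ hq, mul_comm]
  apply Real.le_sqrt_of_sq_le
  have h2 : 0 ≤ discQ (3 / (8 * p)) c ρ * ‖1 - ((3 / (8 * p) : ℝ) : ℂ) * (x - p)‖ ^ 2 := by
    positivity
  have := mul_nonneg h2 (sub_nonneg.2 hx)
  nlinarith

end Disc

section Bounds

variable {a c ρ D : ℝ}

lemma sq_mul_le (ha : 0 ≤ a) (hD : 0 < D) (haD : a * D ≤ 1 / 64) (hρ : ρ ≤ 2 * D ^ 2) :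
    a ^ 2 * ρ ≤ 1 / 2048 := by
  have h1 : (a * D) ^ 2 ≤ (1 / 64) ^ 2 := pow_le_pow_left₀ (by positivity) haD 2
  have h2 : a ^ 2 * ρ ≤ a ^ 2 * (2 * D ^ 2) := by gcongr
  nlinarith

lemma abs_mul_le (ha : 0 ≤ a) (haD : a * D ≤ 1 / 64) (hc : |c| ≤ D / 64) :
    |a * c| ≤ 1 / 4096 := by
  rw [abs_mul, abs_of_nonneg ha]
  have : a * |c| ≤ a * (D / 64) := by gcongr
  linarith

lemma discQ_mem (ha : 0 ≤ a) (hD : 0 < D) (haD : a * D ≤ 1 / 64) (hc : |c| ≤ D / 64)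
    (hρ0 : 0 ≤ ρ) (hρ : ρ ≤ 2 * D ^ 2) : 9 / 10 ≤ discQ a c ρ ∧ discQ a c ρ ≤ 11 / 10 := by
  have h1 := sq_mul_le ha hD haD hρ
  have h2 := abs_le.1 (abs_mul_le ha haD hc)
  have h3 : 0 ≤ a ^ 2 * ρ := by positivity
  unfold discQ
  constructor <;> nlinarith

lemma abs_discG_le (ha : 0 ≤ a) (haD : a * D ≤ 1 / 64) (hc : |c| ≤ D / 64)
    (hρ0 : 0 ≤ ρ) : |discG a c ρ| ≤ 2 * |c| + a * ρ := by
  have h2 := abs_mul_le ha haD hc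
  have h3 : |1 + a * c| ≤ 2 := (abs_add_le _ _).trans (by rw [abs_one]; linarith)
  unfold discG
  refine (abs_sub _ _).trans ?_
  rw [abs_mul, abs_of_nonneg (show 0 ≤ a * ρ by positivity)]
  nlinarith [abs_nonneg c]

lemma discCenter_le (ha : 0 ≤ a) (hD : 0 < D) (haD : a * D ≤ 1 / 64) (hc : |c| ≤ D / 64)
    (hρ0 : 0 ≤ ρ) (hρ : ρ ≤ 2 * D ^ 2) :
    |discG a c ρ / discQ a c ρ| ≤ 3 * |c| + 3 * (a * D ^ 2) := by
  have hq := discQ_mem ha hD haD hc hρ0 hρ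
  have hg := abs_discG_le ha haD hc hρ0
  rw [abs_div, abs_of_pos (by linarith : 0 < discQ a c ρ), div_le_iff₀ (by linarith)]
  have h1 : a * ρ ≤ a * (2 * D ^ 2) := by gcongr
  have h2 : 0 ≤ a * D ^ 2 := by positivity
  have h3 := abs_nonneg c
  nlinarith

lemma discRadius_sq_sub_le {ρ' : ℝ} (ha : 0 ≤ a) (hD : 0 < D) (haD : a * D ≤ 1 / 64)
    (hc : |c| ≤ D / 64) (hρ0 : 0 ≤ ρ) (hle : ρ ≤ ρ') (hρ : ρ' ≤ 2 * D ^ 2) :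
    ρ' / discQ a c ρ' ^ 2 - ρ / discQ a c ρ ^ 2 ≤ 3 * (ρ' - ρ) := by
  have hq := discQ_mem ha hD haD hc hρ0 (hle.trans hρ)
  have hq' := discQ_mem ha hD haD hc (hρ0.trans hle) hρ
  have h0 := sq_mul_le ha hD haD (hle.trans hρ)
  have hdiff : discQ a c ρ - discQ a c ρ' = a ^ 2 * (ρ' - ρ) := by unfold discQ; ring
  set q := discQ a c ρ
  set q' := discQ a c ρ'
  have hq0 : 0 < q := by linarith
  have hq0' : 0 < q' := by linarith
  have e : ρ' / q' ^ 2 - ρ / q ^ 2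
      = (ρ' - ρ) * (1 / q' ^ 2 + a ^ 2 * ρ * ((q + q') / (q' ^ 2 * q ^ 2))) := by
    have : q = q' + a ^ 2 * (ρ' - ρ) := by linarith
    have e2 : ρ' / q' ^ 2 - ρ / q ^ 2
      = (ρ' - ρ) * (1 / q' ^ 2) + ρ * ((q - q') * (q + q') / (q' ^ 2 * q ^ 2)) := by
      field_simp
      ring
    rw [e2, hdiff]
    ring
  have s1 : (81 / 100 : ℝ) ≤ q' ^ 2 := by nlinarith
  have s2 : (81 / 100 : ℝ) ≤ q ^ 2 := by nlinarith
  have b1 : 1 / q' ^ 2 ≤ 2 := by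
    rw [div_le_iff₀ (by positivity)]; linarith
  have b2 : (q + q') / (q' ^ 2 * q ^ 2) ≤ 4 := by
    rw [div_le_iff₀ (by positivity)]
    have : (81 / 100 : ℝ) * (81 / 100) ≤ q' ^ 2 * q ^ 2 :=
      mul_le_mul s1 s2 (by norm_num) (by positivity)
    linarith
  have b3 : a ^ 2 * ρ * ((q + q') / (q' ^ 2 * q ^ 2)) ≤ 1 / 2048 * 4 :=
    mul_le_mul h0 b2 (by positivity) (by norm_num)
  rw [e, mul_comm]
  exact mul_le_mul_of_nonneg_right (by linarith) (by linarith)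

end Bounds

end VortexRing

namespace VortexRing

lemma volume_real_ball (z : ℂ) {s : ℝ} (hs : 0 ≤ s) :
    volume.real (Metric.ball z s) = π * s ^ 2 := by
  rw [measureReal_def, Complex.volume_ball, ENNReal.toReal_mul, ENNReal.toReal_pow,
    ENNReal.toReal_ofReal hs, mul_comm]
  rfl

lemma volume_real_closedBall (z : ℂ) {s : ℝ} (hs : 0 ≤ s) :
    volume.real (Metric.closedBall z s) = π * s ^ 2 := by
  rw [measureReal_def, Complex.volume_closedBall, ENNReal.toReal_mul, ENNReal.toReal_pow,
    ENNReal.toReal_ofReal hs, mul_comm]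
  rfl

lemma integral_re_ball (z : ℝ) (s : ℝ) :
    ∫ x in Metric.ball (z : ℂ) s, x.re = z * volume.real (Metric.ball (z : ℂ) s) := by
  have hpre : mirror z ⁻¹' Metric.ball (z : ℂ) s = Metric.ball (z : ℂ) s := by
    ext x
    have : mirror z z = z := by apply Complex.ext <;> simp; ring
    rw [Set.mem_preimage, mem_ball_iff_norm, mem_ball_iff_norm,
      ← norm_mirror_sub_mirror z x z, this]
  have h := (measurePreserving_mirror z).setIntegral_preimage_emb (measurableEmbedding_mirror z)
    (fun x => x.re) (Metric.ball (z : ℂ) s)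
  rw [hpre] at h
  simp only [mirror_re] at h
  have hfin : volume (Metric.ball (z : ℂ) s) ≠ ⊤ := measure_ball_lt_top.ne
  have hfi : IntegrableOn (fun x : ℂ => x.re) (Metric.ball (z : ℂ) s) :=
    (Complex.continuous_re.continuousOn.integrableOn_compact
      (isCompact_closedBall (z : ℂ) s)).mono_set Metric.ball_subset_closedBall
  have hc : IntegrableOn (fun _ : ℂ => 2 * z) (Metric.ball (z : ℂ) s) := integrableOn_const hfin
  rw [integral_sub hc hfi, setIntegral_const, smul_eq_mul] at h
  linarith

namespace RingData

variable {κ W δ ε μ : ℝ} {A : Set ℂ} {ψ : ℂ → ℝ} {p : ℝ}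

/-- If a disc contained in the cross-section exhausts it up to measure `E`, then so does the disc
with the same center and the radius determined by the circulation. -/
lemma volume_symmDiff_le (R : RingData κ W δ ε μ A ψ p) {z s E : ℝ} (hs : 0 < s)
    (hsub : Metric.ball (z : ℂ) s ⊆ A) (hE : volume.real A ≤ π * s ^ 2 + E) :
    δ ≤ z ∧ volume.real (symmDiff A (Metric.ball (z : ℂ) (ε * √(κ / (π * z)))))
      ≤ (1 + 1 / δ ^ 2) * E := by
  have hδ := R.delta_pos
  have hκ := R.kappa_pos
  have hε := R.eps_pos
  have hz : δ ≤ z := by simpa using (R.strip z (hsub (Metric.mem_ball_self hs))).1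
  refine ⟨hz, ?_⟩
  have hz0 : 0 < z := hδ.trans_le hz
  set B := Metric.ball (z : ℂ) s with hB
  set s₀ := ε * √(κ / (π * z)) with hs₀
  have hs₀0 : 0 ≤ s₀ := by positivity
  have hs₀2 : π * s₀ ^ 2 * z = κ * ε ^ 2 := by
    rw [hs₀, mul_pow, Real.sq_sqrt (by positivity)]
    field_simp
  have hBm : MeasurableSet B := Metric.isOpen_ball.measurableSet
  have hdiff : volume.real (A \ B) ≤ E := by
    rw [measureReal_sdiff hsub hBm R.volume_ne_top, volume_real_ball _ hs.le]
    linarith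
  have hE0 : 0 ≤ E := measureReal_nonneg.trans hdiff
  have hsplit : ∫ x in A, x.re = z * (π * s ^ 2) + ∫ x in A \ B, x.re := by
    rw [← volume_real_ball (z : ℂ) hs.le, ← integral_re_ball,
      ← setIntegral_union Set.disjoint_sdiff_right (R.measurableSet.diff hBm)
        (R.integrableOn_re.mono_set hsub) (R.integrableOn_re.mono_set Set.sdiff_subset),
      Set.union_sdiff_cancel hsub]
  have hI0 : 0 ≤ ∫ x in A \ B, x.re :=
    setIntegral_nonneg (R.measurableSet.diff hBm) fun x hx => (R.re_pos hx.1).le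
  have hI1 : ∫ x in A \ B, x.re ≤ E / δ := by
    have hfin : volume (A \ B) ≠ ⊤ := measure_ne_top_of_subset Set.sdiff_subset R.volume_ne_top
    have := setIntegral_mono_on (R.integrableOn_re.mono_set Set.sdiff_subset)
      (integrableOn_const hfin) (R.measurableSet.diff hBm)
      (fun x (hx : x ∈ A \ B) => (R.strip x hx.1).2)
    rw [setIntegral_const, smul_eq_mul] at this
    refine this.trans ?_
    rw [mul_one_div]
    gcongr
  have hgap : (π * s₀ ^ 2 - π * s ^ 2) * z = ∫ x in A \ B, x.re := by
    have := R.circ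
    rw [hsplit] at this
    linarith
  have hgap0 : 0 ≤ π * s₀ ^ 2 - π * s ^ 2 := by
    by_contra hcon
    push Not at hcon
    have := mul_neg_of_neg_of_pos hcon hz0
    linarith
  have hgap1 : π * s₀ ^ 2 - π * s ^ 2 ≤ 1 / δ ^ 2 * E := by
    have h1 : (π * s₀ ^ 2 - π * s ^ 2) * δ ≤ E / δ :=
      (mul_le_mul_of_nonneg_left hz hgap0).trans (hgap.le.trans hI1)
    rw [le_div_iff₀ hδ] at h1
    rw [one_div, inv_mul_eq_div, le_div_iff₀ (by positivity)]
    linarith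
  have hle : s ≤ s₀ := by
    refine le_of_sq_le_sq ?_ hs₀0
    have := Real.pi_pos
    nlinarith
  have hBB : B ⊆ Metric.ball (z : ℂ) s₀ := Metric.ball_subset_ball hle
  have hsymm : symmDiff A (Metric.ball (z : ℂ) s₀) ⊆ (A \ B) ∪ (Metric.ball (z : ℂ) s₀ \ B) := by
    rintro x (⟨h1, h2⟩ | ⟨h1, h2⟩)
    · exact Or.inl ⟨h1, fun h => h2 (hBB h)⟩
    · exact Or.inr ⟨h1, fun h => h2 (hsub h)⟩
  have hfin : volume ((A \ B) ∪ (Metric.ball (z : ℂ) s₀ \ B)) ≠ ⊤ :=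
    measure_ne_top_of_subset (Set.union_subset_union Set.sdiff_subset Set.sdiff_subset)
      (measure_union_lt_top R.volume_ne_top.lt_top measure_ball_lt_top).ne
  refine (measureReal_mono hsymm hfin).trans ((measureReal_union_le _ _).trans ?_)
  have : volume.real (Metric.ball (z : ℂ) s₀ \ B) = π * s₀ ^ 2 - π * s ^ 2 := by
    rw [measureReal_sdiff hBB hBm measure_ball_lt_top.ne, volume_real_ball _ hs.le, volume_real_ball _ hs₀0]
  rw [this]
  linarith

end RingData

end VortexRing

namespace VortexRing

lemma norm_baseT_bounds {p D : ℝ} (hp : 0 < p) (haD : 3 / (8 * p) * D ≤ 1 / 64) {x : ℂ}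
    (hx : ‖x - p‖ ≤ D) :
    64 / 65 * ‖x - p‖ ≤ ‖baseT p x‖ ∧ ‖baseT p x‖ ≤ 64 / 63 * ‖x - p‖ := by
  have h1 : ‖((3 / (8 * p) : ℝ) : ℂ) * (x - p)‖ ≤ 1 / 64 := by
    rw [norm_mul, Complex.norm_real, Real.norm_eq_abs, abs_of_pos (by positivity)]
    exact (mul_le_mul_of_nonneg_left hx (by positivity)).trans haD
  set w := ((3 / (8 * p) : ℝ) : ℂ) * (x - p)
  have h2 : 63 / 64 ≤ ‖1 - w‖ := by
    have := norm_sub_norm_le 1 w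
    rw [norm_one] at this
    linarith
  have h3 : ‖1 - w‖ ≤ 65 / 64 := by
    have := norm_sub_le 1 w
    rw [norm_one] at this
    linarith
  have h4 := norm_nonneg (x - p)
  rw [baseT_eq, norm_div, le_div_iff₀ (by linarith), div_le_iff₀ (by linarith)]
  constructor <;> nlinarith

/-- A set that in the base chart is comparable with discs about `c` contains a disc exhausting it
up to a small measure. -/
lemma exists_disc_subset {A : Set ℂ} {p δ D c G : ℝ} (hδ : 0 < δ) (h1 : δ ≤ p) (h2 : p ≤ 1 / δ)
    (hD : 0 < D) (hs : 4 * D * (1 / δ + 1) ≤ 1 / 32) (hA : ∀ x ∈ A, ‖x - p‖ ≤ D)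
    (hfar : ∃ x ∈ A, 31 / 32 * D ≤ ‖x - p‖) (hc : |c| ≤ D / 64) (hG0 : 0 ≤ G)
    (hG : G ≤ D ^ 2 / 512)
    (hmem : ∀ x ∈ A, ∀ y : ℂ, ‖y - p‖ ≤ 4 * D →
      G ≤ ‖baseT p x - c‖ ^ 2 - ‖baseT p y - c‖ ^ 2 → y ∈ A) :
    ∃ z s : ℝ, 0 < s ∧ Metric.ball (z : ℂ) s ⊆ A ∧ |z - p| ≤ 3 * |c| + 3 * (1 / δ * D ^ 2) ∧
      volume.real A ≤ π * s ^ 2 + 3 * π * G ∧ 2 / 5 * D ^ 2 ≤ s ^ 2 := by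
  have hp : 0 < p := hδ.trans_le h1
  have ha0 : 0 ≤ 3 / (8 * p) := by positivity
  have haδ : 3 / (8 * p) ≤ 1 / δ := by
    rw [div_le_div_iff₀ (by positivity) hδ]
    linarith
  have haD : 3 / (8 * p) * D ≤ 1 / 64 := by
    have := mul_le_mul_of_nonneg_right haδ hD.le
    linarith
  have hden : ∀ x : ℂ, ‖x - p‖ ≤ 4 * D → 1 - ((3 / (8 * p) : ℝ) : ℂ) * (x - p) ≠ 0 := fun x hx =>
    (mob_base hδ h1 h2 (by linarith) hs).denom_ne_zero hx
  have hup : ∀ x ∈ A, ‖baseT p x - c‖ ^ 2 ≤ 11 / 10 * D ^ 2 := fun x hx => by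
    have h3 := (norm_baseT_bounds hp haD (hA x hx)).2
    have h4 := norm_sub_le (baseT p x) c
    rw [Complex.norm_real, Real.norm_eq_abs] at h4
    have h5 : ‖baseT p x - c‖ ≤ 26 / 25 * D := by linarith [hA x hx]
    have := pow_le_pow_left₀ (norm_nonneg _) h5 2
    nlinarith
  set S := (fun x : ℂ => ‖baseT p x - c‖ ^ 2) '' A with hS
  have hbdd : BddAbove S := ⟨11 / 10 * D ^ 2, by rintro _ ⟨x, hx, rfl⟩; exact hup x hx⟩
  obtain ⟨x₁, hx₁, hfar⟩ := hfar
  have hne : S.Nonempty := ⟨_, x₁, hx₁, rfl⟩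
  set ρ' := sSup S with hρ'
  have hle : ∀ x ∈ A, ‖baseT p x - c‖ ^ 2 ≤ ρ' := fun x hx => le_csSup hbdd ⟨x, hx, rfl⟩
  have hρ'1 : ρ' ≤ 11 / 10 * D ^ 2 :=
    csSup_le hne (by rintro _ ⟨x, hx, rfl⟩; exact hup x hx)
  have hρ'0 : 3 / 5 * D ^ 2 ≤ ρ' := by
    refine le_trans ?_ (hle x₁ hx₁)
    have h3 := (norm_baseT_bounds hp haD (hA x₁ hx₁)).1
    have h4 := norm_sub_norm_le (baseT p x₁) c
    rw [Complex.norm_real, Real.norm_eq_abs] at h4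
    have h5 : 9 / 10 * D ≤ ‖baseT p x₁ - c‖ := by linarith
    have := pow_le_pow_left₀ (by positivity) h5 2
    nlinarith
  have hD2 : 0 < D ^ 2 := by positivity
  set ρ := ρ' - G with hρ
  have hρ0 : 11 / 20 * D ^ 2 ≤ ρ := by linarith
  have hρ1 : ρ ≤ 2 * D ^ 2 := by linarith
  have hq := discQ_mem ha0 hD haD hc (by linarith) hρ1
  have hq' := discQ_mem ha0 hD haD hc (by linarith) (show ρ' ≤ 2 * D ^ 2 by linarith)
  have hz := discCenter_le ha0 hD haD hc (by linarith) hρ1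
  have hr := discRadius_sq_sub_le ha0 hD haD hc (by linarith) (show ρ ≤ ρ' by linarith)
    (show ρ' ≤ 2 * D ^ 2 by linarith)
  have hsub := fun y : ℂ => norm_baseT_sub_sq_lt (p := p) (x := y)
    (show 0 < discQ (3 / (8 * p)) c ρ by linarith) (show 0 ≤ ρ by linarith)
  have hsup := fun y : ℂ => norm_sub_le_of_norm_baseT_sub_sq_le (p := p) (x := y) (ρ := ρ')
    (show 0 < discQ (3 / (8 * p)) c ρ' by linarith)
  set q := discQ (3 / (8 * p)) c ρ
  set q' := discQ (3 / (8 * p)) c ρ'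
  set t := discG (3 / (8 * p)) c ρ / q
  have hsq : (√ρ / q) ^ 2 = ρ / q ^ 2 := by rw [div_pow, Real.sq_sqrt (by linarith)]
  have hsq' : (√ρ' / q') ^ 2 = ρ' / q' ^ 2 := by rw [div_pow, Real.sq_sqrt (by linarith)]
  have haD2 : 3 / (8 * p) * D ^ 2 ≤ D / 64 := by
    have := mul_le_mul_of_nonneg_right haD hD.le
    linarith
  refine ⟨p + t, √ρ / q, div_pos (Real.sqrt_pos.2 (by linarith)) (by linarith), ?_, ?_, ?_, ?_⟩
  · intro y hy
    rw [mem_ball_iff_norm] at hy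
    have hrad : √ρ / q ≤ 2 * D := by
      rw [div_le_iff₀ (by linarith)]
      apply Real.sqrt_le_iff.2 ⟨by nlinarith, ?_⟩
      have h3 : (9 / 5 * D) ^ 2 ≤ (2 * D * q) ^ 2 :=
        pow_le_pow_left₀ (by positivity) (by nlinarith) 2
      nlinarith
    have hy4 : ‖y - p‖ ≤ 4 * D := by
      have h3 : y - p = (y - ((p + t : ℝ) : ℂ)) + (t : ℂ) := by push_cast; ring
      have h4 := norm_add_le (y - ((p + t : ℝ) : ℂ)) (t : ℂ)
      rw [← h3, Complex.norm_real, Real.norm_eq_abs] at h4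
      linarith
    have h3 := hsub y (hden y hy4) hy
    obtain ⟨_, ⟨x, hx, rfl⟩, h4⟩ :=
      exists_lt_of_lt_csSup hne (show ‖baseT p y - c‖ ^ 2 + G < sSup S by linarith)
    exact hmem x hx y hy4 (by simp only at h4; linarith)
  · rw [add_sub_cancel_left]
    have := mul_le_mul_of_nonneg_right haδ hD2.le
    linarith
  · have hAsub : A ⊆ Metric.closedBall
        ((p + discG (3 / (8 * p)) c ρ' / q' : ℝ) : ℂ) (√ρ' / q') := fun x hx => by
      rw [mem_closedBall_iff_norm]
      exact hsup x (hden x ((hA x hx).trans (by linarith))) (hle x hx)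
    have h3 := measureReal_mono (μ := volume) hAsub measure_closedBall_lt_top.ne
    rw [volume_real_closedBall _ (div_nonneg (Real.sqrt_nonneg _) (by linarith)), hsq'] at h3
    rw [hsq]
    have h4 := mul_le_mul_of_nonneg_left hr Real.pi_pos.le
    rw [show ρ' - ρ = G from sub_sub_cancel ρ' G, mul_sub] at h4
    calc volume.real A ≤ π * (ρ' / q' ^ 2) := h3
      _ ≤ π * (ρ / q ^ 2) + π * (3 * G) := by rwa [← sub_le_iff_le_add']
      _ = _ := by ring
  · have hq0 : 0 < q := by linarith
    rw [hsq, le_div_iff₀ (by positivity)]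
    have : q ^ 2 ≤ (11 / 10) ^ 2 := pow_le_pow_left₀ (by linarith) hq.2 2
    have := mul_le_mul_of_nonneg_left this (show 0 ≤ 2 / 5 * D ^ 2 by positivity)
    linarith

/-- The cross-section contains a disc exhausting it up to a small measure. -/
lemma exists_disc_approx (κ W δ : ℝ) (hκ : 0 < κ) (hW : 0 < W) (hδ : 0 < δ) :
    ∃ L₀ : ℝ, ∃ C > 0, ∀ ε μ A ψ p, RingData κ W δ ε μ A ψ p → L₀ ≤ Real.log (1 / ε) →
      ∃ z s : ℝ, 0 < s ∧ Metric.ball (z : ℂ) s ⊆ A ∧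
        |z - p| ≤ C * (ε ^ 2 * Real.log (1 / ε)) ∧
        volume.real A ≤ π * s ^ 2 + C * (ε ^ 4 * Real.log (1 / ε)) := by
  obtain ⟨K, hK, d, hd, h⟩ := exists_ball_comparison κ W δ hκ hW hδ
  obtain ⟨L₀, hL₀⟩ := exists_log_mul_dist_le κ W δ (min (d / 4) (1 / (131072 * K)))
    (by positivity)
  refine ⟨L₀, (48 * K + 3 / δ) * (κ / δ) + 768 * π * K * (κ / δ) ^ 2, by positivity, ?_⟩
  intro ε μ A ψ p R hL
  have hε := R.eps_pos
  have hL1 := R.one_le_log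
  have hb := hL₀ ε μ A ψ p R hL
  have hlog := R.one_le_log
  set L := Real.log (1 / ε)
  set S := (fun x : ℂ => ‖x - p‖) '' A with hS
  have hb1 : ∀ x ∈ A, ‖x - p‖ ≤ min (d / 4) (1 / (131072 * K)) / L := fun x hx => by
    rw [le_div_iff₀ (by linarith), mul_comm]
    exact hb x hx
  have hbdd : BddAbove S := ⟨_, by rintro _ ⟨x, hx, rfl⟩; exact hb1 x hx⟩
  have hne : S.Nonempty := ⟨_, p, R.mem, rfl⟩
  set D := sSup S with hDdef
  have hA : ∀ x ∈ A, ‖x - p‖ ≤ D := fun x hx => le_csSup hbdd ⟨x, hx, rfl⟩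
  have hDle : D ≤ min (d / 4) (1 / (131072 * K)) / L :=
    csSup_le hne (by rintro _ ⟨x, hx, rfl⟩; exact hb1 x hx)
  have hD : 0 < D := by
    obtain ⟨r, hr, hrA⟩ := Metric.isOpen_iff.1 R.isOpen p R.mem
    have : ((p : ℂ) + (r / 2 : ℝ)) ∈ A := hrA (by
      rw [mem_ball_iff_norm, add_sub_cancel_left, Complex.norm_real, Real.norm_eq_abs,
        abs_of_pos (by linarith)]
      linarith)
    have h1 := hA _ this
    rw [add_sub_cancel_left, Complex.norm_real, Real.norm_eq_abs, abs_of_pos (by linarith)] at h1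
    linarith
  have hLD : D * L ≤ min (d / 4) (1 / (131072 * K)) := (le_div_iff₀ (by linarith)).1 hDle
  have hDd : D * L ≤ d / 4 := hLD.trans (min_le_left _ _)
  have hDK : K * (D * L) ≤ 1 / 131072 := by
    have := mul_le_mul_of_nonneg_left (hLD.trans (min_le_right _ _)) hK.le
    have e : K * (1 / (131072 * K)) = 1 / 131072 := by field_simp
    linarith
  have hDL : D ≤ D * L := le_mul_of_one_le_right hD.le hL1
  obtain ⟨hs, hc, hmem⟩ := h ε μ A ψ p (4 * D) R (fun x hx => (hA x hx).trans (by linarith))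
    (by linarith) (by linarith)
  have hD128 : D ≤ 1 / 128 := by
    have : 0 ≤ D * (1 / δ) := by positivity
    linarith
  have hfar : ∃ x ∈ A, 31 / 32 * D ≤ ‖x - p‖ := by
    obtain ⟨_, ⟨x, hx, rfl⟩, hlt⟩ := exists_lt_of_lt_csSup hne
      (show 31 / 32 * D < sSup S by linarith)
    exact ⟨x, hx, hlt.le⟩
  have hc1 : |baseCent A p| ≤ D / 64 := by
    refine hc.trans ?_
    have := mul_le_mul_of_nonneg_right hDK hD.le
    nlinarith
  have hG : K * (L * (4 * D) ^ 4) ≤ D ^ 2 / 512 := by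
    have h1 : K * (D * L) * (D ^ 2 * D) ≤ 1 / 131072 * (D ^ 2 * 1) := by
      gcongr
      linarith
    nlinarith
  obtain ⟨z, s, hs0, hsub, hz, hvol, hDs⟩ := exists_disc_subset hδ R.p_mem.1 R.p_mem.2 hD hs hA
    hfar hc1 (by positivity) hG hmem
  refine ⟨z, s, hs0, hsub, ?_, ?_⟩
  all_goals
    have hDε : D ^ 2 ≤ κ / δ * ε ^ 2 := by
      have h1 := measureReal_mono (μ := volume) hsub R.volume_ne_top
      rw [volume_real_ball _ hs0.le] at h1
      have h2 := h1.trans R.volume_le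
      have h3 := Real.pi_gt_three
      nlinarith [sq_nonneg D]
    have hκδ : 0 < κ / δ := by positivity
  · have h1 : |baseCent A p| ≤ 16 * K * L * (κ / δ * ε ^ 2) := by
      refine hc.trans ?_
      have : K * (L * (4 * D) ^ 2) = 16 * K * L * D ^ 2 := by ring
      rw [this]
      gcongr
    have h2 : 1 / δ * D ^ 2 ≤ 1 / δ * (κ / δ * ε ^ 2) * L := by
      have h3 : 1 / δ * D ^ 2 ≤ 1 / δ * (κ / δ * ε ^ 2) := by gcongr
      exact h3.trans (le_mul_of_one_le_right (by positivity) hL1)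
    have h3 : 0 ≤ 768 * π * K * (κ / δ) ^ 2 * (ε ^ 2 * L) := by positivity
    refine hz.trans ?_
    have e : ((48 * K + 3 / δ) * (κ / δ) + 768 * π * K * (κ / δ) ^ 2) * (ε ^ 2 * L)
        = 3 * (16 * K * L * (κ / δ * ε ^ 2)) + 3 * (1 / δ * (κ / δ * ε ^ 2) * L)
          + 768 * π * K * (κ / δ) ^ 2 * (ε ^ 2 * L) := by ring
    rw [e]
    linarith
  · have h1 : D ^ 4 ≤ (κ / δ * ε ^ 2) ^ 2 := by
      have := pow_le_pow_left₀ (by positivity) hDε 2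
      rwa [← pow_mul] at this
    have h2 : 3 * π * (K * (L * (4 * D) ^ 4)) ≤ 768 * π * K * L * (κ / δ * ε ^ 2) ^ 2 := by
      have e : 3 * π * (K * (L * (4 * D) ^ 4)) = 768 * π * K * L * D ^ 4 := by ring
      rw [e]
      gcongr
    have h3 : 0 ≤ (48 * K + 3 / δ) * (κ / δ) * (ε ^ 4 * L) := by positivity
    refine hvol.trans ?_
    have e : ((48 * K + 3 / δ) * (κ / δ) + 768 * π * K * (κ / δ) ^ 2) * (ε ^ 4 * L)
        = (48 * K + 3 / δ) * (κ / δ) * (ε ^ 4 * L)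
          + 768 * π * K * L * (κ / δ * ε ^ 2) ^ 2 := by ring
    rw [e]
    linarith

theorem exists_ball_approx (κ W δ : ℝ) (hκ : 0 < κ) (hW : 0 < W) (hδ : 0 < δ) :
    ∃ L₀ : ℝ, ∃ C > 0, ∀ ε μ A ψ p, RingData κ W δ ε μ A ψ p → L₀ ≤ Real.log (1 / ε) →
      ∃ z : ℝ, 0 < z ∧ |z - p| ≤ C * (ε ^ 2 * Real.log (1 / ε)) ∧
        volume.real (symmDiff A (Metric.ball (z : ℂ) (ε * √(κ / (π * z)))))
          ≤ C * (ε ^ 4 * Real.log (1 / ε)) := by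
  obtain ⟨L₀, C, hC, h⟩ := exists_disc_approx κ W δ hκ hW hδ
  refine ⟨L₀, (1 + 1 / δ ^ 2) * C, by positivity, fun ε μ A ψ p R hL => ?_⟩
  obtain ⟨z, s, hs, hsub, hz, hvol⟩ := h ε μ A ψ p R hL
  obtain ⟨h1, h2⟩ := R.volume_symmDiff_le hs hsub hvol
  have hL1 := R.one_le_log
  have hε := R.eps_pos
  refine ⟨z, hδ.trans_le h1, hz.trans ?_, h2.trans_eq (by ring)⟩
  gcongr
  exact le_mul_of_one_le_left hC.le (by have : 0 ≤ 1 / δ ^ 2 := by positivity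
                                        linarith)

end VortexRing

namespace VortexRing

/-- The identification of the complex numbers with the plane. -/
def toPlane : ℂ ≃ₗᵢ[ℝ] Plane := Complex.orthonormalBasisOneI.repr

lemma toPlane_zero (x : ℂ) : toPlane x 0 = x.re := by
  simp [toPlane, Complex.orthonormalBasisOneI_repr_apply]

lemma toPlane_one (x : ℂ) : toPlane x 1 = x.im := by
  simp [toPlane, Complex.orthonormalBasisOneI_repr_apply]

lemma toPlane_eq_mk2 (x : ℂ) : toPlane x = mk2 x.re x.im := by
  ext i
  fin_cases i
  · exact toPlane_zero x
  · exact toPlane_one x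

lemma toPlane_ofReal (a : ℝ) : toPlane a = mk2 a 0 := by
  rw [toPlane_eq_mk2, Complex.ofReal_re, Complex.ofReal_im]

lemma Gstar_toPlane (x x' : ℂ) : Gstar (toPlane x) (toPlane x') = greenC x x' := by
  simp only [Gstar, greenC, toPlane_zero, toPlane_one]

lemma setIntegral_preimage_toPlane (f : Plane → ℝ) (A : Set Plane) :
    ∫ x in toPlane ⁻¹' A, f (toPlane x) = ∫ x in A, f x :=
  toPlane.measurePreserving.setIntegral_preimage_emb
    toPlane.toHomeomorph.measurableEmbedding f A

lemma volume_preimage_toPlane (A : Set Plane) : volume (toPlane ⁻¹' A) = volume A :=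
  toPlane.measurePreserving.measure_preimage_emb toPlane.toHomeomorph.measurableEmbedding A

lemma isOpen_crossSection {ψ : Plane → ℝ} {ε W μ : ℝ} (h : ContinuousOn ψ halfPlane) :
    IsOpen (crossSection ψ ε W μ) := by
  have hopen : IsOpen halfPlane := isOpen_lt continuous_const (by fun_prop)
  have hc : ContinuousOn (fun x : Plane => ψ x - W / 2 * (x 0) ^ 2 * Real.log (1 / ε))
      halfPlane := h.sub (by fun_prop)
  exact hc.isOpen_inter_preimage hopen isOpen_Ioi

/-- The data of a vortex ring in complex coordinates. -/
lemma ringData_of_stream {κ W δ ε μ p : ℝ} {ψ : Plane → ℝ} (hκ : 0 < κ) (hW : 0 < W) (hδ : 0 < δ)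
    (hε : 0 < ε) (hL : 1 ≤ Real.log (1 / ε)) (hμ : 0 < μ) (hψ : IsVortexRingStream ψ ε W μ)
    (hcen : Centralized ψ) (hcirc : circulation ψ ε W μ = κ)
    (hconn : IsPreconnected (crossSection ψ ε W μ))
    (hstrip : crossSection ψ ε W μ ⊆ {x : Plane | δ ≤ x 0 ∧ x 0 ≤ 1 / δ})
    (hdiam : Metric.diam (crossSection ψ ε W μ) ≤ 1) (hp : mk2 p 0 ∈ crossSection ψ ε W μ)
    (hmax : ∀ x ∈ closure (crossSection ψ ε W μ), ψ x ≤ ψ (mk2 p 0)) :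
    RingData κ W δ ε μ (toPlane ⁻¹' crossSection ψ ε W μ) (fun x => ψ (toPlane x)) p where
  kappa_pos := hκ
  W_pos := hW
  delta_pos := hδ
  eps_pos := hε
  one_le_log := hL
  mu_pos := hμ
  isOpen := (isOpen_crossSection hψ.continuousOn).preimage toPlane.continuous
  preconn := by
    rw [← toPlane.coe_toHomeomorph]
    exact toPlane.toHomeomorph.isPreconnected_preimage.2 hconn
  strip x hx := by simpa only [Set.mem_ofPred_eq, toPlane_zero] using hstrip hx
  diam x hx y hy := by
    rw [← dist_eq_norm, ← toPlane.dist_map]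
    exact (Metric.dist_le_diam_of_mem hψ.bounded hx hy).trans hdiam
  level x hx := by
    simp only [Set.mem_preimage, crossSection, halfPlane, Set.mem_ofPred_eq, toPlane_zero, hx,
      true_and, lt_sub_iff_add_lt]
  repr x hx := by
    rw [hψ.repr _ (show 0 < toPlane x 0 by rwa [toPlane_zero]), ← setIntegral_preimage_toPlane]
    simp only [Gstar_toPlane]
  symm x hx := by
    have h1 : toPlane ((starRingEnd ℂ) x) 0 = toPlane x 0 := by simp [toPlane_zero]
    have h2 : ψ (toPlane ((starRingEnd ℂ) x)) = ψ (toPlane x) := by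
      rw [toPlane_eq_mk2, toPlane_eq_mk2 x, Complex.conj_re, Complex.conj_im]
      exact hcen _ _
    simpa only [Set.mem_preimage, crossSection, halfPlane, Set.mem_ofPred_eq, h1, h2] using hx
  circ := by
    rw [← hcirc, circulation, div_mul_cancel₀ _ (by positivity), ← setIntegral_preimage_toPlane]
    simp only [toPlane_zero]
  mem := by rwa [Set.mem_preimage, toPlane_ofReal]
  max x hx := by
    rw [toPlane_ofReal]
    exact hmax _ (subset_closure hx)

end VortexRing

/-- **Refined localization of the cross-section** (Lemma 3.14). For a centralized steady
vortex ring of small cross-section with circulation `κ` and maximum point `p = (p₁,0)`,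
there is `z₁` with `|z₁ − p₁| ≤ C ε² ln(1/ε)` such that the cross-section differs from the
ball `B_{s₀}((z₁,0))`, `s₀ = ε √(κ/(π z₁))`, by a set of measure at most `C ε⁴ ln(1/ε)`. -/
theorem refined_localization (κ W δ₀ m₀ : ℝ)
    (hκ : 0 < κ) (hW : 0 < W) (hδ₀ : 0 < δ₀) (hm₀ : 0 < m₀) :
    ∃ ε₀ > (0 : ℝ), ∃ d₀ > (0 : ℝ), ∃ C > (0 : ℝ), ∀ ε ∈ Set.Ioc (0 : ℝ) ε₀,
      ∀ ψ : Plane → ℝ, ∀ μ : ℝ, m₀ ≤ μ →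
        IsVortexRingStream ψ ε W μ → Centralized ψ →
        circulation ψ ε W μ = κ →
        SimplyConnectedSpace ↥(crossSection ψ ε W μ) →
        crossSection ψ ε W μ ⊆ {x : Plane | δ₀ ≤ x 0 ∧ x 0 ≤ 1 / δ₀} →
        Metric.diam (crossSection ψ ε W μ) ≤ d₀ →
        ∀ p₁ : ℝ, mk2 p₁ 0 ∈ crossSection ψ ε W μ →
          (∀ x ∈ closure (crossSection ψ ε W μ), ψ x ≤ ψ (mk2 p₁ 0)) →
          ∃ z₁ : ℝ, 0 < z₁ ∧ |z₁ - p₁| ≤ C * ε ^ 2 * Real.log (1 / ε) ∧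
            (volume (symmDiff (crossSection ψ ε W μ)
                (Metric.ball (mk2 z₁ 0) (ε * Real.sqrt (κ / (π * z₁)))))).toReal
              ≤ C * ε ^ 4 * Real.log (1 / ε) := by
  obtain ⟨L₀, C, hC, h⟩ := VortexRing.exists_ball_approx κ W δ₀ hκ hW hδ₀
  refine ⟨Real.exp (-max L₀ 1), Real.exp_pos _, 1, one_pos, C, hC, ?_⟩
  intro ε hε ψ μ hμ hψ hcen hcirc hconn hstrip hdiam p₁ hp hmax
  have hL : max L₀ 1 ≤ Real.log (1 / ε) := by
    rw [one_div, Real.log_inv, le_neg]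
    exact (Real.log_le_iff_le_exp hε.1).2 hε.2
  have R := VortexRing.ringData_of_stream hκ hW hδ₀ hε.1 ((le_max_right _ _).trans hL)
    (hm₀.trans_le hμ) hψ hcen hcirc (isPreconnected_iff_preconnectedSpace.2 inferInstance)
    hstrip hdiam hp hmax
  obtain ⟨z, hz, h1, h2⟩ := h ε μ _ _ p₁ R ((le_max_left _ _).trans hL)
  refine ⟨z, hz, by rwa [mul_assoc], ?_⟩
  rw [mul_assoc, ← VortexRing.volume_preimage_toPlane]
  convert h2 using 2
  rw [measureReal_def, Set.preimage_symmDiff, ← VortexRing.toPlane_ofReal,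
    VortexRing.toPlane.preimage_ball, VortexRing.toPlane.symm_apply_apply]
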